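/- Let Γ be a metric graph with a fixed self-loop-free model G = (V,E), and let D ∈ |D_0| be a divisor in a complete linear system. Then D is generic (i.e. D lies in the relative interior of an inclusion-wise maximal cell of the abstract polyhedral complex |D_0|) if and only if: (1) D(x) < val(x) for all x ∈ Γ, and (2) D is V-unsaturated, meaning no closed subgraph C ⊆ Γ with ∂C ∩ V ≠ ∅ can fire with respect to D. -/

import Mathlib

open scoped ENNReal
open Set Function

namespace TropGraph

variable {G : Type*} [MetricSpace G]

/-! ### Metric graphs: length spaces with star-shaped neighbourhoods -/

/-- The length of a path, via the extended variation of its extension to `ℝ`. -/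
noncomputable def pathLength {x y : G} (g : Path x y) : ℝ≥0∞ :=
  eVariationOn (fun t : ℝ => g.extend t) (Set.Icc 0 1)

/-- The star with `v` branches of radius `ε`: a disjoint union of `v` copies of `[0, ε)`
with all the zeroes identified. -/
def starSetoid (v : ℕ) (ε : ℝ) : Setoid (Fin v × Set.Ico (0:ℝ) ε) where
  r a b := a = b ∨ ((a.2 : ℝ) = 0 ∧ (b.2 : ℝ) = 0)
  iseqv :=
    { refl := fun _ => Or.inl rfl
      symm := fun h => h.imp Eq.symm And.symm
      trans := fun h₁ h₂ => by
        rcases h₁ with rfl | h₁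
        · exact h₂
        · rcases h₂ with rfl | h₂
          · exact Or.inr h₁
          · exact Or.inr ⟨h₁.1, h₂.2⟩ }

/-- The glued star-shaped space `⊔_{i=1}^v [0, ε) / ∼`. -/
def StarGlue (v : ℕ) (ε : ℝ) : Type :=
  Quotient (starSetoid v ε)

instance (v : ℕ) (ε : ℝ) : TopologicalSpace (StarGlue v ε) := by
  unfold StarGlue; infer_instance

/-- `U` is a star-shaped neighbourhood of `x` of valence `v`. -/
def IsStarNbhdOf (x : G) (v : ℕ) (U : Set G) : Prop :=
  ∃ (ε : ℝ) (hε : 0 < ε) (φ : U ≃ₜ StarGlue v ε) (hx : x ∈ U),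
    ∀ i : Fin v, φ ⟨x, hx⟩ = Quotient.mk (starSetoid v ε) (i, ⟨0, le_rfl, hε⟩)

/-- A metric graph: a compact length space in which every point has a star-shaped
neighbourhood. -/
def IsMetricGraph (X : Type*) [MetricSpace X] : Prop :=
  CompactSpace X ∧
  (∀ x y : X, edist x y = ⨅ g : Path x y, pathLength g) ∧
  ∀ x : X, ∃ (v : ℕ) (U : Set X), U ∈ nhds x ∧ IsStarNbhdOf x v U

/-- `x` has valence `v`. -/
def HasValence (x : G) (v : ℕ) : Prop :=
  ∃ U ∈ nhds x, IsStarNbhdOf x v U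

/-! ### Rational functions, tangent directions, orders and divisors -/

/-- `g` is a unit speed (isometric) path of length `ε` starting at `x`. -/
def IsUnitSpeedFrom (x : G) (ε : ℝ) (g : ℝ → G) : Prop :=
  g 0 = x ∧ ∀ s ∈ Set.Ico (0:ℝ) ε, ∀ t ∈ Set.Ico (0:ℝ) ε, dist (g s) (g t) = |s - t|

/-- `f` has (integer) slope `s` along the path `g` near its starting point. -/
def HasSlopeAlong (f : G → ℝ) (g : ℝ → G) (s : ℤ) : Prop :=
  ∃ δ > (0:ℝ), ∀ t ∈ Set.Ico (0:ℝ) δ, f (g t) = f (g 0) + s * t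

/-- A rational function: continuous, and linear with integer slope along every direction
near every point.  (On a compact metric graph this coincides with being continuous
piecewise linear with integer slopes.) -/
def IsRational (f : G → ℝ) : Prop :=
  Continuous f ∧ ∀ (x : G) (ε : ℝ) (g : ℝ → G), 0 < ε → IsUnitSpeedFrom x ε g →
    ∃ s : ℤ, HasSlopeAlong f g s

/-- Unit speed paths emanating from `x`. -/
def UnitPath (x : G) : Type _ :=
  {g : ℝ → G // ∃ ε > (0:ℝ), IsUnitSpeedFrom x ε g}

/-- Two unit speed paths are equivalent when they agree near `0`. -/
def germSetoid (x : G) : Setoid (UnitPath x) where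
  r g₁ g₂ := ∃ δ > (0:ℝ), ∀ t ∈ Set.Ico (0:ℝ) δ, g₁.1 t = g₂.1 t
  iseqv := by
    constructor
    · intro g
      obtain ⟨ε, hε, _⟩ := g.2
      exact ⟨ε, hε, fun t _ => rfl⟩
    · rintro g₁ g₂ ⟨δ, hδ, h⟩
      exact ⟨δ, hδ, fun t ht => (h t ht).symm⟩
    · rintro g₁ g₂ g₃ ⟨δ₁, hδ₁, h₁⟩ ⟨δ₂, hδ₂, h₂⟩
      refine ⟨min δ₁ δ₂, lt_min hδ₁ hδ₂, fun t ht => ?_⟩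
      have ht' := Set.mem_Ico.mp ht
      rw [h₁ t (Set.mem_Ico.mpr ⟨ht'.1, lt_of_lt_of_le ht'.2 (min_le_left _ _)⟩),
        h₂ t (Set.mem_Ico.mpr ⟨ht'.1, lt_of_lt_of_le ht'.2 (min_le_right _ _)⟩)]

/-- The set of (unit) tangent directions at `x`: germs of unit speed paths from `x`. -/
def TangentDir (x : G) : Type _ :=
  Quotient (germSetoid x)

open scoped Classical in
/-- The outgoing slope of `f` along a tangent direction. -/
noncomputable def tangentSlope (f : G → ℝ) {x : G} (ζ : TangentDir x) : ℤ :=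
  if h : ∃ s : ℤ, HasSlopeAlong f (Quotient.out ζ).1 s then h.choose else 0

/-- The order of `f` at `x`: the sum of the outgoing slopes of `f` at `x`. -/
noncomputable def ordAt (f : G → ℝ) (x : G) : ℤ :=
  ∑ᶠ ζ : TangentDir x, tangentSlope f ζ

/-- Divisors are represented as finitely supported functions `G → ℤ`. -/
def FinSupp (D : G → ℤ) : Prop :=
  (Function.support D).Finite

/-- A divisor is effective when all its coefficients are nonnegative. -/
def Effective (D : G → ℤ) : Prop :=
  ∀ x, 0 ≤ D x

/-- The degree of a divisor. -/
noncomputable def deg (D : G → ℤ) : ℤ :=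
  ∑ᶠ x, D x

/-- The degree of the restriction of a divisor to a subset. -/
noncomputable def degOn (S : Set G) (D : G → ℤ) : ℤ :=
  ∑ᶠ x ∈ S, D x

/-- Linear equivalence of divisors: the difference is the divisor of a rational function. -/
def LinEquiv (D D' : G → ℤ) : Prop :=
  ∃ f : G → ℝ, IsRational f ∧ ∀ x, D' x = D x + ordAt f x

/-- `R(D)`: rational functions `f` with `D + div f ≥ 0`. -/
def RD (D : G → ℤ) : Set (G → ℝ) :=
  {f | IsRational f ∧ ∀ x, 0 ≤ D x + ordAt f x}

/-- The complete linear system `|D₀|` of effective divisors linearly equivalent to `D₀`. -/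
def LinSys (D₀ : G → ℤ) : Set (G → ℤ) :=
  {D | FinSupp D ∧ Effective D ∧ LinEquiv D₀ D}

/-- The oscillation `max f - min f` of a function. -/
noncomputable def osc (f : G → ℝ) : ℝ :=
  sSup (Set.range f) - sInf (Set.range f)

/-- The distance `d_∞` on a complete linear system. -/
noncomputable def linDist (D₁ D₂ : G → ℤ) : ℝ :=
  sInf {r : ℝ | ∃ f : G → ℝ, IsRational f ∧ (∀ x, D₂ x = D₁ x + ordAt f x) ∧ r = osc f}

/-- `f` is constant on `S`. -/
def ConstOn (f : G → ℝ) (S : Set G) : Prop :=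
  ∀ x ∈ S, ∀ y ∈ S, f x = f y

/-! ### Subgraphs, arcs, components, firing -/

/-- An open arc: the isometric image of a nonempty open interval. -/
def IsOpenArc (S : Set G) : Prop :=
  ∃ (a b : ℝ) (g : ℝ → G), a < b ∧
    (∀ s ∈ Set.Ioo a b, ∀ t ∈ Set.Ioo a b, dist (g s) (g t) = |s - t|) ∧
    S = g '' Set.Ioo a b

/-- The set of connected components of a subset. -/
def compsOf (S : Set G) : Set (Set G) :=
  {C | ∃ x ∈ S, C = connectedComponentIn S x}

/-- The outgoing degree of `x` with respect to a closed subgraph `Z`: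
the number of tangent directions at `x` leaving `Z`. -/
noncomputable def degOut (Z : Set G) (x : G) : ℕ :=
  Nat.card {ζ : TangentDir x //
    ∃ δ > (0:ℝ), ∀ t ∈ Set.Ioo (0:ℝ) δ, (Quotient.out ζ).1 t ∉ interior Z}

/-- A closed subgraph `Z` can fire with respect to `D` when `D(x) ≥ deg^out_Z(x)` for
all `x` on the boundary of `Z`. -/
def CanFire (D : G → ℤ) (Z : Set G) : Prop :=
  Z.Nonempty ∧ IsClosed Z ∧ (compsOf Z).Finite ∧
  ∀ x ∈ frontier Z, (degOut Z x : ℤ) ≤ D x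

/-- A `v`-reduced divisor. -/
def IsReduced (v : G) (D : G → ℤ) : Prop :=
  (∀ x, x ≠ v → 0 ≤ D x) ∧ ∀ Z : Set G, v ∉ Z → ¬CanFire D Z

/-- `D` is `V`-unsaturated: no closed subgraph whose boundary meets `V` can fire. -/
def Unsaturated (V : Set G) (D : G → ℤ) : Prop :=
  ¬∃ Z : Set G, (frontier Z ∩ V).Nonempty ∧ CanFire D Z

/-- A local maximum of `f`: a closed connected set on which `f` is constant, with a
neighbourhood on which `f` is strictly smaller outside of it. -/
def IsLocalMaxSet (f : G → ℝ) (C : Set G) : Prop :=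
  IsClosed C ∧ IsConnected C ∧ ConstOn f C ∧
  ∃ U, IsOpen U ∧ C ⊆ U ∧ ∀ x ∈ U \ C, ∀ y ∈ C, f x < f y

/-! ### Models and genus -/

/-- A model of the metric graph: a finite set of vertices whose complement is a finite
disjoint union of open arcs. -/
def IsGraphModel (V : Set G) : Prop :=
  V.Finite ∧ (compsOf Vᶜ).Finite ∧ ∀ C ∈ compsOf Vᶜ, IsOpenArc C

/-- A model has no self-loops: the closure of each open edge contains two distinct
endpoints. -/
def LoopFree (V : Set G) : Prop :=
  ∀ C ∈ compsOf Vᶜ, (closure C \ C).ncard = 2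

/-- A model of an open subgraph `U`, together with valences of its vertices inside `U`. -/
def IsModelIn (U V : Set G) (val : G → ℕ) : Prop :=
  V ⊆ U ∧ V.Finite ∧
  (∀ x ∈ V, ∃ W ∈ nhds x, W ⊆ U ∧ IsStarNbhdOf x (val x) W) ∧
  (compsOf (U \ V)).Finite ∧ (∀ C ∈ compsOf (U \ V), IsOpenArc C) ∧
  (compsOf U).Finite

/-- The genus (first Betti number) of an open subgraph `U`, i.e. of its completion:
computed from any model as `Σ val(x) - #edges - #vertices + #components`. -/
def HasGenusOpen (U : Set G) (g : ℤ) : Prop :=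
  ∃ (V : Set G) (val : G → ℕ), IsModelIn U V val ∧
    g = (∑ᶠ x ∈ V, (val x : ℤ)) - ((compsOf (U \ V)).ncard : ℤ)
        - (V.ncard : ℤ) + ((compsOf U).ncard : ℤ)

/-! ### Chip firing moves -/

/-- The open `ε`-neighbourhood of `Z`. -/
def ZNbhd (Z : Set G) (ε : ℝ) : Set G :=
  {x | Metric.infDist x Z < ε}

/-- The chip firing function `CF(Z, ε)`. -/
noncomputable def CF (Z : Set G) (ε : ℝ) : G → ℝ :=
  fun x => -min (Metric.infDist x Z) ε

/-- The data of a chip firing move: a closed subgraph with finitely many components such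
that `Z_ε \ Z` is a disjoint union of open intervals. -/
def ChipData (Z : Set G) (ε : ℝ) : Prop :=
  IsClosed Z ∧ Z.Nonempty ∧ (compsOf Z).Finite ∧
  ∀ C ∈ compsOf (ZNbhd Z ε \ Z), IsOpenArc C

/-- `h` is a chip firing move. -/
def IsCFMove (h : G → ℝ) : Prop :=
  ∃ (Z : Set G) (ε : ℝ), 0 < ε ∧ ChipData Z ε ∧ h = CF Z ε

/-- `f` is linear (with some real slope) on the open arc `C`. -/
def LinearOnArc (f : G → ℝ) (C : Set G) : Prop :=
  ∃ (a b : ℝ) (g : ℝ → G) (s c : ℝ), a < b ∧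
    (∀ u ∈ Set.Ioo a b, ∀ t ∈ Set.Ioo a b, dist (g u) (g t) = |u - t|) ∧
    C = g '' Set.Ioo a b ∧ ∀ t ∈ Set.Ioo a b, f (g t) = s * t + c

/-- A weighted chip firing move. -/
def IsWeightedCF (f : G → ℝ) : Prop :=
  IsRational f ∧ (¬∀ x y : G, f x = f y) ∧
  ∃ Z₁ Z₂ : Set G, IsClosed Z₁ ∧ IsClosed Z₂ ∧ Z₁.Nonempty ∧ Z₂.Nonempty ∧
    Disjoint Z₁ Z₂ ∧ Z₁ ≠ Set.univ ∧ Z₂ ≠ Set.univ ∧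
    (∀ C ∈ compsOf (Z₁ ∪ Z₂)ᶜ, IsOpenArc C) ∧
    ConstOn f Z₁ ∧ ConstOn f Z₂ ∧
    ∀ C ∈ compsOf (Z₁ ∪ Z₂)ᶜ, LinearOnArc f C

/-! ### Cells of the complete linear system -/

/-- The part of the support of a divisor lying in the interiors of the edges. -/
def edgeSupp (V : Set G) (D : G → ℤ) : Set G :=
  {x | x ∉ V ∧ D x ≠ 0}

/-- The dimension of the cell of `|D₀|` containing `D` in its relative interior:
the number of connected components of `Γ ∖ supp D_E`, minus one. -/
noncomputable def cellDim (V : Set G) (D : G → ℤ) : ℤ :=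
  ((compsOf (edgeSupp V D)ᶜ).ncard : ℤ) - 1

/-- Two divisors of `|D₀|` have the same combinatorial type with respect to the model `V`
(they lie in the relative interior of the same cell): equal multiplicities on the
vertices, chip configurations on the edges related by a homeomorphism fixing the
vertices and each edge, and equal slopes at all tangent directions at the vertices. -/
def SameType (V : Set G) (D₀ D₁ D₂ : G → ℤ) : Prop :=
  (∀ v ∈ V, D₁ v = D₂ v) ∧
  (∃ h : G ≃ₜ G, (∀ v ∈ V, h v = v) ∧ (∀ x ∉ V, h x ∈ connectedComponentIn Vᶜ x) ∧
    ∀ x, D₂ (h x) = D₁ x) ∧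
  (∃ f₁ f₂ : G → ℝ, IsRational f₁ ∧ IsRational f₂ ∧
    (∀ x, D₁ x = D₀ x + ordAt f₁ x) ∧ (∀ x, D₂ x = D₀ x + ordAt f₂ x) ∧
    ∀ v ∈ V, ∀ ζ : TangentDir v, tangentSlope f₁ ζ = tangentSlope f₂ ζ)

/-- `D'` lies in the closed cell `Δ_D` of `|D₀|`. -/
def InClosedCell (V : Set G) (D₀ D D' : G → ℤ) : Prop :=
  ∀ ε > (0:ℝ), ∃ D'' : G → ℤ, SameType V D₀ D D'' ∧ linDist D' D'' < ε

/-- `D` is generic in `|D₀|`: it lies in the relative interior of an inclusion-wise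
maximal cell, i.e. all sufficiently nearby divisors of `|D₀|` lie in the closed cell
of `D`. -/
def Generic (V : Set G) (D₀ D : G → ℤ) : Prop :=
  D ∈ LinSys D₀ ∧ ∃ ε > (0:ℝ), ∀ D' ∈ LinSys D₀, linDist D D' < ε → InClosedCell V D₀ D D'

/-- The rank of `D` is at least `d`: for every effective divisor `E` of degree `d`,
`|D - E|` is nonempty. -/
def rankGe (D : G → ℤ) (d : ℕ) : Prop :=
  ∀ E : G → ℤ, FinSupp E → Effective E → deg E = (d : ℤ) →
    ∃ D' : G → ℤ, FinSupp D' ∧ Effective D' ∧ LinEquiv (fun x => D x - E x) D'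

/-! ### Cycles, the canonical divisor and realizability -/

/-- A simple cycle: a subset homeomorphic to a circle. -/
def IsCycleSet (C : Set G) : Prop :=
  Nonempty (C ≃ₜ AddCircle (1 : ℝ))

/-- The canonical divisor `K + div f` for a vertex valence function `val`. -/
noncomputable def canDiv (val : G → ℕ) (f : G → ℝ) : G → ℤ :=
  fun x => (val x : ℤ) - 2 + ordAt f x

/-- The enhanced-level-graph invariant `k(ζ) = -s_ζ(f) - 1` of a tangent direction. -/
noncomputable def kVal (f : G → ℝ) {v : G} (ζ : TangentDir v) : ℤ :=
  -(tangentSlope f ζ) - 1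

/-- `v` is an inconvenient vertex of the enhanced level graph `Γ⁺(f)` (all vertex
weights `h ≡ 0`): no `k`-value equals `-1`, and some `k`-value (of a half-edge, or of
one of the `D(v)` attached legs, which carry `k = 1`) exceeds
`Σ_{k_j < 0} (-k_j) - #{k_j < 0} - 1`.  (Legs have `k = 1 > 0` and so never contribute
to the sums, and their `k`-value is `≠ -1`.) -/
def Inconvenient (val : G → ℕ) (f : G → ℝ) (v : G) : Prop :=
  (∀ ζ : TangentDir v, kVal f ζ ≠ -1) ∧
  ∃ k₀ : ℤ, ((∃ ζ : TangentDir v, kVal f ζ = k₀) ∨ (0 < canDiv val f v ∧ k₀ = 1)) ∧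
    (∑ᶠ ζ ∈ {ζ : TangentDir v | kVal f ζ < 0}, (-kVal f ζ))
      - (({ζ : TangentDir v | kVal f ζ < 0}).ncard : ℤ) - 1 < k₀

/-- The realizability criterion of Möller–Ulirsch–Werner for the effective canonical
divisor `K + div f`: every inconvenient vertex, and every open arc on which `f` is
constant, away from the bends of `f` and from higher-valence points, is contained in a
simple cycle lying above it. -/
def RealizableFn (val : G → ℕ) (f : G → ℝ) : Prop :=
  (∀ v, Inconvenient val f v →
    ∃ Z : Set G, IsCycleSet Z ∧ v ∈ Z ∧ ∀ z ∈ Z, f v ≤ f z) ∧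
  (∀ A : Set G, IsOpenArc A → ConstOn f A → (∀ x ∈ A, ordAt f x = 0 ∧ val x = 2) →
    ∃ Z : Set G, IsCycleSet Z ∧ A ⊆ Z ∧ ∀ z ∈ Z, ∀ a ∈ A, f a ≤ f z)

/-- The realizability locus inside the canonical linear system. -/
def RealSet (val : G → ℕ) : Set (G → ℤ) :=
  {D | ∃ f : G → ℝ, IsRational f ∧ (∀ x, D x = (val x : ℤ) - 2 + ordAt f x) ∧
    RealizableFn val f}

/-! ### Tropical linear series -/

/-- The cone `R(𝔡, D)` of rational functions `f` with `D + div f ∈ 𝔡`. -/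
def coneOf (D : G → ℤ) (𝔡 : Set (G → ℤ)) : Set (G → ℝ) :=
  {f | IsRational f ∧ (fun x => D x + ordAt f x) ∈ 𝔡}

/-- A tropical linear series: a tropically convex subset of a complete linear system,
i.e. one whose cone of rational functions is a tropical submodule. -/
def TropLinearSeries (D₀ : G → ℤ) (𝔡 : Set (G → ℤ)) : Prop :=
  𝔡 ⊆ LinSys D₀ ∧
  (∀ f ∈ coneOf D₀ 𝔡, ∀ g ∈ coneOf D₀ 𝔡, (fun x => max (f x) (g x)) ∈ coneOf D₀ 𝔡) ∧
  (∀ c : ℝ, ∀ f ∈ coneOf D₀ 𝔡, (fun x => c + f x) ∈ coneOf D₀ 𝔡)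

/-- The rank of the tropical linear series `𝔡` is at least `d`:
`𝔡(-E)` is nonempty for every effective divisor `E` of degree `d`. -/
def lsRankGe (𝔡 : Set (G → ℤ)) (d : ℕ) : Prop :=
  ∀ E : G → ℤ, FinSupp E → Effective E → deg E = (d : ℤ) →
    ∃ D ∈ 𝔡, ∀ x, E x ≤ D x

/-- `D` splits in `𝔡`: some non-constant `f ∈ R(𝔡, D)`, with maximum locus `Z`, has a
boundary point `x ∈ ∂Z` with `D(x) + ord_x(f) > 0`. -/
def Splits (𝔡 : Set (G → ℤ)) (D : G → ℤ) : Prop :=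
  ∃ f ∈ coneOf D 𝔡, (¬∀ x y : G, f x = f y) ∧
    ∃ x ∈ frontier {y | ∀ z, f z ≤ f y}, 0 < D x + ordAt f x

/-- The pairing of a divisor with a test function. -/
noncomputable def pairing (D : G → ℤ) (φ : G → ℝ) : ℝ :=
  ∑ᶠ x, (D x : ℝ) * φ x

/-- The tangent space of `X` at `D` has dimension at least `r`: there are `r`
one-sided differentiable paths through `D` inside `X` whose derivatives (as linear
functionals on rational test functions) are linearly independent. -/
def TangentDimGe (X : Set (G → ℤ)) (D : G → ℤ) (r : ℕ) : Prop :=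
  ∃ (c : Fin r → ℝ → G → ℤ) (L : Fin r → (G → ℝ) → ℝ) (ε : ℝ), 0 < ε ∧
    (∀ i, c i 0 = D) ∧ (∀ i, ∀ t ∈ Set.Ico (0:ℝ) ε, c i t ∈ X) ∧
    (∀ i, ∀ φ : G → ℝ, IsRational φ →
      HasDerivWithinAt (fun t => pairing (c i t) φ) (L i φ) (Set.Ici 0) 0) ∧
    LinearIndependent ℝ L

/-! ### Local stars and slopes -/

/-- The unit speed paths `γ i` on `[0, r)` exhibit the ball of radius `r` around `x` as a
star. -/
structure IsStar (x : G) {ι : Type*} (γ : ι → ℝ → G) (r : ℝ) : Prop where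
  pos : 0 < r
  zero : ∀ i, γ i 0 = x
  iso : ∀ i, ∀ s ∈ Ico (0:ℝ) r, ∀ t ∈ Ico (0:ℝ) r, dist (γ i s) (γ i t) = |s - t|
  inj : ∀ i j, ∀ s ∈ Ioo (0:ℝ) r, ∀ t ∈ Ioo (0:ℝ) r, γ i s = γ j t → i = j
  cover : ∀ y, y ≠ x → dist x y < r → ∃ i, ∃ t ∈ Ioo (0:ℝ) r, γ i t = y
  isOpen : ∀ i, IsOpen (γ i '' Ioo 0 r)

namespace IsStar

variable {x : G} {ι : Type*} {γ : ι → ℝ → G} {r : ℝ}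

theorem dist_eq (h : IsStar x γ r) (i : ι) {t : ℝ} (ht : t ∈ Ico (0:ℝ) r) :
    dist x (γ i t) = t := by
  have := h.iso i 0 ⟨le_rfl, h.pos⟩ t ht
  rw [h.zero] at this
  rw [this, zero_sub, abs_neg, abs_of_nonneg ht.1]

theorem mono (h : IsStar x γ r) {r' : ℝ} (h0 : 0 < r') (hr : r' ≤ r) : IsStar x γ r' where
  pos := h0
  zero := h.zero
  iso i s hs t ht := h.iso i s ⟨hs.1, hs.2.trans_le hr⟩ t ⟨ht.1, ht.2.trans_le hr⟩
  inj i j s hs t ht := h.inj i j s ⟨hs.1, hs.2.trans_le hr⟩ t ⟨ht.1, ht.2.trans_le hr⟩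
  cover y hy hd := by
    obtain ⟨i, t, ht, rfl⟩ := h.cover y hy (hd.trans_le hr)
    rw [h.dist_eq i ⟨ht.1.le, ht.2⟩] at hd
    exact ⟨i, t, ⟨ht.1, hd⟩, rfl⟩
  isOpen i := by
    have : γ i '' Ioo 0 r' = γ i '' Ioo 0 r ∩ {y | dist x y < r'} := by
      ext y
      constructor
      · rintro ⟨t, ht, rfl⟩
        have ht' : t ∈ Ioo 0 r := ⟨ht.1, ht.2.trans_le hr⟩
        refine ⟨⟨t, ht', rfl⟩, ?_⟩
        rw [mem_ofPred_eq, h.dist_eq i ⟨ht'.1.le, ht'.2⟩]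
        exact ht.2
      · rintro ⟨⟨t, ht, rfl⟩, hd⟩
        rw [mem_ofPred_eq, h.dist_eq i ⟨ht.1.le, ht.2⟩] at hd
        exact ⟨t, ⟨ht.1, hd⟩, rfl⟩
    rw [this]
    exact (h.isOpen i).inter (isOpen_lt (by fun_prop) (by fun_prop))

theorem continuousOn (h : IsStar x γ r) (i : ι) : ContinuousOn (γ i) (Ico 0 r) := by
  rw [Metric.continuousOn_iff]
  intro b hb ε hε
  refine ⟨ε, hε, fun a ha hab => ?_⟩
  rwa [h.iso i a ha b hb]

theorem ne (h : IsStar x γ r) (i : ι) {t : ℝ} (ht : t ∈ Ioo (0:ℝ) r) : γ i t ≠ x := by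
  intro he
  have := h.dist_eq i ⟨ht.1.le, ht.2⟩
  rw [he, dist_self] at this
  exact ht.1.ne this

theorem isUnitSpeedFrom (h : IsStar x γ r) (i : ι) : IsUnitSpeedFrom x r (γ i) :=
  ⟨h.zero i, h.iso i⟩

/-- Every unit speed path from the centre of a star follows one of its branches. -/
theorem exists_eq (h : IsStar x γ r) {ε : ℝ} (hε : 0 < ε) {g : ℝ → G}
    (hg : IsUnitSpeedFrom x ε g) :
    ∃ i, ∃ δ > (0:ℝ), ∀ t ∈ Ico (0:ℝ) δ, g t = γ i t := by
  set δ := min ε r with hδ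
  have hδ0 : 0 < δ := lt_min hε h.pos
  have hd : ∀ t ∈ Ioo (0:ℝ) δ, dist x (g t) = t := by
    intro t ht
    have := hg.2 0 ⟨le_rfl, hε⟩ t ⟨ht.1.le, ht.2.trans_le (min_le_left _ _)⟩
    rwa [hg.1, zero_sub, abs_neg, abs_of_pos ht.1] at this
  have hb : ∀ t ∈ Ioo (0:ℝ) δ, ∃ i, g t = γ i t := by
    intro t ht
    have hne : g t ≠ x := by
      intro he
      have := hd t ht
      rw [he, dist_self] at this
      exact ht.1.ne this
    obtain ⟨i, s, hs, hst⟩ := h.cover (g t) hne (by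
      rw [hd t ht]; exact ht.2.trans_le (min_le_right _ _))
    have h1 := h.dist_eq i ⟨hs.1.le, hs.2⟩
    rw [hst, hd t ht] at h1
    exact ⟨i, by rw [← hst, h1]⟩
  have hsub : ∀ {t}, t ∈ Ioo (0:ℝ) δ → t ∈ Ioo (0:ℝ) r := fun ht =>
    ⟨ht.1, ht.2.trans_le (min_le_right _ _)⟩
  obtain ⟨i, hi⟩ := hb (δ / 2) ⟨by linarith, by linarith⟩
  have hcont : ContinuousOn g (Ioo 0 δ) := by
    rw [Metric.continuousOn_iff]
    intro b hb ε' hε'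
    refine ⟨ε', hε', fun a ha hab => ?_⟩
    rwa [hg.2 a ⟨ha.1.le, ha.2.trans_le (min_le_left _ _)⟩ b
      ⟨hb.1.le, hb.2.trans_le (min_le_left _ _)⟩]
  have hpre : IsPreconnected (g '' Ioo 0 δ) := isPreconnected_Ioo.image _ hcont
  have hmid : δ / 2 ∈ Ioo (0:ℝ) δ := ⟨by linarith, by linarith⟩
  have hsubset : g '' Ioo 0 δ ⊆ γ i '' Ioo 0 r := by
    refine hpre.subset_left_of_subset_union (v := ⋃ j ∈ {j | j ≠ i}, γ j '' Ioo 0 r)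
      (h.isOpen i) (isOpen_biUnion fun j _ => h.isOpen j) ?_ ?_ ?_
    · rw [disjoint_left]
      rintro _ ⟨s, hs, rfl⟩ h2
      simp only [mem_iUnion, mem_ofPred_eq] at h2
      obtain ⟨j, hj, t, ht, he⟩ := h2
      exact hj (h.inj j i t ht s hs he)
    · rintro _ ⟨t, ht, rfl⟩
      obtain ⟨j, hj⟩ := hb t ht
      by_cases hji : j = i
      · left; exact ⟨t, hsub ht, by rw [hj, hji]⟩
      · right
        simp only [mem_iUnion, mem_ofPred_eq]
        exact ⟨j, hji, t, hsub ht, hj.symm⟩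
    · exact ⟨g (δ / 2), ⟨_, hmid, rfl⟩, ⟨δ / 2, hsub hmid, hi.symm⟩⟩
  refine ⟨i, δ, hδ0, fun t ht => ?_⟩
  rcases ht.1.eq_or_lt with rfl | h0
  · rw [hg.1, h.zero]
  · obtain ⟨s, hs, he⟩ := hsubset ⟨t, ⟨h0, ht.2⟩, rfl⟩
    have h1 := h.dist_eq i ⟨hs.1.le, hs.2⟩
    rw [he, hd t ⟨h0, ht.2⟩] at h1
    rw [← he, h1]

/-- The tangent direction of a branch. -/
def dir (h : IsStar x γ r) (i : ι) : TangentDir x :=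
  Quotient.mk (germSetoid x) ⟨γ i, r, h.pos, h.isUnitSpeedFrom i⟩

theorem dir_bijective (h : IsStar x γ r) : Function.Bijective h.dir := by
  constructor
  · intro i j hij
    obtain ⟨δ, hδ, H⟩ := Quotient.exact hij
    have hm : 0 < min δ r := lt_min hδ h.pos
    have h1 : min δ r / 2 < δ := by linarith [min_le_left δ r]
    have h2 : min δ r / 2 < r := by linarith [min_le_right δ r]
    exact h.inj i j _ ⟨by linarith, h2⟩ _ ⟨by linarith, h2⟩
      (H (min δ r / 2) ⟨by linarith, h1⟩)
  · intro ζ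
    induction ζ using Quotient.inductionOn with
    | _ g =>
      obtain ⟨g, ε, hε, hg⟩ := g
      obtain ⟨i, δ, hδ, H⟩ := h.exists_eq hε hg
      exact ⟨i, Quotient.sound ⟨δ, hδ, fun t ht => (H t ht).symm⟩⟩

/-- The branches of a star are the tangent directions at its centre. -/
noncomputable def equivDir (h : IsStar x γ r) : ι ≃ TangentDir x :=
  Equiv.ofBijective h.dir h.dir_bijective

theorem out_dir (h : IsStar x γ r) (i : ι) :
    ∃ δ > (0:ℝ), ∀ t ∈ Ico (0:ℝ) δ, (Quotient.out (h.dir i)).1 t = γ i t := by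
  have : Quotient.mk (germSetoid x) (Quotient.out (h.dir i)) = h.dir i := Quotient.out_eq _
  exact Quotient.exact this

end IsStar

theorem HasSlopeAlong.congr_path {X : Type*} {f : X → ℝ} {g g' : ℝ → X} {s : ℤ} {δ : ℝ} (hδ : 0 < δ)
    (h : ∀ t ∈ Ico (0:ℝ) δ, g t = g' t) (hs : HasSlopeAlong f g s) : HasSlopeAlong f g' s := by
  obtain ⟨δ', hδ', H⟩ := hs
  refine ⟨min δ δ', lt_min hδ hδ', fun t ht => ?_⟩
  rw [← h t ⟨ht.1, ht.2.trans_le (min_le_left _ _)⟩, ← h 0 ⟨le_rfl, hδ⟩]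
  exact H t ⟨ht.1, ht.2.trans_le (min_le_right _ _)⟩

theorem HasSlopeAlong.unique {X : Type*} {f : X → ℝ} {g : ℝ → X} {s s' : ℤ}
    (h : HasSlopeAlong f g s) (h' : HasSlopeAlong f g s') : s = s' := by
  obtain ⟨δ, hδ, H⟩ := h
  obtain ⟨δ', hδ', H'⟩ := h'
  have hm : 0 < min δ δ' := lt_min hδ hδ'
  have h1 := H (min δ δ' / 2) ⟨by linarith, by linarith [min_le_left δ δ']⟩
  have h2 := H' (min δ δ' / 2) ⟨by linarith, by linarith [min_le_right δ δ']⟩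
  have : (s : ℝ) = s' := by
    have h3 : (s : ℝ) * (min δ δ' / 2) = s' * (min δ δ' / 2) := by linarith
    exact mul_right_cancel₀ (by linarith) h3
  exact_mod_cast this

theorem HasSlopeAlong.sub {X : Type*} {f f' : X → ℝ} {g : ℝ → X} {s s' : ℤ}
    (h : HasSlopeAlong f g s) (h' : HasSlopeAlong f' g s') :
    HasSlopeAlong (fun x => f x - f' x) g (s - s') := by
  obtain ⟨δ, hδ, H⟩ := h
  obtain ⟨δ', hδ', H'⟩ := h'
  refine ⟨min δ δ', lt_min hδ hδ', fun t ht => ?_⟩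
  simp only [H t ⟨ht.1, ht.2.trans_le (min_le_left _ _)⟩,
    H' t ⟨ht.1, ht.2.trans_le (min_le_right _ _)⟩]
  push_cast
  ring

namespace IsStar

variable {x : G} {ι : Type*} {γ : ι → ℝ → G} {r : ℝ}

theorem tangentSlope_dir (h : IsStar x γ r) {f : G → ℝ} {i : ι} {s : ℤ}
    (hs : HasSlopeAlong f (γ i) s) : tangentSlope f (h.dir i) = s := by
  obtain ⟨δ, hδ, H⟩ := h.out_dir i
  have hs' : HasSlopeAlong f (Quotient.out (h.dir i)).1 s :=
    hs.congr_path hδ fun t ht => (H t ht).symm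
  have hex : ∃ s : ℤ, HasSlopeAlong f (Quotient.out (h.dir i)).1 s := ⟨s, hs'⟩
  rw [tangentSlope, dif_pos hex]
  exact hex.choose_spec.unique hs'

theorem ordAt_eq [Fintype ι] (h : IsStar x γ r) {f : G → ℝ} {s : ι → ℤ}
    (hs : ∀ i, HasSlopeAlong f (γ i) (s i)) : ordAt f x = ∑ i, s i := by
  rw [ordAt, ← finsum_eq_sum_of_fintype]
  exact (finsum_eq_of_bijective h.dir h.dir_bijective
    fun i => (h.tangentSlope_dir (hs i)).symm).symm

theorem exists_slope (h : IsStar x γ r) {f : G → ℝ} (hf : IsRational f) (i : ι) :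
    ∃ s : ℤ, HasSlopeAlong f (γ i) s :=
  hf.2 x r (γ i) h.pos (h.isUnitSpeedFrom i)

theorem ordAt_sub [Finite ι] (h : IsStar x γ r) {f f' : G → ℝ} (hf : IsRational f)
    (hf' : IsRational f') : ordAt (fun x => f x - f' x) x = ordAt f x - ordAt f' x := by
  have := Fintype.ofFinite ι
  choose s hs using h.exists_slope hf
  choose s' hs' using h.exists_slope hf'
  rw [h.ordAt_eq hs, h.ordAt_eq hs', h.ordAt_eq fun i => (hs i).sub (hs' i),
    Finset.sum_sub_distrib]

theorem degOut_eq (h : IsStar x γ r) (Z : Set G) :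
    degOut Z x = Nat.card {i : ι // ∃ δ > (0:ℝ), ∀ t ∈ Ioo (0:ℝ) δ, γ i t ∉ interior Z} := by
  refine (Nat.card_congr (h.equivDir.subtypeEquiv fun i => ?_)).symm
  obtain ⟨δ, hδ, H⟩ := h.out_dir i
  constructor
  · rintro ⟨δ', hδ', H'⟩
    refine ⟨min δ δ', lt_min hδ hδ', fun t ht => ?_⟩
    have h1 := H t ⟨ht.1.le, ht.2.trans_le (min_le_left _ _)⟩
    have h2 := H' t ⟨ht.1, ht.2.trans_le (min_le_right _ _)⟩
    change (Quotient.out (h.dir i)).1 t ∉ _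
    rwa [h1]
  · rintro ⟨δ', hδ', H'⟩
    refine ⟨min δ δ', lt_min hδ hδ', fun t ht => ?_⟩
    have h1 := H t ⟨ht.1.le, ht.2.trans_le (min_le_left _ _)⟩
    have h2 := H' t ⟨ht.1, ht.2.trans_le (min_le_right _ _)⟩
    change (Quotient.out (h.dir i)).1 t ∉ _ at h2
    rwa [h1] at h2

end IsStar

theorem isRational_of_stars {f : G → ℝ} (hf : Continuous f)
    (h : ∀ x : G, ∃ (ι : Type) (γ : ι → ℝ → G) (r : ℝ), IsStar x γ r ∧
      ∀ i, ∃ s : ℤ, HasSlopeAlong f (γ i) s) : IsRational f := by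
  refine ⟨hf, fun x ε g hε hg => ?_⟩
  obtain ⟨ι, γ, r, hst, hs⟩ := h x
  obtain ⟨i, δ, hδ, H⟩ := hst.exists_eq hε hg
  obtain ⟨s, hs⟩ := hs i
  exact ⟨s, hs.congr_path hδ fun t ht => (H t ht).symm⟩

theorem IsRational.sub {f f' : G → ℝ} (hf : IsRational f) (hf' : IsRational f') :
    IsRational fun x => f x - f' x := by
  refine ⟨hf.1.sub hf'.1, fun x ε g hε hg => ?_⟩
  obtain ⟨s, hs⟩ := hf.2 x ε g hε hg
  obtain ⟨s', hs'⟩ := hf'.2 x ε g hε hg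
  exact ⟨s - s', hs.sub hs'⟩

/-! ### The valence counts the branches of a star -/

/-- If a neighbourhood `U` of `x` has a radial coordinate and a branch label, then there
are at most as many disjoint paths emanating from `x` as labels. -/
theorem exists_injective_of_label {ι κ : Type*} [TopologicalSpace ι] [DiscreteTopology ι]
    {x : G} {U : Set G} (hU : U ∈ nhds x) {ρ : G → ℝ} (hρ : ContinuousOn ρ U) (hρx : ρ x = 0)
    (hρpos : ∀ y ∈ U, y ≠ x → 0 < ρ y) {lab : G → ι} (hlab : ContinuousOn lab (U \ {x}))
    (hinj : ∀ y ∈ U \ {x}, ∀ z ∈ U \ {x}, ρ y = ρ z → lab y = lab z → y = z)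
    {r : ℝ} (hr : 0 < r) {β : κ → ℝ → G} (hβ : ∀ k, ContinuousOn (β k) (Ico 0 r))
    (hβ0 : ∀ k, β k 0 = x) (hβne : ∀ k, ∀ t ∈ Ioo 0 r, β k t ≠ x)
    (hβinj : ∀ k l, ∀ s ∈ Ioo 0 r, ∀ t ∈ Ioo 0 r, β k s = β l t → k = l) :
    ∃ j : κ → ι, Function.Injective j := by
  have hsmall : ∀ k, ∃ s ∈ Ioo 0 r, ∀ t ∈ Icc 0 s, β k t ∈ U := by
    intro k
    have h1 : U ∈ nhds (β k 0) := by rwa [hβ0]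
    have h2 := (hβ k 0 ⟨le_rfl, hr⟩).preimage_mem_nhdsWithin h1
    rw [mem_nhdsWithin_iff_exists_mem_nhds_inter] at h2
    obtain ⟨u, hu, hsub⟩ := h2
    obtain ⟨δ, hδ, hb⟩ := Metric.mem_nhds_iff.1 hu
    have hm : 0 < min δ r := lt_min hδ hr
    refine ⟨min δ r / 2, ⟨by linarith, by linarith [min_le_right δ r]⟩, fun t ht => ?_⟩
    refine hsub ⟨hb ?_, ht.1, by linarith [min_le_right δ r, ht.2]⟩
    rw [Metric.mem_ball, Real.dist_eq, sub_zero, abs_of_nonneg ht.1]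
    linarith [min_le_left δ r, ht.2]
  choose s hs hsU using hsmall
  have hlabc : ∀ k, ∀ t ∈ Ioc 0 (s k), lab (β k t) = lab (β k (s k)) := by
    intro k t ht
    have hc : ContinuousOn (fun t => lab (β k t)) (Ioc 0 (s k)) := by
      refine hlab.comp ((hβ k).mono fun u hu => ⟨hu.1.le, hu.2.trans_lt (hs k).2⟩) ?_
      intro u hu
      exact ⟨hsU k u ⟨hu.1.le, hu.2⟩, hβne k u ⟨hu.1, hu.2.trans_lt (hs k).2⟩⟩
    exact isPreconnected_Ioc.constant hc ht ⟨(hs k).1, le_rfl⟩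
  have hρc : ∀ k, ContinuousOn (fun t => ρ (β k t)) (Icc 0 (s k)) := fun k =>
    hρ.comp ((hβ k).mono fun u hu => ⟨hu.1, hu.2.trans_lt (hs k).2⟩) fun u hu => hsU k u hu
  have hpos : ∀ k, 0 < ρ (β k (s k)) := fun k =>
    hρpos _ (hsU k _ ⟨(hs k).1.le, le_rfl⟩) (hβne k _ (hs k))
  refine ⟨fun k => lab (β k (s k)), fun k l hkl => ?_⟩
  set m := min (ρ (β k (s k))) (ρ (β l (s l))) with hm
  have hm0 : 0 < m := lt_min (hpos k) (hpos l)
  have key : ∀ k', m ≤ ρ (β k' (s k')) → ∃ t ∈ Ioc 0 (s k'), ρ (β k' t) = m := by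
    intro k' hk'
    have := intermediate_value_Icc (hs k').1.le (hρc k')
    obtain ⟨t, ht, he⟩ := this (show m ∈ _ by
      simp only [hβ0, hρx]
      exact ⟨hm0.le, hk'⟩)
    refine ⟨t, ⟨lt_of_le_of_ne ht.1 ?_, ht.2⟩, he⟩
    rintro rfl
    simp only [hβ0, hρx] at he
    exact hm0.ne he
  obtain ⟨t, ht, hte⟩ := key k (min_le_left _ _)
  obtain ⟨u, hu, hue⟩ := key l (min_le_right _ _)
  have ht' : t ∈ Ioo 0 r := ⟨ht.1, ht.2.trans_lt (hs k).2⟩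
  have hu' : u ∈ Ioo 0 r := ⟨hu.1, hu.2.trans_lt (hs l).2⟩
  refine hβinj k l t ht' u hu' (hinj _ ⟨hsU k t ⟨ht.1.le, ht.2⟩, hβne k t ht'⟩ _
    ⟨hsU l u ⟨hu.1.le, hu.2⟩, hβne l u hu'⟩ (hte.trans hue.symm) ?_)
  rw [hlabc k t ht, hlabc l u hu]
  exact hkl

/-- The projection onto the glued star. -/
def StarGlue.mk {v : ℕ} {ε : ℝ} (a : Fin v × Set.Ico (0:ℝ) ε) : StarGlue v ε :=
  Quotient.mk (starSetoid v ε) a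

/-- The distance to the centre of a glued star. -/
def StarGlue.radius {v : ℕ} {ε : ℝ} : StarGlue v ε → ℝ :=
  Quotient.lift (fun a : Fin v × Set.Ico (0:ℝ) ε => (a.2 : ℝ)) fun a b h => by
    rcases h with rfl | h
    · rfl
    · exact h.1.trans h.2.symm

/-- The index of a branch containing a point of a glued star. -/
noncomputable def StarGlue.branch {v : ℕ} {ε : ℝ} (z : StarGlue v ε) : Fin v :=
  (Quotient.out (s := starSetoid v ε) z).1

namespace StarGlue

variable {v : ℕ} {ε : ℝ}

theorem continuous_mk : Continuous (mk : _ → StarGlue v ε) :=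
  continuous_quotient_mk'

theorem continuous_radius : Continuous (radius : StarGlue v ε → ℝ) :=
  Continuous.quotient_lift (by fun_prop) _

theorem branch_mk (i : Fin v) (t : Set.Ico (0:ℝ) ε) (ht : (t : ℝ) ≠ 0) :
    branch (mk (i, t)) = i := by
  have h : (starSetoid v ε).r (Quotient.out (Quotient.mk (starSetoid v ε) (i, t))) (i, t) :=
    Quotient.exact (Quotient.out_eq (Quotient.mk (starSetoid v ε) (i, t)))
  rcases h with h | h
  · exact congrArg Prod.fst h
  · exact absurd h.2 ht

theorem eq_of_radius_of_branch {z w : StarGlue v ε} (hz : radius z ≠ 0)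
    (hr : radius z = radius w) (hb : branch z = branch w) : z = w := by
  induction z using Quotient.inductionOn with
  | _ a =>
  induction w using Quotient.inductionOn with
  | _ b =>
    obtain ⟨i, s⟩ := a
    obtain ⟨j, t⟩ := b
    have h1 : (s : ℝ) ≠ 0 := hz
    have h2 : (s : ℝ) = t := hr
    have h3 : i = j := (branch_mk i s h1).symm.trans (hb.trans (branch_mk j t (h2 ▸ h1)))
    exact congrArg mk (Prod.ext h3 (Subtype.ext h2))

theorem isOpen_branch (i : Fin v) :
    IsOpen {z : StarGlue v ε | radius z ≠ 0 ∧ branch z = i} := by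
  refine isOpen_coinduced.2 ?_
  have : (mk ⁻¹' {z : StarGlue v ε | radius z ≠ 0 ∧ branch z = i}) =
      {a : Fin v × Set.Ico (0:ℝ) ε | (a.2 : ℝ) ≠ 0 ∧ a.1 = i} := by
    ext ⟨j, t⟩
    constructor
    · rintro ⟨h1, h2⟩
      have h1 : (t : ℝ) ≠ 0 := h1
      rw [branch_mk j t h1] at h2
      exact ⟨h1, h2⟩
    · rintro ⟨h1, h2⟩
      exact ⟨h1, (branch_mk j t h1).trans h2⟩
  change IsOpen (mk ⁻¹' {z : StarGlue v ε | radius z ≠ 0 ∧ branch z = i})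
  rw [this]
  exact (isOpen_ne_fun (by fun_prop) (by fun_prop)).inter
    ((isOpen_discrete {i}).preimage continuous_fst)

theorem continuousOn_branch : ContinuousOn branch {z : StarGlue v ε | radius z ≠ 0} := by
  intro z hz
  refine ContinuousAt.continuousWithinAt ?_
  rw [ContinuousAt, nhds_discrete (Fin v), Filter.tendsto_pure]
  filter_upwards [(isOpen_branch (branch z)).mem_nhds ⟨hz, rfl⟩] with w hw
  exact hw.2

end StarGlue

theorem HasValence.pos {x : G} {v : ℕ} (h : HasValence x v) : 0 < v := by
  obtain ⟨U, -, ε, hε, φ, hx, -⟩ := h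
  obtain ⟨a⟩ := Quotient.exists_rep (φ ⟨x, hx⟩)
  exact a.1.pos

theorem IsStar.card_eq {x : G} {ι : Type*} [Finite ι] {γ : ι → ℝ → G} {r : ℝ}
    (h : IsStar x γ r) {v : ℕ} (hv : HasValence x v) : Nat.card ι = v := by
  classical
  obtain ⟨U, hU, ε, hε, φ, hx, hφ⟩ := hv
  replace hφ : ∀ i : Fin v, φ ⟨x, hx⟩ = StarGlue.mk (i, ⟨0, le_rfl, hε⟩) := hφ
  have hcentre : ∀ (i : Fin v) (t : Set.Ico (0:ℝ) ε),
      φ ⟨x, hx⟩ = StarGlue.mk (i, t) ↔ (t : ℝ) = 0 := by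
    intro i t
    constructor
    · intro he
      have := congrArg StarGlue.radius ((hφ i).symm.trans he)
      exact this.symm
    · intro ht
      rw [hφ i]
      exact Quotient.sound (Or.inr ⟨rfl, ht⟩)
  have hrad : ∀ y : U, StarGlue.radius (φ y) = 0 → y = ⟨x, hx⟩ := by
    intro y hy
    apply φ.injective
    generalize φ y = z at hy
    induction z using Quotient.inductionOn with
    | _ a => exact ((hcentre a.1 a.2).2 hy).symm
  have hradx : StarGlue.radius (φ ⟨x, hx⟩) = 0 := by
    obtain ⟨a, ha⟩ := Quotient.exists_rep (φ ⟨x, hx⟩)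
    have := hφ a.1
    rw [this]
    rfl
  have hnonneg : ∀ z : StarGlue v ε, 0 ≤ StarGlue.radius z := by
    intro z
    induction z using Quotient.inductionOn with
    | _ a => exact a.2.2.1
  -- the given branches inject into the branches of the glued star
  have h1 : ∃ j : ι → Fin v, Function.Injective j := by
    obtain ⟨i₀⟩ : Nonempty (Fin v) := by
      obtain ⟨a⟩ := Quotient.exists_rep (φ ⟨x, hx⟩)
      exact ⟨a.1⟩
    let ρ : G → ℝ := fun y => if hy : y ∈ U then StarGlue.radius (φ ⟨y, hy⟩) else 0
    let lab : G → Fin v := fun y => if hy : y ∈ U then StarGlue.branch (φ ⟨y, hy⟩) else i₀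
    have hρ : ∀ y (hy : y ∈ U), ρ y = StarGlue.radius (φ ⟨y, hy⟩) := fun y hy => dif_pos hy
    have hlab : ∀ y (hy : y ∈ U), lab y = StarGlue.branch (φ ⟨y, hy⟩) := fun y hy => dif_pos hy
    have hne : ∀ y (hy : y ∈ U), y ≠ x → StarGlue.radius (φ ⟨y, hy⟩) ≠ 0 := fun y hy hyx h0 =>
      hyx (congrArg Subtype.val (hrad _ h0))
    refine exists_injective_of_label hU (ρ := ρ) ?_ ?_ ?_ (lab := lab) ?_ ?_ h.pos h.continuousOn
      h.zero (fun k t ht => h.ne k ht) h.inj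
    · rw [continuousOn_iff_continuous_domRestrict]
      have : U.domRestrict ρ = fun y => StarGlue.radius (φ y) := by
        ext y
        exact hρ y y.2
      rw [this]
      exact StarGlue.continuous_radius.comp φ.continuous
    · rw [hρ x hx, hradx]
    · intro y hy hyx
      rw [hρ y hy]
      exact lt_of_le_of_ne (hnonneg _) (hne y hy hyx).symm
    · rw [continuousOn_iff_continuous_domRestrict]
      have : (U \ {x}).domRestrict lab =
          fun y : ↥(U \ {x}) => StarGlue.branch (φ ⟨y.1, y.2.1⟩) := by
        ext y
        exact congrArg Fin.val (hlab y y.2.1)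
      rw [this]
      refine StarGlue.continuousOn_branch.comp_continuous
        (φ.continuous.comp (Continuous.subtype_mk continuous_subtype_val _)) ?_
      intro y
      exact hne y.1 y.2.1 y.2.2
    · rintro y ⟨hy, hyx⟩ z ⟨hz, -⟩ h1 h2
      rw [hρ y hy, hρ z hz] at h1
      rw [hlab y hy, hlab z hz] at h2
      exact congrArg Subtype.val
        (φ.injective (StarGlue.eq_of_radius_of_branch (hne y hy hyx) h1 h2))
  -- and conversely
  have h2 : ∃ j : Fin v → ι, Function.Injective j := by
    let _ : TopologicalSpace ι := ⊥
    have _ : DiscreteTopology ι := ⟨rfl⟩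
    let β : Fin v → ℝ → G := fun k t => if ht : t ∈ Set.Ico (0:ℝ) ε then
      (φ.symm (StarGlue.mk (k, ⟨t, ht⟩))).1 else x
    have hβ : ∀ k t (ht : t ∈ Set.Ico (0:ℝ) ε),
        β k t = (φ.symm (StarGlue.mk (k, ⟨t, ht⟩))).1 := fun k t ht => dif_pos ht
    have hβne : ∀ k, ∀ t ∈ Ioo 0 ε, β k t ≠ x := by
      intro k t ht he
      rw [hβ k t ⟨ht.1.le, ht.2⟩] at he
      have he' : φ.symm (StarGlue.mk (k, ⟨t, ⟨ht.1.le, ht.2⟩⟩)) = ⟨x, hx⟩ :=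
        Subtype.ext he
      exact ht.1.ne' ((hcentre _ _).1 (φ.symm_apply_eq.1 he').symm)
    have hcov : ∀ y ∈ Metric.ball x r \ {x}, ∃ i, y ∈ γ i '' Ioo 0 r := by
      rintro y ⟨hy, hyx⟩
      obtain ⟨i, t, ht, he⟩ := h.cover y hyx (by rwa [dist_comm])
      exact ⟨i, t, ht, he⟩
    by_cases hv0 : IsEmpty (Fin v)
    · exact ⟨fun k => (hv0.false k).elim, fun k => (hv0.false k).elim⟩
    have hι : Nonempty ι := by
      obtain ⟨k⟩ := not_isEmpty_iff.1 hv0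
      by_contra hemp
      have hsub : Metric.ball x r ⊆ {x} := by
        intro y hy
        by_contra hyx
        obtain ⟨i, -⟩ := hcov y ⟨hy, hyx⟩
        exact hemp ⟨i⟩
      have hopen : ({x} : Set G) ∈ nhds x :=
        Filter.mem_of_superset (Metric.ball_mem_nhds x h.pos) hsub
      have hcont : Continuous fun t : Set.Ico (0:ℝ) ε =>
          (φ.symm (StarGlue.mk (k, t))).1 :=
        continuous_subtype_val.comp (φ.symm.continuous.comp
          (StarGlue.continuous_mk.comp (by fun_prop)))
      have h0 : (φ.symm (StarGlue.mk (k, ⟨0, le_rfl, hε⟩))).1 = x := by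
        rw [← hφ k, φ.symm_apply_apply]
      have hev := hcont.continuousAt.preimage_mem_nhds (x := ⟨0, le_rfl, hε⟩)
        (by rw [h0]; exact hopen)
      obtain ⟨δ, hδ, hb⟩ := Metric.mem_nhds_iff.1 hev
      have hm : 0 < min δ ε := lt_min hδ hε
      have ht : min δ ε / 2 ∈ Ioo 0 ε := ⟨by linarith, by linarith [min_le_right δ ε]⟩
      have := hb (show (⟨min δ ε / 2, ht.1.le, ht.2⟩ : Set.Ico (0:ℝ) ε) ∈ _ by
        rw [Metric.mem_ball, Subtype.dist_eq, Real.dist_eq, sub_zero, abs_of_pos ht.1]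
        linarith [min_le_left δ ε])
      refine hβne k _ ht ?_
      rw [hβ k _ ⟨ht.1.le, ht.2⟩]
      exact this
    obtain ⟨i₀⟩ := hι
    let lab : G → ι := fun y => if hy : ∃ i, y ∈ γ i '' Ioo 0 r then hy.choose else i₀
    have hlab : ∀ i, ∀ t ∈ Ioo 0 r, lab (γ i t) = i := by
      intro i t ht
      have hy : ∃ j, γ i t ∈ γ j '' Ioo 0 r := ⟨i, t, ht, rfl⟩
      have : lab (γ i t) = hy.choose := dif_pos hy
      rw [this]
      obtain ⟨s, hs, he⟩ := hy.choose_spec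
      exact h.inj _ _ s hs t ht he
    refine exists_injective_of_label (Metric.ball_mem_nhds x h.pos) (ρ := fun y => dist x y)
      (by fun_prop) (dist_self x) (fun y _ hyx => dist_pos.2 hyx.symm) (lab := lab) ?_ ?_ hε
      (β := β) ?_ ?_ hβne ?_
    · intro y hy
      obtain ⟨i, t, ht, rfl⟩ := hcov y hy
      refine ContinuousAt.continuousWithinAt ?_
      rw [ContinuousAt, nhds_discrete (ι), Filter.tendsto_pure]
      filter_upwards [(h.isOpen i).mem_nhds ⟨t, ht, rfl⟩] with w hw
      obtain ⟨u, hu, rfl⟩ := hw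
      rw [hlab i u hu, hlab i t ht]
    · intro y hy z hz h1 h2
      obtain ⟨i, t, ht, rfl⟩ := hcov y hy
      obtain ⟨j, u, hu, rfl⟩ := hcov z hz
      rw [hlab i t ht, hlab j u hu] at h2
      subst h2
      simp only [h.dist_eq i ⟨ht.1.le, ht.2⟩, h.dist_eq i ⟨hu.1.le, hu.2⟩] at h1
      rw [h1]
    · intro k
      rw [continuousOn_iff_continuous_domRestrict]
      have : (Ico 0 ε).domRestrict (β k) = fun t : Set.Ico (0:ℝ) ε =>
          (φ.symm (StarGlue.mk (k, t))).1 := by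
        ext t
        exact hβ k t t.2
      rw [this]
      exact continuous_subtype_val.comp (φ.symm.continuous.comp
          (StarGlue.continuous_mk.comp (by fun_prop)))
    · intro k
      rw [hβ k 0 ⟨le_rfl, hε⟩, ← hφ k, φ.symm_apply_apply]
    · intro k l s hs t ht he
      rw [hβ k s ⟨hs.1.le, hs.2⟩, hβ l t ⟨ht.1.le, ht.2⟩] at he
      have he' := φ.symm.injective (Subtype.ext he)
      have := congrArg StarGlue.branch he'
      rwa [StarGlue.branch_mk _ _ hs.1.ne', StarGlue.branch_mk _ _ ht.1.ne'] at this
  obtain ⟨j, hj⟩ := h1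
  obtain ⟨j', hj'⟩ := h2
  have e1 := Nat.card_le_card_of_injective j hj
  have e2 := Nat.card_le_card_of_injective j' hj'
  rw [Nat.card_eq_fintype_card (α := Fin v), Fintype.card_fin] at e1 e2
  omega

/-! ### Models as families of geodesic edges -/

/-- A decomposition of `G` into a finite set `W` of vertices and finitely many pairwise
disjoint open edges, each parametrized by a geodesic with end points in `W`. -/
structure EdgeModel (W : Set G) where
  E : Type
  finE : Finite E
  len : E → ℝ
  γ : E → ℝ → G
  len_pos : ∀ e, 0 < len e
  iso : ∀ e, ∀ s ∈ Icc 0 (len e), ∀ t ∈ Icc 0 (len e), dist (γ e s) (γ e t) = |s - t|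
  src : ∀ e, γ e 0 ∈ W
  tgt : ∀ e, γ e (len e) ∈ W
  inter : ∀ e, ∀ t ∈ Ioo 0 (len e), γ e t ∉ W
  disj : ∀ e e', ∀ s ∈ Ioo 0 (len e), ∀ t ∈ Ioo 0 (len e'), γ e s = γ e' t → e = e'
  cover : ∀ y, y ∉ W → ∃ e, ∃ t ∈ Ioo 0 (len e), γ e t = y
  finW : W.Finite

theorem closure_inter_of_mem_compsOf {S C : Set G} (hC : C ∈ compsOf S) : closure C ∩ S ⊆ C := by
  obtain ⟨x, hx, rfl⟩ := hC
  refine IsPreconnected.subset_connectedComponentIn ?_ ?_ inter_subset_right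
  · exact isPreconnected_connectedComponentIn.subset_closure
      (subset_inter subset_closure (connectedComponentIn_subset S x)) inter_subset_left
  · exact ⟨subset_closure (mem_connectedComponentIn hx), hx⟩

theorem eq_of_mem_compsOf {S C C' : Set G} (hC : C ∈ compsOf S) (hC' : C' ∈ compsOf S) {y : G}
    (hy : y ∈ C) (hy' : y ∈ C') : C = C' := by
  obtain ⟨x, hx, rfl⟩ := hC
  obtain ⟨x', hx', rfl⟩ := hC'
  rw [connectedComponentIn_eq hy, connectedComponentIn_eq hy']

theorem subset_of_mem_compsOf {S C : Set G} (hC : C ∈ compsOf S) : C ⊆ S := by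
  obtain ⟨x, -, rfl⟩ := hC
  exact connectedComponentIn_subset S x

theorem exists_arc_end [CompactSpace G] {a b c : ℝ} {g : ℝ → G}
    (hg : ∀ s ∈ Ioo a b, ∀ t ∈ Ioo a b, dist (g s) (g t) = |s - t|)
    {l : Filter ℝ} [l.NeBot] (hl : ∀ᶠ t in l, t ∈ Ioo a b) (hlc : l ≤ nhds c) :
    ∃ p, (∀ t ∈ Ioo a b, dist p (g t) = |c - t|) ∧ p ∈ closure (g '' Ioo a b) := by
  obtain ⟨p, -, hp⟩ := isCompact_univ.ultrafilter_le_nhds ((Ultrafilter.of l).map g) (by simp)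
  have hp : Filter.Tendsto g (Ultrafilter.of l) (nhds p) := hp
  have hle : (Ultrafilter.of l : Filter ℝ) ≤ l := Ultrafilter.of_le l
  refine ⟨p, fun t ht => ?_, ?_⟩
  · have h1 : Filter.Tendsto (fun s => dist (g s) (g t)) (Ultrafilter.of l) (nhds (dist p (g t))) :=
      hp.dist tendsto_const_nhds
    have h2 : Filter.Tendsto (fun s => |s - t|) (Ultrafilter.of l) (nhds |c - t|) := by
      have : Filter.Tendsto (fun s : ℝ => |s - t|) (nhds c) (nhds |c - t|) :=
        Continuous.tendsto (by fun_prop) c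
      exact this.mono_left (hle.trans hlc)
    refine tendsto_nhds_unique_of_eventuallyEq h1 h2 ?_
    filter_upwards [hle hl] with s hs
    exact hg s hs t ht
  · refine mem_closure_of_tendsto hp ?_
    filter_upwards [hle hl] with s hs
    exact ⟨s, hs, rfl⟩

theorem exists_edge_of_isOpenArc [CompactSpace G] {V C : Set G} (hC : C ∈ compsOf Vᶜ)
    (harc : IsOpenArc C) :
    ∃ (ℓ : ℝ) (γ : ℝ → G), 0 < ℓ ∧
      (∀ s ∈ Icc 0 ℓ, ∀ t ∈ Icc 0 ℓ, dist (γ s) (γ t) = |s - t|) ∧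
      γ 0 ∈ V ∧ γ ℓ ∈ V ∧ C = γ '' Ioo 0 ℓ := by
  obtain ⟨a, b, g, hab, hg, rfl⟩ := harc
  obtain ⟨p, hp, hpc⟩ := exists_arc_end hg (l := nhdsWithin a (Ioi a)) (c := a)
    (Ioo_mem_nhdsGT hab) nhdsWithin_le_nhds
  obtain ⟨q, hq, hqc⟩ := exists_arc_end hg (l := nhdsWithin b (Iio b)) (c := b)
    (Ioo_mem_nhdsLT hab) nhdsWithin_le_nhds
  have hmem : ∀ {z c}, z ∈ closure (g '' Ioo a b) → (∀ t ∈ Ioo a b, dist z (g t) = |c - t|) →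
      c ∉ Ioo a b → z ∈ V := by
    intro z c hz hd hc
    by_contra hzV
    obtain ⟨t, ht, rfl⟩ := closure_inter_of_mem_compsOf hC ⟨hz, hzV⟩
    have := hd t ht
    rw [dist_self, eq_comm, abs_eq_zero, sub_eq_zero] at this
    exact hc (this ▸ ht)
  have hpq : dist p q = b - a := by
    refine le_antisymm ?_ (le_of_forall_lt_imp_le_of_dense fun x hx => ?_)
    · have ht : (a + b) / 2 ∈ Ioo a b := ⟨by linarith, by linarith⟩
      have h1 := dist_triangle_right p q (g ((a + b) / 2))
      rw [hp _ ht, hq _ ht, abs_of_nonpos (by linarith [ht.1]),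
        abs_of_nonneg (by linarith [ht.2])] at h1
      linarith
    · have ht : max ((a + b) / 2) ((x + a + b) / 2) ∈ Ioo a b :=
        ⟨lt_max_of_lt_left (by linarith), max_lt (by linarith) (by linarith)⟩
      have h1 := dist_triangle p q (g (max ((a + b) / 2) ((x + a + b) / 2)))
      rw [hp _ ht, hq _ ht, abs_of_nonpos (by linarith [ht.1]),
        abs_of_nonneg (by linarith [ht.2])] at h1
      linarith [le_max_right ((a + b) / 2) ((x + a + b) / 2)]
  classical
  set γ : ℝ → G := fun t => if t = 0 then p else if t = b - a then q else g (a + t) with hγ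
  have h0 : γ 0 = p := by simp [hγ]
  have h1 : γ (b - a) = q := by
    have : b - a ≠ 0 := by linarith
    simp [hγ, this]
  have h2 : ∀ t ∈ Ioo 0 (b - a), γ t = g (a + t) := by
    intro t ht
    simp [hγ, ht.1.ne', ht.2.ne]
  have hio : ∀ t ∈ Ioo 0 (b - a), a + t ∈ Ioo a b := fun t ht =>
    ⟨by linarith [ht.1], by linarith [ht.2]⟩
  have key : ∀ s ∈ Icc 0 (b - a), ∀ t ∈ Icc 0 (b - a), s < t → dist (γ s) (γ t) = t - s := by
    intro s hs t ht hst
    rcases hs.1.eq_or_lt with rfl | hs0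
    · rcases ht.2.eq_or_lt with rfl | ht1
      · rw [h0, h1, hpq, sub_zero]
      · rw [h0, h2 t ⟨hst, ht1⟩, hp _ (hio t ⟨hst, ht1⟩), abs_of_neg (by linarith)]
        ring
    · rw [h2 s ⟨hs0, hst.trans_le ht.2⟩]
      have hs' := hio s ⟨hs0, hst.trans_le ht.2⟩
      rcases ht.2.eq_or_lt with rfl | ht1
      · rw [h1, dist_comm, hq _ hs', abs_of_pos (by linarith)]
        ring
      · rw [h2 t ⟨hs0.trans hst, ht1⟩, hg _ hs' _ (hio t ⟨hs0.trans hst, ht1⟩),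
          abs_of_neg (by linarith)]
        ring
  refine ⟨b - a, γ, by linarith, ?_, h0 ▸ hmem hpc hp (by simp), h1 ▸ hmem hqc hq (by simp), ?_⟩
  · intro s hs t ht
    rcases lt_trichotomy s t with h | rfl | h
    · rw [key s hs t ht h, abs_of_neg (by linarith)]
      ring
    · simp
    · rw [dist_comm, key t ht s hs h, abs_of_pos (by linarith)]
  · ext y
    constructor
    · rintro ⟨t, ht, rfl⟩
      have ht' : t - a ∈ Ioo 0 (b - a) := ⟨by linarith [ht.1], by linarith [ht.2]⟩
      exact ⟨t - a, ht', by rw [h2 _ ht']; congr 1; ring⟩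
    · rintro ⟨t, ht, rfl⟩
      exact ⟨a + t, hio t ht, (h2 t ht).symm⟩

theorem exists_edgeModel [CompactSpace G] {V : Set G} (hV : IsGraphModel V) :
    Nonempty (EdgeModel V) := by
  obtain ⟨hfin, hcomp, harc⟩ := hV
  have : Finite (compsOf Vᶜ) := hcomp
  let e := (Finite.equivFin (compsOf Vᶜ)).symm
  choose len γ h0 hiso hs ht hC using fun i =>
    exists_edge_of_isOpenArc (e i).2 (harc _ (e i).2)
  exact ⟨{
    E := Fin (Nat.card (compsOf Vᶜ))
    finE := inferInstance
    len := len
    γ := γ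
    len_pos := h0
    iso := hiso
    src := hs
    tgt := ht
    inter := fun i t ht => subset_of_mem_compsOf (e i).2 (by rw [hC]; exact ⟨t, ht, rfl⟩)
    disj := fun i j s hs t ht hst => by
      refine e.injective (Subtype.ext (eq_of_mem_compsOf (e i).2 (e j).2 (y := γ i s) ?_ ?_))
      · rw [hC]; exact ⟨s, hs, rfl⟩
      · rw [hC j, hst]; exact ⟨t, ht, rfl⟩
    cover := fun y hy => by
      obtain ⟨i, hi⟩ := e.surjective ⟨connectedComponentIn Vᶜ y, y, hy, rfl⟩
      have hm : y ∈ (e i : Set G) := by rw [hi]; exact mem_connectedComponentIn hy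
      rw [hC] at hm
      exact ⟨i, hm⟩
    finW := hfin }⟩

namespace EdgeModel

theorem inj {W : Set G} (M : EdgeModel W) (e : M.E) {s t : ℝ} (hs : s ∈ Icc 0 (M.len e))
    (ht : t ∈ Icc 0 (M.len e)) (h : M.γ e s = M.γ e t) : s = t := by
  have := M.iso e s hs t ht
  rw [h, dist_self, eq_comm, abs_eq_zero, sub_eq_zero] at this
  exact this

/-- Subdividing an edge. -/
theorem insert {W : Set G} (M : EdgeModel W) {p : G} (hp : p ∉ W) :
    Nonempty (EdgeModel (insert p W)) := by
  classical
  obtain ⟨e₀, c, hc, rfl⟩ := M.cover p hp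
  have hlen : ∀ e, (if e = e₀ then c else M.len e) ≤ M.len e := by
    intro e
    split_ifs with h
    · rw [h]; exact hc.2.le
    · exact le_rfl
  have := M.finE
  exact ⟨{
    E := Option M.E
    finE := inferInstance
    len := fun o => o.elim (M.len e₀ - c) fun e => if e = e₀ then c else M.len e
    γ := fun o => o.elim (fun t => M.γ e₀ (c + t)) M.γ
    len_pos := by
      rintro (_ | e)
      · simpa using hc.2
      · simp only [Option.elim_some]
        split_ifs
        exacts [hc.1, M.len_pos e]
    iso := by
      rintro (_ | e) s hs t ht
      · simp only [Option.elim_none] at hs ht ⊢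
        rw [M.iso e₀ _ ⟨by linarith [hs.1, hc.1], by linarith [hs.2]⟩ _
          ⟨by linarith [ht.1, hc.1], by linarith [ht.2]⟩]
        congr 1
        ring
      · simp only [Option.elim_some] at hs ht ⊢
        exact M.iso e s ⟨hs.1, hs.2.trans (hlen e)⟩ t ⟨ht.1, ht.2.trans (hlen e)⟩
    src := by
      rintro (_ | e)
      · simp
      · exact mem_insert_of_mem _ (M.src e)
    tgt := by
      rintro (_ | e)
      · simpa using Or.inr (M.tgt e₀)
      · simp only [Option.elim_some]
        split_ifs with h
        · rw [h]; exact mem_insert _ _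
        · exact mem_insert_of_mem _ (M.tgt e)
    inter := by
      rintro (_ | e) t ht
      · simp only [Option.elim_none] at ht ⊢
        have ht' : c + t ∈ Ioo 0 (M.len e₀) := ⟨by linarith [ht.1, hc.1], by linarith [ht.2]⟩
        rintro (h | h)
        · have := M.inj e₀ (Ioo_subset_Icc_self ht') (Ioo_subset_Icc_self hc) h
          linarith [ht.1]
        · exact M.inter e₀ _ ht' h
      · simp only [Option.elim_some] at ht ⊢
        have ht' : t ∈ Ioo 0 (M.len e) := ⟨ht.1, ht.2.trans_le (hlen e)⟩
        rintro (h | h)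
        · obtain rfl := M.disj _ _ _ ht' _ hc h
          have := M.inj _ (Ioo_subset_Icc_self ht') (Ioo_subset_Icc_self hc) h
          have h2 := ht.2
          simp only [if_true] at h2
          linarith
        · exact M.inter e _ ht' h
    disj := by
      have aux : ∀ e, ∀ s ∈ Ioo 0 (if e = e₀ then c else M.len e), ∀ t ∈ Ioo 0 (M.len e₀ - c),
          M.γ e s ≠ M.γ e₀ (c + t) := by
        intro e s hs t ht h
        have hs' : s ∈ Ioo 0 (M.len e) := ⟨hs.1, hs.2.trans_le (hlen e)⟩
        have ht' : c + t ∈ Ioo 0 (M.len e₀) := ⟨by linarith [ht.1, hc.1], by linarith [ht.2]⟩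
        obtain rfl := M.disj _ _ _ hs' _ ht' h
        have := M.inj _ (Ioo_subset_Icc_self hs') (Ioo_subset_Icc_self ht') h
        have h2 := hs.2
        simp only [if_true] at h2
        linarith [ht.1]
      rintro (_ | e) (_ | e') s hs t ht h
      · rfl
      · exact (aux e' t ht s hs h.symm).elim
      · exact (aux e s hs t ht h).elim
      · exact congrArg some (M.disj e e' s ⟨hs.1, hs.2.trans_le (hlen e)⟩ t
          ⟨ht.1, ht.2.trans_le (hlen e')⟩ h)
    cover := by
      intro y hy
      obtain ⟨e, t, ht, rfl⟩ := M.cover y fun h => hy (mem_insert_of_mem _ h)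
      by_cases he : e = e₀
      · subst he
        rcases lt_trichotomy t c with h | rfl | h
        · exact ⟨some e, t, by simpa using ⟨ht.1, h⟩, rfl⟩
        · exact (hy (mem_insert _ _)).elim
        · exact ⟨none, t - c, by simpa using ⟨h, ht.2⟩, by simp⟩
      · exact ⟨some e, t, by simpa [he] using ht, rfl⟩
    finW := M.finW.insert _ }⟩

theorem union {W : Set G} (M : EdgeModel W) {F : Set G} (hF : F.Finite) :
    Nonempty (EdgeModel (W ∪ F)) := by
  induction F, hF using Set.Finite.induction_on with
  | empty => exact ⟨by rw [union_empty]; exact M⟩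
  | @insert p F _ _ ih =>
    obtain ⟨M'⟩ := ih
    rw [union_insert]
    by_cases hp : p ∈ W ∪ F
    · rw [insert_eq_of_mem hp]; exact ⟨M'⟩
    · exact M'.insert hp

end EdgeModel

namespace EdgeModel

variable {W : Set G} (M : EdgeModel W)

/-- Oriented edges. -/
abbrev HalfEdge : Type := M.E × Bool

instance : Finite M.E := M.finE

/-- The length of an oriented edge. -/
def hlen (h : M.HalfEdge) : ℝ := M.len h.1

/-- The parametrization of an oriented edge. -/
def path (h : M.HalfEdge) (t : ℝ) : G := if h.2 then M.γ h.1 (M.len h.1 - t) else M.γ h.1 t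

/-- The opposite orientation. -/
def flip (h : M.HalfEdge) : M.HalfEdge := (h.1, !h.2)

variable {M}

theorem hlen_pos (h : M.HalfEdge) : 0 < M.hlen h := M.len_pos h.1

@[simp] theorem hlen_flip (h : M.HalfEdge) : M.hlen (M.flip h) = M.hlen h := rfl

theorem path_flip (h : M.HalfEdge) (t : ℝ) : M.path (M.flip h) t = M.path h (M.hlen h - t) := by
  obtain ⟨e, _ | _⟩ := h <;> simp [path, flip, hlen]

theorem path_base_mem (h : M.HalfEdge) : M.path h 0 ∈ W := by
  obtain ⟨e, _ | _⟩ := h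
  · simpa [path] using M.src e
  · simpa [path] using M.tgt e

theorem path_end_mem (h : M.HalfEdge) : M.path h (M.hlen h) ∈ W := by
  have := path_base_mem (M.flip h)
  rwa [path_flip, sub_zero] at this

theorem dist_path (h : M.HalfEdge) {s t : ℝ} (hs : s ∈ Icc 0 (M.hlen h))
    (ht : t ∈ Icc 0 (M.hlen h)) : dist (M.path h s) (M.path h t) = |s - t| := by
  obtain ⟨e, _ | _⟩ := h
  · simpa [path] using M.iso e s hs t ht
  · simp only [hlen] at hs ht
    simp only [path, if_true]
    rw [M.iso e _ ⟨by linarith [hs.2], by linarith [hs.1]⟩ _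
      ⟨by linarith [ht.2], by linarith [ht.1]⟩, abs_sub_comm]
    congr 1
    ring

theorem path_inj (h : M.HalfEdge) {s t : ℝ} (hs : s ∈ Icc 0 (M.hlen h))
    (ht : t ∈ Icc 0 (M.hlen h)) (he : M.path h s = M.path h t) : s = t := by
  have := dist_path h hs ht
  rw [he, dist_self, eq_comm, abs_eq_zero, sub_eq_zero] at this
  exact this

theorem path_notMem (h : M.HalfEdge) {t : ℝ} (ht : t ∈ Ioo 0 (M.hlen h)) : M.path h t ∉ W := by
  obtain ⟨e, _ | _⟩ := h
  · simpa [path] using M.inter e t ht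
  · simp only [hlen] at ht
    simpa [path] using M.inter e (M.len e - t) ⟨by linarith [ht.2], by linarith [ht.1]⟩

theorem mem_Ioo_hlen_sub {h : M.HalfEdge} {t : ℝ} (ht : t ∈ Ioo 0 (M.hlen h)) :
    M.hlen h - t ∈ Ioo 0 (M.hlen h) := ⟨by linarith [ht.2], by linarith [ht.1]⟩

theorem path_eq {h h' : M.HalfEdge} {s t : ℝ} (hs : s ∈ Ioo 0 (M.hlen h))
    (ht : t ∈ Ioo 0 (M.hlen h')) (he : M.path h s = M.path h' t) :
    (h' = h ∧ t = s) ∨ (h' = M.flip h ∧ t = M.hlen h - s) := by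
  have h1 : h.1 = h'.1 := by
    obtain ⟨e, b⟩ := h
    obtain ⟨e', b'⟩ := h'
    have hs' := mem_Ioo_hlen_sub hs
    have ht' := mem_Ioo_hlen_sub ht
    cases b <;> cases b' <;> simp only [path, if_true, hlen] at he hs ht hs' ht'
    exacts [M.disj _ _ _ hs _ ht he, M.disj _ _ _ hs _ ht' he, M.disj _ _ _ hs' _ ht he,
      M.disj _ _ _ hs' _ ht' he]
  have h2 : h' = h ∨ h' = M.flip h := by
    obtain ⟨e, b⟩ := h
    obtain ⟨e', b'⟩ := h'
    obtain rfl : e = e' := h1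
    cases b <;> cases b' <;> simp [flip]
  rcases h2 with rfl | rfl
  · exact Or.inl ⟨rfl, path_inj h' (Ioo_subset_Icc_self ht) (Ioo_subset_Icc_self hs) he.symm⟩
  · refine Or.inr ⟨rfl, ?_⟩
    rw [path_flip] at he
    have := path_inj h (Ioo_subset_Icc_self hs)
      (Ioo_subset_Icc_self (mem_Ioo_hlen_sub (h := h) ht)) he
    linarith

theorem exists_path_eq {y : G} (hy : y ∉ W) :
    ∃ h : M.HalfEdge, ∃ t ∈ Ioo 0 (M.hlen h), t ≤ M.hlen h / 2 ∧ M.path h t = y := by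
  obtain ⟨e, t, ht, rfl⟩ := M.cover y hy
  by_cases h2 : t ≤ M.len e / 2
  · exact ⟨(e, false), t, ht, h2, by simp [path]⟩
  · refine ⟨(e, true), M.len e - t, ⟨by linarith [ht.2], ?_⟩, ?_, by simp [path]⟩ <;>
      simp only [hlen] <;> linarith [ht.1]

theorem continuousOn_path (h : M.HalfEdge) : ContinuousOn (M.path h) (Icc 0 (M.hlen h)) := by
  rw [Metric.continuousOn_iff]
  intro b hb ε hε
  refine ⟨ε, hε, fun a ha hab => ?_⟩
  rwa [dist_path h ha hb]

theorem isClosed_path_image (h : M.HalfEdge) {a b : ℝ} (ha : 0 ≤ a) (hb : b ≤ M.hlen h) :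
    IsClosed (M.path h '' Icc a b) :=
  (isCompact_Icc.image_of_continuousOn
    ((continuousOn_path h).mono (Icc_subset_Icc ha hb))).isClosed

theorem isOpen_path_image (h : M.HalfEdge) {a b : ℝ} (ha : 0 ≤ a) (hb : b ≤ M.hlen h) :
    IsOpen (M.path h '' Ioo a b) := by
  have hcl : IsClosed (W ∪ (⋃ h' ∈ {h' | h' ≠ h ∧ h' ≠ M.flip h}, M.path h' '' Icc 0 (M.hlen h')) ∪
      (M.path h '' Icc 0 (min a (M.hlen h)) ∪ M.path h '' Icc (max b 0) (M.hlen h))) := by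
    refine (M.finW.isClosed.union (Set.Finite.isClosed_biUnion (toFinite _) fun h' _ =>
      isClosed_path_image h' le_rfl le_rfl)).union ((isClosed_path_image h le_rfl
        (min_le_right _ _)).union (isClosed_path_image h (le_max_right _ _) le_rfl))
  convert hcl.isOpen_compl using 1
  ext y
  constructor
  · rintro ⟨t, ht, rfl⟩
    have ht' : t ∈ Ioo 0 (M.hlen h) := ⟨ha.trans_lt ht.1, ht.2.trans_le hb⟩
    rintro ((hW | hW) | (⟨s, hs, hst⟩ | ⟨s, hs, hst⟩))
    · exact path_notMem h ht' hW
    · simp only [mem_iUnion] at hW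
      obtain ⟨h', hh', s, hs, hst⟩ := hW
      have hs' : s ∈ Ioo 0 (M.hlen h') := by
        refine ⟨hs.1.lt_of_ne ?_, hs.2.lt_of_ne ?_⟩
        · rintro rfl
          exact path_notMem h ht' (hst ▸ path_base_mem h')
        · rintro rfl
          exact path_notMem h ht' (hst ▸ path_end_mem h')
      rcases path_eq ht' hs' hst.symm with h1 | h1
      exacts [hh'.1 h1.1, hh'.2 h1.1]
    · have := path_inj h ⟨hs.1, hs.2.trans (min_le_right _ _)⟩ (Ioo_subset_Icc_self ht') hst
      linarith [hs.2.trans (min_le_left _ _), ht.1]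
    · have := path_inj h ⟨(le_max_right _ _).trans hs.1, hs.2⟩ (Ioo_subset_Icc_self ht') hst
      linarith [(le_max_left _ _).trans hs.1, ht.2]
  · intro hy
    simp only [mem_compl_iff, mem_union, not_or] at hy
    obtain ⟨⟨hW, hU⟩, h1, h2⟩ := hy
    obtain ⟨h', t, ht, -, rfl⟩ := exists_path_eq (M := M) hW
    have key : ∃ s ∈ Ioo 0 (M.hlen h), M.path h s = M.path h' t := by
      by_contra hcon
      refine hU (mem_biUnion (x := h') ⟨?_, ?_⟩ ⟨t, Ioo_subset_Icc_self ht, rfl⟩)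
      · rintro rfl
        exact hcon ⟨t, ht, rfl⟩
      · rintro rfl
        exact hcon ⟨_, mem_Ioo_hlen_sub (h := h) ht, (path_flip h t).symm⟩
    obtain ⟨s, hs, hst⟩ := key
    rw [← hst] at h1 h2 ⊢
    refine ⟨s, ⟨?_, ?_⟩, rfl⟩
    · by_contra! hc
      exact h1 ⟨s, ⟨hs.1.le, le_min hc hs.2.le⟩, rfl⟩
    · by_contra! hc
      exact h2 ⟨s, ⟨max_le hc hs.1.le, hs.2.le⟩, rfl⟩

/-- The branches of the edge through an interior point. -/
theorem exists_isStar_path (h : M.HalfEdge) {t : ℝ} (ht : t ∈ Ioo 0 (M.hlen h)) :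
    ∃ r, IsStar (M.path h t) (fun (b : Bool) u => M.path h (if b then t + u else t - u)) r := by
  obtain ⟨ε, hε, hball⟩ := Metric.isOpen_iff.1 (isOpen_path_image h le_rfl le_rfl)
    (M.path h t) ⟨t, ht, rfl⟩
  have ht0 := ht.1
  have ht1 := ht.2
  set r := min ε (min t (M.hlen h - t)) with hr
  have hr0 : 0 < r := lt_min hε (lt_min ht.1 (by linarith))
  have hr1 : r ≤ ε := min_le_left _ _
  have hr2 : r ≤ t := (min_le_right _ _).trans (min_le_left _ _)
  have hr3 : r ≤ M.hlen h - t := (min_le_right _ _).trans (min_le_right _ _)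
  have hmem : ∀ (b : Bool), ∀ u ∈ Ico 0 r, (if b then t + u else t - u) ∈ Ioo 0 (M.hlen h) := by
    intro b u hu
    have := hu.1
    have := hu.2
    cases b <;> constructor <;> simp <;> linarith
  refine ⟨r, hr0, by simp, ?_, ?_, ?_, ?_⟩
  · intro b s hs u hu
    rw [dist_path h (Ioo_subset_Icc_self (hmem b s hs)) (Ioo_subset_Icc_self (hmem b u hu))]
    cases b
    · simp only [Bool.false_eq_true, if_false]
      rw [abs_sub_comm]
      congr 1
      ring
    · simp
  · intro b b' s hs u hu he
    have := path_inj h (Ioo_subset_Icc_self (hmem b s (Ioo_subset_Ico_self hs)))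
      (Ioo_subset_Icc_self (hmem b' u (Ioo_subset_Ico_self hu))) he
    have h1 := hs.1
    have h2 := hu.1
    cases b <;> cases b' <;> simp at this ⊢ <;> linarith
  · intro y hy hd
    obtain ⟨s, hs, rfl⟩ := hball (by rw [Metric.mem_ball, dist_comm]; exact hd.trans_le hr1)
    rw [dist_path h (Ioo_subset_Icc_self ht) (Ioo_subset_Icc_self hs)] at hd
    rcases lt_trichotomy s t with hst | rfl | hst
    · rw [abs_of_pos (by linarith)] at hd
      exact ⟨false, t - s, ⟨by linarith, hd⟩, by simp⟩
    · exact (hy rfl).elim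
    · rw [abs_of_neg (by linarith)] at hd
      exact ⟨true, s - t, ⟨by linarith, by linarith⟩, by simp⟩
  · intro b
    cases b
    · have : (fun u => M.path h (t - u)) '' Ioo 0 r = M.path h '' Ioo (t - r) t := by
        rw [← Function.comp_def, image_comp]
        simp
      simpa using this ▸ isOpen_path_image h (by linarith) (by linarith)
    · have : (fun u => M.path h (t + u)) '' Ioo 0 r = M.path h '' Ioo t (t + r) := by
        rw [← Function.comp_def, image_comp]
        simp [add_comm r]
      simpa using this ▸ isOpen_path_image h (by linarith) (by linarith)

theorem exists_isStar_vertex {w : G} (hw : w ∈ W) :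
    ∃ r, (∀ h, r ≤ M.hlen h) ∧ IsStar w (fun h : {h : M.HalfEdge // M.path h 0 = w} => M.path h) r := by
  have hcl : IsClosed (W \ {w} ∪ (⋃ h ∈ {h : M.HalfEdge | M.path h 0 ≠ w},
      M.path h '' Icc 0 (M.hlen h / 2))) :=
    (M.finW.subset sdiff_subset).isClosed.union (Set.Finite.isClosed_biUnion (toFinite _)
      fun h _ => isClosed_path_image h le_rfl (by linarith [hlen_pos h]))
  obtain ⟨ε, hε, hball⟩ := Metric.isOpen_iff.1 hcl.isOpen_compl w (by
    simp only [mem_compl_iff, mem_union, not_or, mem_iUnion]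
    refine ⟨fun h => h.2 rfl, ?_⟩
    rintro ⟨h, hh, t, ht, he⟩
    rcases ht.1.eq_or_lt with rfl | h0
    · exact hh he
    · exact path_notMem h ⟨h0, by linarith [ht.2, hlen_pos h]⟩ (he ▸ hw))
  obtain ⟨ρ, hρ, hρh⟩ : ∃ ρ > 0, ∀ h : M.HalfEdge, ρ ≤ M.hlen h / 2 := by
    rcases isEmpty_or_nonempty M.HalfEdge with hE | hE
    · exact ⟨1, one_pos, fun h => (hE.false h).elim⟩
    · obtain ⟨h₀, hh₀⟩ := Finite.exists_min M.hlen
      exact ⟨M.hlen h₀ / 2, by linarith [hlen_pos h₀], fun h => by linarith [hh₀ h]⟩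
  set r := min ε ρ with hr
  have hr1 : r ≤ ε := min_le_left _ _
  have hr2 : ∀ h, r ≤ M.hlen h / 2 := fun h => (min_le_right _ _).trans (hρh h)
  have hrI : ∀ {h t}, t ∈ Ico 0 r → t ∈ Icc 0 (M.hlen h) := fun {h t} ht =>
    ⟨ht.1, by linarith [ht.2, hr2 h, hlen_pos h]⟩
  have hrI' : ∀ {h t}, t ∈ Ioo 0 r → t ∈ Ioo 0 (M.hlen h) := fun {h t} ht =>
    ⟨ht.1, by linarith [ht.2, hr2 h, hlen_pos h]⟩
  refine ⟨r, fun h => by linarith [hr2 h, hlen_pos h], lt_min hε hρ, fun h => h.2, ?_, ?_, ?_, ?_⟩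
  · intro h s hs t ht
    exact dist_path h.1 (hrI hs) (hrI ht)
  · intro h h' s hs t ht he
    rcases path_eq (hrI' hs) (hrI' ht) he with h1 | h1
    · exact Subtype.ext h1.1.symm
    · linarith [hr2 h, hs.2, ht.2]
  · intro y hy hd
    have hyK := hball (by rw [Metric.mem_ball, dist_comm]; exact hd.trans_le hr1)
    simp only [mem_compl_iff, mem_union, not_or, mem_iUnion] at hyK
    obtain ⟨h, t, ht, ht2, rfl⟩ := exists_path_eq (M := M) fun hyW => hyK.1 ⟨hyW, hy⟩
    have hb : M.path h 0 = w := by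
      by_contra hb
      exact hyK.2 ⟨h, hb, t, ⟨ht.1.le, ht2⟩, rfl⟩
    refine ⟨⟨h, hb⟩, t, ⟨ht.1, ?_⟩, rfl⟩
    rw [← hb, dist_path h ⟨le_rfl, (hlen_pos h).le⟩ (Ioo_subset_Icc_self ht), zero_sub, abs_neg,
      abs_of_pos ht.1] at hd
    exact hd
  · intro h
    exact isOpen_path_image h.1 le_rfl (by linarith [hr2 h, hlen_pos h.1])

/-- A common radius for the stars at the vertices. -/
theorem exists_radius (M : EdgeModel W) : ∃ r, 0 < r ∧ (∀ h, r ≤ M.hlen h) ∧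
    ∀ w ∈ W, IsStar w (fun h : {h : M.HalfEdge // M.path h 0 = w} => M.path h) r := by
  choose! ρ hρ hstar using fun w (hw : w ∈ W) => exists_isStar_vertex (M := M) hw
  rcases W.eq_empty_or_nonempty with rfl | hne
  · exact ⟨1, one_pos, fun h => (path_base_mem h).elim, fun w hw => hw.elim⟩
  · obtain ⟨w₀, hw₀, hmin⟩ := M.finW.exists_minimalFor ρ W hne
    have hmin : ∀ w ∈ W, ρ w₀ ≤ ρ w := fun w hw => by
      rcases le_total (ρ w₀) (ρ w) with h | h
      exacts [h, hmin hw h]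
    exact ⟨ρ w₀, (hstar w₀ hw₀).pos, hρ w₀ hw₀,
      fun w hw => (hstar w hw).mono (hstar w₀ hw₀).pos (hmin w hw)⟩

theorem exists_isStar (M : EdgeModel W) (x : G) :
    ∃ (ι : Type) (_ : Finite ι) (γ : ι → ℝ → G) (r : ℝ), IsStar x γ r := by
  by_cases hx : x ∈ W
  · obtain ⟨r, -, h⟩ := exists_isStar_vertex (M := M) hx
    exact ⟨_, inferInstance, _, r, h⟩
  · obtain ⟨h, t, ht, -, rfl⟩ := exists_path_eq (M := M) hx
    obtain ⟨r, hr⟩ := exists_isStar_path h ht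
    exact ⟨_, inferInstance, _, r, hr⟩

end EdgeModel

/-! ### Convex piecewise linear functions of small oscillation on an interval -/

/-- A continuous function on `[0, ℓ]` with integer one-sided slopes `sR` and `sL` (both outgoing)
whose sum is nonnegative in the interior. -/
structure PLConvex (φ : ℝ → ℝ) (ℓ : ℝ) (sR sL : ℝ → ℤ) : Prop where
  cont : ContinuousOn φ (Icc 0 ℓ)
  right : ∀ t ∈ Ico 0 ℓ, HasSlopeAlong φ (fun u => t + u) (sR t)
  left : ∀ t ∈ Ioc 0 ℓ, HasSlopeAlong φ (fun u => t - u) (sL t)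
  nonneg : ∀ t ∈ Ioo 0 ℓ, 0 ≤ sR t + sL t

namespace PLConvex

variable {φ : ℝ → ℝ} {ℓ : ℝ} {sR sL : ℝ → ℤ}

theorem reflect (h : PLConvex φ ℓ sR sL) :
    PLConvex (fun t => φ (ℓ - t)) ℓ (fun t => sL (ℓ - t)) (fun t => sR (ℓ - t)) where
  cont := h.cont.comp (by fun_prop) fun t ht => ⟨by linarith [ht.2], by linarith [ht.1]⟩
  right t ht := by
    obtain ⟨δ, hδ, H⟩ := h.left (ℓ - t) ⟨by linarith [ht.2], by linarith [ht.1]⟩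
    refine ⟨δ, hδ, fun u hu => ?_⟩
    have := H u hu
    simp only [sub_zero, add_zero] at this ⊢
    rw [← this]
    congr 1
    ring
  left t ht := by
    obtain ⟨δ, hδ, H⟩ := h.right (ℓ - t) ⟨by linarith [ht.2], by linarith [ht.1]⟩
    refine ⟨δ, hδ, fun u hu => ?_⟩
    have := H u hu
    simp only [sub_zero, add_zero] at this ⊢
    rw [← this]
    congr 1
    ring
  nonneg t ht := by
    rw [add_comm]
    exact h.nonneg _ ⟨by linarith [ht.2], by linarith [ht.1]⟩

theorem le_right (h : PLConvex φ ℓ sR sL) {t u : ℝ} (ht : 0 ≤ t) (htu : t ≤ u) (hu : u ≤ ℓ) :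
    φ t + sR t * (u - t) ≤ φ u := by
  by_contra! hlt
  have htu' : t < u := htu.lt_of_ne (by rintro rfl; simp at hlt)
  set m : ℝ := (φ u - φ t) / (u - t) with hm
  have hmu : m * (u - t) = φ u - φ t := div_mul_cancel₀ _ (by linarith)
  have hms : m < sR t := by
    have : m * (u - t) < sR t * (u - t) := by linarith
    exact lt_of_mul_lt_mul_right this (by linarith)
  set χ : ℝ → ℝ := fun x => φ x - φ t - m * (x - t) with hχ
  have hcont : ContinuousOn χ (Icc t u) :=
    ((h.cont.mono (Icc_subset_Icc ht hu)).sub continuousOn_const).sub (by fun_prop)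
  obtain ⟨x₁, hx₁, hmax⟩ := isCompact_Icc.exists_isMaxOn (nonempty_Icc.2 htu) hcont
  have hpos : 0 < χ x₁ := by
    obtain ⟨δ, hδ, H⟩ := h.right t ⟨ht, htu'.trans_le hu⟩
    set d := min δ (u - t) / 2 with hd
    have hd0 : 0 < min δ (u - t) := lt_min hδ (by linarith)
    have hd1 : d < δ := by linarith [min_le_left δ (u - t)]
    have hd2 : d < u - t := by linarith [min_le_right δ (u - t)]
    have h1 := H d ⟨by linarith, hd1⟩
    have h2 : χ (t + d) ≤ χ x₁ := hmax ⟨by linarith, by linarith⟩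
    simp only [add_zero] at h1
    refine lt_of_lt_of_le ?_ h2
    simp only [hχ, h1]
    have : 0 < (sR t - m) * d := mul_pos (by linarith) (by linarith)
    linarith
  obtain ⟨x₀, ⟨hx₀, hval⟩, hleast⟩ := (isCompact_Icc.of_isClosed_subset
    (hcont.preimage_isClosed_of_isClosed isClosed_Icc (isClosed_singleton (x := χ x₁)))
    inter_subset_left).exists_isLeast ⟨x₁, hx₁, rfl⟩
  have hval : χ x₀ = χ x₁ := hval
  have hx0t : t < x₀ := hx₀.1.lt_of_ne fun he => by
    rw [← he] at hval
    simp only [hχ, sub_self, mul_zero] at hval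
    linarith
  have hx0u : x₀ < u := hx₀.2.lt_of_ne fun he => by
    rw [he] at hval
    simp only [hχ] at hval
    linarith
  have h0 : x₀ ∈ Ioo 0 ℓ := ⟨by linarith, by linarith⟩
  have hr : (sR x₀ : ℝ) ≤ m := by
    by_contra! hc
    obtain ⟨δ, hδ, H⟩ := h.right x₀ ⟨h0.1.le, h0.2⟩
    set d := min δ (u - x₀) / 2 with hd
    have hd0 : 0 < min δ (u - x₀) := lt_min hδ (by linarith)
    have h1 := H d ⟨by linarith, by linarith [min_le_left δ (u - x₀)]⟩
    have h2 : χ (x₀ + d) ≤ χ x₁ :=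
      hmax ⟨by linarith, by linarith [min_le_right δ (u - x₀)]⟩
    rw [← hval] at h2
    simp only [hχ, h1, add_zero] at h2
    have : 0 < (sR x₀ - m) * d := mul_pos (by linarith) (by linarith)
    linarith
  have hl : (sL x₀ : ℝ) < -m := by
    by_contra! hc
    obtain ⟨δ, hδ, H⟩ := h.left x₀ ⟨h0.1, h0.2.le⟩
    set d := min δ (x₀ - t) / 2 with hd
    have hd0 : 0 < min δ (x₀ - t) := lt_min hδ (by linarith)
    have h1 := H d ⟨by linarith, by linarith [min_le_left δ (x₀ - t)]⟩
    have hmem : x₀ - d ∈ Icc t u := ⟨by linarith [min_le_right δ (x₀ - t)], by linarith⟩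
    have h2 : χ (x₀ - d) ≤ χ x₁ := hmax hmem
    have h3 : χ (x₀ - d) ≠ χ x₁ := fun he => by
      have := hleast ⟨hmem, he⟩
      linarith
    have h4 := h2.lt_of_ne h3
    rw [← hval] at h4
    simp only [hχ, h1, sub_zero] at h4
    have : 0 ≤ (sL x₀ + m) * d := mul_nonneg (by linarith) (by linarith)
    linarith
  have := h.nonneg x₀ h0
  have : (0:ℝ) ≤ sR x₀ + sL x₀ := by exact_mod_cast this
  linarith

theorem le_left (h : PLConvex φ ℓ sR sL) {t u : ℝ} (hu : 0 ≤ u) (hut : u ≤ t) (ht : t ≤ ℓ) :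
    φ t + sL t * (t - u) ≤ φ u := by
  have := h.reflect.le_right (t := ℓ - t) (u := ℓ - u) (by linarith) (by linarith) (by linarith)
  simpa using this

section SmallOscillation

variable {ε : ℝ} (h : PLConvex φ ℓ sR sL) (hε : 0 < ε)
  (hosc : ∀ s ∈ Icc 0 ℓ, ∀ t ∈ Icc 0 ℓ, |φ s - φ t| < ε)

include h hε hosc

theorem sR_nonpos {t : ℝ} (ht : 0 ≤ t) (htε : ε ≤ ℓ - t) : sR t ≤ 0 := by
  by_contra! hc
  have h1 : (1:ℝ) ≤ sR t := by exact_mod_cast hc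
  have h2 := h.le_right ht (by linarith : t ≤ ℓ) le_rfl
  have h3 := (abs_lt.1 (hosc ℓ ⟨by linarith, le_rfl⟩ t ⟨ht, by linarith⟩)).2
  nlinarith

theorem antitoneOn : AntitoneOn φ (Icc 0 (ℓ - ε)) := by
  intro s hs t ht hst
  rcases hst.eq_or_lt with rfl | hst
  · exact le_rfl
  have h1 := h.sR_nonpos hε hosc ht.1 (by linarith [ht.2])
  have h2 := h.nonneg t ⟨hs.1.trans_lt hst, by linarith [ht.2]⟩
  have h3 : (0:ℝ) ≤ sL t := by exact_mod_cast (by linarith : (0:ℤ) ≤ sL t)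
  have h4 := h.le_left hs.1 hst.le (by linarith [ht.2])
  nlinarith

theorem monotoneOn : MonotoneOn φ (Icc ε ℓ) := by
  intro s hs t ht hst
  have := h.reflect.antitoneOn hε (fun s hs t ht => hosc _ ⟨by linarith [hs.2], by linarith [hs.1]⟩
    _ ⟨by linarith [ht.2], by linarith [ht.1]⟩) (a := ℓ - t) (b := ℓ - s)
    ⟨by linarith [ht.2], by linarith [ht.1]⟩ ⟨by linarith [hs.2], by linarith [hs.1]⟩ (by linarith)
  simpa using this

theorem eq_mid (hℓ : 4 * ε ≤ ℓ) {t : ℝ} (ht : t ∈ Icc ε (ℓ - ε)) : φ t = φ (ℓ / 2) := by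
  have h1 := h.antitoneOn hε hosc
  have h2 := h.monotoneOn hε hosc
  have t1 : t ∈ Icc 0 (ℓ - ε) := ⟨by linarith [ht.1], ht.2⟩
  have t2 : t ∈ Icc ε ℓ := ⟨ht.1, by linarith [ht.2]⟩
  have m1 : ℓ / 2 ∈ Icc 0 (ℓ - ε) := ⟨by linarith, by linarith⟩
  have m2 : ℓ / 2 ∈ Icc ε ℓ := ⟨by linarith, by linarith⟩
  rcases le_total t (ℓ / 2) with h3 | h3
  · exact le_antisymm (h2 t2 m2 h3) (h1 t1 m1 h3)
  · exact le_antisymm (h1 m1 t1 h3) (h2 m2 t2 h3)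

theorem mid_le (hℓ : 4 * ε ≤ ℓ) : φ (ℓ / 2) ≤ φ 0 :=
  h.antitoneOn hε hosc ⟨le_rfl, by linarith⟩ ⟨by linarith, by linarith⟩ (by linarith)

theorem mid_lt_iff (hℓ : 4 * ε ≤ ℓ) : φ (ℓ / 2) < φ 0 ↔ sR 0 < 0 := by
  constructor
  · intro hlt
    by_contra! hc
    have h1 := h.le_right le_rfl (by linarith : 0 ≤ ℓ / 2) (by linarith)
    have h2 : (0:ℝ) ≤ sR 0 := by exact_mod_cast hc
    nlinarith
  · intro hs
    obtain ⟨δ, hδ, H⟩ := h.right 0 ⟨le_rfl, by linarith⟩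
    set d := min δ (ℓ / 2) / 2 with hd
    have hd0 : 0 < min δ (ℓ / 2) := lt_min hδ (by linarith)
    have h1 := H d ⟨by linarith, by linarith [min_le_left δ (ℓ / 2)]⟩
    have h2 : d ≤ ℓ / 2 := by linarith [min_le_right δ (ℓ / 2)]
    have h3 := h.antitoneOn hε hosc (a := d) (b := ℓ / 2) ⟨by linarith, by linarith⟩
      ⟨by linarith, by linarith⟩ h2
    have h4 : (sR 0 : ℝ) < 0 := by exact_mod_cast hs
    simp only [zero_add] at h1
    nlinarith

theorem eq_max (hℓ : 4 * ε ≤ ℓ) (h0 : -1 ≤ sR 0) {t : ℝ} (ht : t ∈ Icc 0 (ℓ - ε)) :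
    φ t = max (φ 0 - t) (φ (ℓ / 2)) := by
  have hs0 : (-1:ℝ) ≤ sR 0 := by exact_mod_cast h0
  refine le_antisymm ?_ (max_le ?_ ?_)
  · by_contra! hc
    obtain ⟨hc1, hc2⟩ := max_lt_iff.1 hc
    have ht0 : 0 < t := ht.1.lt_of_ne (by rintro rfl; simp at hc1)
    have htε : t < ε := by
      by_contra! hge
      exact hc2.ne (h.eq_mid hε hosc hℓ ⟨hge, ht.2⟩).symm
    have h1 := h.sR_nonpos hε hosc ht.1 (by linarith [ht.2])
    rcases h1.eq_or_lt with h2 | h2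
    · have := h.le_right ht.1 (by linarith : t ≤ ℓ / 2) (by linarith)
      rw [h2] at this
      simp only [Int.cast_zero, zero_mul, add_zero] at this
      linarith
    · have h3 := h.nonneg t ⟨ht0, by linarith⟩
      have h4 : (1:ℝ) ≤ sL t := by exact_mod_cast (by linarith : (1:ℤ) ≤ sL t)
      have := h.le_left le_rfl ht.1 (by linarith : t ≤ ℓ)
      nlinarith
  · have := h.le_right le_rfl ht.1 (by linarith [ht.2])
    nlinarith [ht.1]
  · rcases le_total t (ℓ / 2) with h3 | h3
    · exact h.antitoneOn hε hosc ht ⟨by linarith, by linarith⟩ h3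
    · exact (h.eq_mid hε hosc hℓ ⟨by linarith, ht.2⟩).ge

end SmallOscillation

end PLConvex

/-! ### Rational functions on a model -/

theorem isRational_const (c : ℝ) : IsRational fun _ : G => c :=
  ⟨continuous_const, fun _ _ _ _ _ => ⟨0, 1, one_pos, fun t _ => by simp⟩⟩

namespace EdgeModel

variable {W : Set G} {M : EdgeModel W} {f f' : G → ℝ}

theorem ordAt_sub (M : EdgeModel W) (hf : IsRational f) (hf' : IsRational f') (x : G) :
    ordAt (fun x => f x - f' x) x = ordAt f x - ordAt f' x := by
  obtain ⟨ι, _, γ, r, h⟩ := M.exists_isStar x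
  exact h.ordAt_sub hf hf'

theorem ordAt_const (M : EdgeModel W) (c : ℝ) (x : G) : ordAt (fun _ => c) x = 0 := by
  obtain ⟨ι, _, γ, r, h⟩ := M.exists_isStar x
  have := Fintype.ofFinite ι
  rw [h.ordAt_eq (s := fun _ => 0) fun i => ⟨1, one_pos, fun t _ => by simp⟩]
  simp

theorem ordAt_neg (M : EdgeModel W) (hf : IsRational f) (x : G) :
    ordAt (fun x => 0 - f x) x = - ordAt f x := by
  rw [M.ordAt_sub (isRational_const 0) hf, M.ordAt_const, zero_sub]

theorem exists_slope_right (hf : IsRational f) (h : M.HalfEdge) {t : ℝ}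
    (ht : t ∈ Ico 0 (M.hlen h)) :
    ∃ s : ℤ, HasSlopeAlong (fun x => f (M.path h x)) (fun u => t + u) s := by
  obtain ⟨s, hs⟩ := hf.2 (M.path h t) (M.hlen h - t) (fun u => M.path h (t + u))
    (by linarith [ht.2]) ⟨by simp, fun a ha b hb => by
      rw [dist_path h ⟨by linarith [ht.1, ha.1], by linarith [ha.2]⟩
        ⟨by linarith [ht.1, hb.1], by linarith [hb.2]⟩]
      simp⟩
  exact ⟨s, hs⟩

theorem exists_slope_left (hf : IsRational f) (h : M.HalfEdge) {t : ℝ}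
    (ht : t ∈ Ioc 0 (M.hlen h)) :
    ∃ s : ℤ, HasSlopeAlong (fun x => f (M.path h x)) (fun u => t - u) s := by
  obtain ⟨s, hs⟩ := hf.2 (M.path h t) t (fun u => M.path h (t - u))
    ht.1 ⟨by simp, fun a ha b hb => by
      rw [dist_path h ⟨by linarith [ha.2], by linarith [ha.1, ht.2]⟩
        ⟨by linarith [hb.2], by linarith [hb.1, ht.2]⟩, abs_sub_comm]
      congr 1
      ring⟩
  exact ⟨s, hs⟩

theorem ordAt_path (h : M.HalfEdge) {t : ℝ} (ht : t ∈ Ioo 0 (M.hlen h)) {a b : ℤ}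
    (ha : HasSlopeAlong (fun x => f (M.path h x)) (fun u => t + u) a)
    (hb : HasSlopeAlong (fun x => f (M.path h x)) (fun u => t - u) b) :
    ordAt f (M.path h t) = a + b := by
  obtain ⟨r, hr⟩ := exists_isStar_path h ht
  rw [hr.ordAt_eq (s := fun c => if c then a else b)]
  · simp
  · rintro (_ | _)
    · exact hb
    · exact ha

theorem ordAt_vertex {w : G} (hw : w ∈ W) {σ : M.HalfEdge → ℤ}
    (hσ : ∀ h, HasSlopeAlong f (M.path h) (σ h)) :
    ordAt f w = ∑ᶠ h : {h : M.HalfEdge // M.path h 0 = w}, σ h := by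
  obtain ⟨r, -, hr⟩ := exists_isStar_vertex (M := M) hw
  have := Fintype.ofFinite {h : M.HalfEdge // M.path h 0 = w}
  rw [hr.ordAt_eq (s := fun h => σ h) fun h => hσ h, finsum_eq_sum_of_fintype]

theorem exists_slope_vertex (M : EdgeModel W) (hf : IsRational f) :
    ∃ σ : M.HalfEdge → ℤ, ∀ h, HasSlopeAlong f (M.path h) (σ h) := by
  choose σ hσ using fun h : M.HalfEdge => exists_slope_right hf h ⟨le_rfl, hlen_pos h⟩
  refine ⟨σ, fun h => ?_⟩
  simpa [HasSlopeAlong] using hσ h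

theorem exists_plConvex (hf : IsRational f) (h : M.HalfEdge) {ℓ : ℝ} (hℓ : ℓ ≤ M.hlen h)
    (hord : ∀ t ∈ Ioo 0 ℓ, 0 ≤ ordAt f (M.path h t)) :
    ∃ sR sL : ℝ → ℤ, PLConvex (fun x => f (M.path h x)) ℓ sR sL := by
  choose! sR hR using fun t (ht : t ∈ Ico 0 (M.hlen h)) => exists_slope_right hf h ht
  choose! sL hL using fun t (ht : t ∈ Ioc 0 (M.hlen h)) => exists_slope_left hf h ht
  refine ⟨sR, sL, hf.1.comp_continuousOn ((continuousOn_path h).mono (Icc_subset_Icc le_rfl hℓ)),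
    fun t ht => hR t ⟨ht.1, ht.2.trans_le hℓ⟩, fun t ht => hL t ⟨ht.1, ht.2.trans hℓ⟩,
    fun t ht => ?_⟩
  rw [← ordAt_path h ⟨ht.1, ht.2.trans_le hℓ⟩ (hR t ⟨ht.1.le, ht.2.trans_le hℓ⟩)
    (hL t ⟨ht.1, ht.2.le.trans hℓ⟩)]
  exact hord t ht

theorem hasSlopeAlong_path_zero {h : M.HalfEdge} {s : ℤ} :
    HasSlopeAlong (fun x => f (M.path h x)) (fun u => 0 + u) s ↔ HasSlopeAlong f (M.path h) s := by
  simp [HasSlopeAlong]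

/-- A rational function of small oscillation without poles off the vertices is constant outside a
small neighbourhood of the vertices; its shape on edges that it leaves with slope at least `-1`
is completely determined. -/
theorem small_osc (M : EdgeModel W) (hf : IsRational f) {ε : ℝ} (hε : 0 < ε)
    (hlen : ∀ h, 4 * ε ≤ M.hlen h) (hosc : ∀ x y, |f x - f y| < ε)
    (hord : ∀ y ∉ W, 0 ≤ ordAt f y) :
    ∃ σ : M.HalfEdge → ℤ, ∀ h, HasSlopeAlong f (M.path h) (σ h) ∧ σ h ≤ 0 ∧
      f (M.path h (M.hlen h / 2)) ≤ f (M.path h 0) ∧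
      (f (M.path h (M.hlen h / 2)) < f (M.path h 0) ↔ σ h < 0) ∧
      (-1 ≤ σ h → ∀ t ∈ Icc 0 (M.hlen h - ε),
        f (M.path h t) = max (f (M.path h 0) - t) (f (M.path h (M.hlen h / 2)))) := by
  choose sR sL hpl using fun h : M.HalfEdge => exists_plConvex hf h le_rfl
    fun t ht => hord _ (path_notMem h ht)
  have hosc' : ∀ h : M.HalfEdge, ∀ s ∈ Icc 0 (M.hlen h), ∀ t ∈ Icc 0 (M.hlen h),
    |f (M.path h s) - f (M.path h t)| < ε := fun h s _ t _ => hosc _ _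
  refine ⟨fun h => sR h 0, fun h => ⟨hasSlopeAlong_path_zero.1 ((hpl h).right 0
    ⟨le_rfl, hlen_pos h⟩), (hpl h).sR_nonpos hε (hosc' h) le_rfl (by linarith [hlen h]),
    (hpl h).mid_le hε (hosc' h) (hlen h), (hpl h).mid_lt_iff hε (hosc' h) (hlen h),
    fun h0 t ht => (hpl h).eq_max hε (hosc' h) (hlen h) h0 ht⟩⟩

end EdgeModel

theorem hasSlopeAlong_max_right {A c t : ℝ} :
    HasSlopeAlong (fun x : ℝ => max (A - x) c) (fun u => t + u) (if t < A - c then -1 else 0) := by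
  split_ifs with h
  · refine ⟨A - c - t, by linarith, fun u hu => ?_⟩
    simp only [add_zero]
    rw [max_eq_left (by linarith [hu.2]), max_eq_left (by linarith)]
    push_cast
    ring
  · refine ⟨1, one_pos, fun u hu => ?_⟩
    simp only [add_zero]
    rw [max_eq_right (by linarith [hu.1]), max_eq_right (by linarith)]
    simp

theorem hasSlopeAlong_max_left {A c t : ℝ} :
    HasSlopeAlong (fun x : ℝ => max (A - x) c) (fun u => t - u) (if t ≤ A - c then 1 else 0) := by
  split_ifs with h
  · refine ⟨1, by linarith, fun u hu => ?_⟩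
    simp only [sub_zero]
    rw [max_eq_left (by linarith [hu.1]), max_eq_left (by linarith)]
    push_cast
    ring
  · refine ⟨t - (A - c), by linarith, fun u hu => ?_⟩
    simp only [sub_zero]
    rw [max_eq_right (by linarith [hu.2]), max_eq_right (by linarith)]
    simp

theorem HasSlopeAlong.congr_fun {φ ψ : ℝ → ℝ} {g : ℝ → ℝ} {s : ℤ} (hs : HasSlopeAlong ψ g s)
    {δ : ℝ} (hδ : 0 < δ) (h : ∀ t ∈ Ico 0 δ, φ (g t) = ψ (g t)) : HasSlopeAlong φ g s := by
  obtain ⟨δ', hδ', H⟩ := hs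
  refine ⟨min δ δ', lt_min hδ hδ', fun t ht => ?_⟩
  rw [h t ⟨ht.1, ht.2.trans_le (min_le_left _ _)⟩, h 0 ⟨le_rfl, hδ⟩,
    H t ⟨ht.1, ht.2.trans_le (min_le_right _ _)⟩]

namespace EdgeModel

variable {W : Set G} {M : EdgeModel W} {f : G → ℝ}

section Kink

variable {L c : M.HalfEdge → ℝ} (hL : ∀ h, M.hlen h / 2 < L h) (hL' : ∀ h, L h ≤ M.hlen h)
  (hf : ∀ h, ∀ t ∈ Icc 0 (L h), f (M.path h t) = max (f (M.path h 0) - t) (c h))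

include hf

theorem kink_slope (h : M.HalfEdge) {t : ℝ} (ht : t ∈ Ico 0 (L h)) :
    HasSlopeAlong (fun x => f (M.path h x)) (fun u => t + u)
      (if t < f (M.path h 0) - c h then -1 else 0) :=
  hasSlopeAlong_max_right.congr_fun (δ := L h - t) (by linarith [ht.2]) fun u hu =>
    hf h _ ⟨by linarith [ht.1, hu.1], by linarith [hu.2]⟩

include hL in
theorem kink_slope_zero (h : M.HalfEdge) :
    HasSlopeAlong f (M.path h) (if c h < f (M.path h 0) then -1 else 0) := by
  have := kink_slope hf h (t := 0) ⟨le_rfl, by linarith [hL h, hlen_pos h]⟩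
  simp only [sub_pos] at this
  exact hasSlopeAlong_path_zero.1 this

theorem kink_slope_left (h : M.HalfEdge) {t : ℝ} (ht : t ∈ Ioc 0 (L h)) :
    HasSlopeAlong (fun x => f (M.path h x)) (fun u => t - u)
      (if t ≤ f (M.path h 0) - c h then 1 else 0) :=
  hasSlopeAlong_max_left.congr_fun (δ := t) ht.1 fun u hu =>
    hf h _ ⟨by linarith [hu.2], by linarith [hu.1, ht.2]⟩

include hL' in
theorem kink_ordAt_path (h : M.HalfEdge) {t : ℝ} (ht : t ∈ Ioo 0 (L h)) :
    ordAt f (M.path h t) = if t = f (M.path h 0) - c h then 1 else 0 := by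
  rw [ordAt_path h ⟨ht.1, ht.2.trans_le (hL' h)⟩ (kink_slope hf h (Ioo_subset_Ico_self ht))
    (kink_slope_left hf h (Ioo_subset_Ioc_self ht))]
  rcases lt_trichotomy t (f (M.path h 0) - c h) with h1 | h1 | h1
  · rw [if_pos h1, if_pos h1.le, if_neg h1.ne]; rfl
  · rw [if_neg h1.not_lt, if_pos h1.le, if_pos h1]; rfl
  · rw [if_neg h1.not_gt, if_neg h1.not_ge, if_neg h1.ne']; rfl

include hL

theorem kink_ordAt_vertex {w : G} (hw : w ∈ W) :
    ordAt f w = - (Nat.card {h : {h : M.HalfEdge // M.path h 0 = w} // c h < f w} : ℤ) := by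
  classical
  have := Fintype.ofFinite {h : M.HalfEdge // M.path h 0 = w}
  rw [ordAt_vertex hw (kink_slope_zero hL hf), finsum_eq_sum_of_fintype, Nat.card_eq_fintype_card,
    Fintype.card_subtype, Finset.card_filter]
  push_cast
  rw [← Finset.sum_neg_distrib]
  refine Finset.sum_congr rfl fun h _ => ?_
  rw [h.2]
  split_ifs <;> simp

theorem kink_isRational (hcont : Continuous f) : IsRational f := by
  refine isRational_of_stars hcont fun x => ?_
  by_cases hx : x ∈ W
  · obtain ⟨r, -, hr⟩ := exists_isStar_vertex (M := M) hx
    exact ⟨_, _, r, hr, fun h => ⟨_, kink_slope_zero hL hf h.1⟩⟩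
  · obtain ⟨h, t, ht, ht2, rfl⟩ := exists_path_eq (M := M) hx
    obtain ⟨r, hr⟩ := exists_isStar_path h ht
    refine ⟨_, _, r, hr, ?_⟩
    rintro (_ | _)
    · exact ⟨_, kink_slope_left hf h ⟨ht.1, ht2.trans (hL h).le⟩⟩
    · exact ⟨_, kink_slope hf h ⟨ht.1.le, ht2.trans_lt (hL h)⟩⟩

end Kink

end EdgeModel

/-! ### The distance on a linear system -/

theorem abs_sub_le_osc [CompactSpace G] {f : G → ℝ} (hf : Continuous f) (x y : G) :
    |f x - f y| ≤ osc f := by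
  have hc := isCompact_range hf
  have h1 := fun z => le_csSup hc.bddAbove (mem_range_self (f := f) z)
  have h2 := fun z => csInf_le hc.bddBelow (mem_range_self (f := f) z)
  rw [osc, abs_le]
  constructor <;> linarith [h1 x, h2 x, h1 y, h2 y]

theorem osc_le {X : Type*} [Nonempty X] {f : X → ℝ} {ε : ℝ} (h : ∀ x y, |f x - f y| ≤ ε) :
    osc f ≤ ε := by
  rw [osc, sub_le_iff_le_add]
  refine csSup_le (range_nonempty f) ?_
  rintro _ ⟨x, rfl⟩
  rw [← sub_le_iff_le_add']
  refine le_csInf (range_nonempty f) ?_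
  rintro _ ⟨y, rfl⟩
  linarith [(abs_le.1 (h x y)).2]

theorem exists_of_linDist_lt [CompactSpace G] {D D' : G → ℤ} {ε : ℝ} (hDD' : LinEquiv D D')
    (h : linDist D D' < ε) :
    ∃ f, IsRational f ∧ (∀ x, D' x = D x + ordAt f x) ∧ ∀ x y, |f x - f y| < ε := by
  obtain ⟨f₀, hf₀, hD₀⟩ := hDD'
  rw [linDist] at h
  obtain ⟨_, ⟨f, hf, hD, rfl⟩, hlt⟩ := exists_lt_of_csInf_lt
    (by exact ⟨_, f₀, hf₀, hD₀, rfl⟩) h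
  exact ⟨f, hf, hD, fun x y => (abs_sub_le_osc hf.1 x y).trans_lt hlt⟩

theorem linDist_le [CompactSpace G] [Nonempty G] {D D' : G → ℤ} {ε : ℝ} {f : G → ℝ}
    (hf : IsRational f) (hD : ∀ x, D' x = D x + ordAt f x) (h : ∀ x y, |f x - f y| ≤ ε) :
    linDist D D' ≤ ε := by
  rw [linDist]
  refine (csInf_le ?_ (by exact ⟨f, hf, hD, rfl⟩)).trans (osc_le h)
  refine ⟨0, ?_⟩
  rintro _ ⟨g, hg, -, rfl⟩
  obtain ⟨x⟩ := ‹Nonempty G›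
  exact (abs_nonneg _).trans (abs_sub_le_osc hg.1 x x)

theorem EdgeModel.linEquiv_of_mem {W : Set G} (M : EdgeModel W) {D₀ D D' : G → ℤ}
    (hD : LinEquiv D₀ D) (hD' : LinEquiv D₀ D') : LinEquiv D D' := by
  obtain ⟨f, hf, h⟩ := hD
  obtain ⟨f', hf', h'⟩ := hD'
  refine ⟨fun x => f' x - f x, hf'.sub hf, fun x => ?_⟩
  rw [M.ordAt_sub hf' hf, h, h']
  ring

theorem EdgeModel.linEquiv_trans {W : Set G} (M : EdgeModel W) {D₀ D D' : G → ℤ}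
    (hD : LinEquiv D₀ D) (hD' : LinEquiv D D') : LinEquiv D₀ D' := by
  obtain ⟨f, hf, h⟩ := hD
  obtain ⟨f', hf', h'⟩ := hD'
  refine ⟨fun x => f x - (0 - f' x), hf.sub ((isRational_const 0).sub hf'), fun x => ?_⟩
  rw [M.ordAt_sub hf ((isRational_const 0).sub hf'), M.ordAt_neg hf', h', h]
  ring

/-! ### Semicontinuity of multiplicities -/

namespace EdgeModel

variable {W : Set G} {M : EdgeModel W}

theorem le_dist_of_mem {r : ℝ} (hr : ∀ h, r ≤ M.hlen h)
    (hst : ∀ w ∈ W, IsStar w (fun h : {h : M.HalfEdge // M.path h 0 = w} => M.path h) r)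
    {w y : G} (hw : w ∈ W) (hy : y ∈ W) (hne : y ≠ w) : r ≤ dist w y := by
  by_contra! hlt
  obtain ⟨h, t, ht, rfl⟩ := (hst w hw).cover y hne hlt
  exact path_notMem h.1 ⟨ht.1, ht.2.trans_le (hr _)⟩ hy

/-- A chip cannot disappear under a small deformation. -/
theorem exists_ne_zero_near {r : ℝ} {D D' : G → ℤ} (hD : ∀ y ∉ W, D y = 0)
    {g : G → ℝ} (hg : IsRational g)
    (hD' : ∀ x, D' x = D x + ordAt g x) {ε : ℝ} (hε : 0 < ε) (hosc : ∀ x y, |g x - g y| < ε)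
    (hεr : ε < r) (hr : ∀ h, r ≤ M.hlen h) {p : G} (hp : p ∈ W) (hDp : 0 < D p) :
    ∃ y, dist p y < ε ∧ D' y ≠ 0 := by
  by_contra! hcon
  have h0 : ordAt g p < 0 := by
    have := hD' p
    rw [hcon p (by simpa using hε)] at this
    linarith
  obtain ⟨σ, hσ⟩ := M.exists_slope_vertex hg
  rw [ordAt_vertex hp hσ] at h0
  obtain ⟨⟨h, rfl⟩, hneg⟩ : ∃ h : {h : M.HalfEdge // M.path h 0 = p}, σ h < 0 := by
    by_contra! hc
    exact absurd (finsum_nonneg hc) h0.not_ge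
  have hng := (isRational_const (0:ℝ)).sub hg
  obtain ⟨sR, sL, hpl⟩ := exists_plConvex hng h (hεr.le.trans (hr h)) fun t ht => by
    have ht' : t ∈ Ioo 0 (M.hlen h) := ⟨ht.1, ht.2.trans (hεr.trans_le (hr h))⟩
    have h1 := hD' (M.path h t)
    rw [hD _ (path_notMem h ht'), hcon _ (by
      rw [dist_path h ⟨le_rfl, (hlen_pos h).le⟩ (Ioo_subset_Icc_self ht'), zero_sub, abs_neg,
        abs_of_pos ht.1]
      exact ht.2)] at h1
    rw [M.ordAt_neg hg]
    linarith
  have hs : sR 0 = 0 - σ h := by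
    refine (hasSlopeAlong_path_zero.1 (hpl.right 0 ⟨le_rfl, hε⟩)).unique
      (HasSlopeAlong.sub (f := fun _ => 0) ⟨1, one_pos, fun t _ => by simp⟩ (hσ h))
  have h1 := hpl.le_right le_rfl hε.le le_rfl
  have h2 : (1:ℝ) ≤ sR 0 := by
    have : 1 ≤ sR 0 := by rw [hs]; simp only at hneg; linarith
    exact_mod_cast this
  have h3 := (abs_lt.1 (hosc (M.path h 0) (M.path h ε))).2
  nlinarith

end EdgeModel

theorem exists_semicontinuous [CompactSpace G] {V : Set G} (hV : IsGraphModel V) {D : G → ℤ}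
    (hD : FinSupp D) (hDe : Effective D) :
    ∃ ε > 0, ∀ D', FinSupp D' → Effective D' → LinEquiv D D' → linDist D D' < ε →
      (∀ v ∈ V, D' v ≤ D v) ∧ (edgeSupp V D).ncard ≤ (edgeSupp V D').ncard := by
  obtain ⟨M₀⟩ := exists_edgeModel hV
  obtain ⟨M⟩ := M₀.union hD
  obtain ⟨r, hr0, hr, hst⟩ := M.exists_radius
  have hD0 : ∀ y ∉ V ∪ support D, D y = 0 := fun y hy => by
    by_contra hc
    exact hy (Or.inr hc)
  refine ⟨r / 4, by linarith, fun D' hD' hDe' hlin hdist => ?_⟩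
  obtain ⟨g, hg, hDD', hosc⟩ := exists_of_linDist_lt hlin hdist
  constructor
  · intro v hv
    obtain ⟨σ, hσ⟩ := M.small_osc hg (by linarith : 0 < r / 4) (fun h => by linarith [hr h]) hosc
      fun y hy => by
        have := hDD' y
        rw [hD0 y hy, zero_add] at this
        exact this ▸ hDe' y
    rw [hDD', EdgeModel.ordAt_vertex (M := M) (Or.inl hv) fun h => (hσ h).1]
    have := finsum_nonneg (f := fun h : {h : M.HalfEdge // M.path h 0 = v} => - σ h)
      fun h => by linarith [(hσ h).2.1]
    rw [finsum_neg_distrib] at this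
    linarith
  · have hex : ∀ p ∈ edgeSupp V D, ∃ y, dist p y < r / 4 ∧ D' y ≠ 0 := fun p hp =>
      EdgeModel.exists_ne_zero_near hD0 hg hDD' (by linarith) hosc (by linarith) hr
        (Or.inr hp.2) ((hDe p).lt_of_ne hp.2.symm)
    choose! y hy hy0 using hex
    refine ncard_le_ncard_of_injOn y ?_ ?_ (hD'.subset fun x hx => hx.2)
    · refine fun p hp => ⟨fun hyV => ?_, hy0 p hp⟩
      have := EdgeModel.le_dist_of_mem hr hst (Or.inr hp.2 : p ∈ V ∪ support D) (Or.inl hyV)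
        (fun he => hp.1 (he ▸ hyV))
      linarith [hy p hp]
    · intro p hp q hq he
      by_contra hne
      have := EdgeModel.le_dist_of_mem hr hst (Or.inr hp.2 : p ∈ V ∪ support D)
        (Or.inr hq.2 : q ∈ V ∪ support D) (Ne.symm hne)
      have h1 := hy q hq
      rw [← he, dist_comm] at h1
      linarith [hy p hp, dist_triangle p (y p) q]

/-- A divisor in the closed cell of `D` has at least the multiplicities of `D` at the vertices, and
at most as many chip positions in the open edges. -/
theorem InClosedCell.le [CompactSpace G] {V : Set G} (hV : IsGraphModel V) {D₀ D D' : G → ℤ}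
    (hD : FinSupp D) (hDe : Effective D) (hD' : FinSupp D') (hDe' : Effective D')
    (hlin : LinEquiv D₀ D') (h : InClosedCell V D₀ D D') :
    (∀ v ∈ V, D v ≤ D' v) ∧ (edgeSupp V D').ncard ≤ (edgeSupp V D).ncard := by
  obtain ⟨ε, hε, H⟩ := exists_semicontinuous hV hD' hDe'
  obtain ⟨D'', ⟨hVD, ⟨φ, hφV, hφ, hφD⟩, f₁, f₂, hf₁, hf₂, hDf₁, hDf₂, -⟩, hdist⟩ := h ε hε
  obtain ⟨M⟩ := exists_edgeModel hV
  have hφD' : ∀ x, D'' x = D (φ.symm x) := fun x => by rw [← hφD, φ.apply_symm_apply]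
  have hfin : FinSupp D'' := by
    refine (hD.image φ).subset fun x hx => ⟨φ.symm x, ?_, by simp⟩
    rwa [mem_support, ← hφD']
  obtain ⟨h1, h2⟩ := H D'' hfin (fun x => hφD' x ▸ hDe _)
    (M.linEquiv_of_mem hlin ⟨f₂, hf₂, hDf₂⟩) hdist
  refine ⟨fun v hv => (hVD v hv).trans_le (h1 v hv), h2.trans ?_⟩
  have : edgeSupp V D'' ⊆ φ '' edgeSupp V D := by
    refine fun x hx => ⟨φ.symm x, ⟨fun hv => hx.1 ?_, ?_⟩, by simp⟩
    · have := hφV _ hv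
      rw [φ.apply_symm_apply] at this
      rwa [this]
    · rw [← hφD']
      exact hx.2
  have hfin' : (edgeSupp V D).Finite := hD.subset fun x hx => hx.2
  exact (ncard_le_ncard this (hfin'.image _)).trans (ncard_image_le hfin')

/-! ### Firing a closed subgraph -/

theorem inter_frontier_nonempty_of_isPreconnected {X : Type*} [TopologicalSpace X] {S Z : Set X}
    (hS : IsPreconnected S) (h₁ : (S ∩ Z).Nonempty) (h₂ : (S ∩ Zᶜ).Nonempty) :
    (S ∩ frontier Z).Nonempty := by
  by_contra hne
  have hfr : ∀ y ∈ S, y ∉ frontier Z := fun y hy hf => hne ⟨y, hy, hf⟩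
  have hin : ∀ y ∈ S, y ∈ Z → y ∈ interior Z := fun y hy hyZ => by
    by_contra hc
    exact hfr y hy ⟨subset_closure hyZ, hc⟩
  have hout : ∀ y ∈ S, y ∉ Z → y ∈ interior Zᶜ := fun y hy hyZ => by
    by_contra hc
    rw [← frontier_compl] at hfr
    exact hfr y hy ⟨subset_closure hyZ, hc⟩
  obtain ⟨y, -, hy₁, hy₂⟩ := hS _ _ isOpen_interior isOpen_interior
    (fun y hy => (em (y ∈ Z)).imp (hin y hy) (hout y hy))
    (h₁.imp fun y hy => ⟨hy.1, hin y hy.1 hy.2⟩) (h₂.imp fun y hy => ⟨hy.1, hout y hy.1 hy.2⟩)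
  exact interior_subset hy₂ (interior_subset hy₁)

theorem isClosed_of_mem_compsOf {Z C : Set G} (hZ : IsClosed Z) (hC : C ∈ compsOf Z) :
    IsClosed C :=
  isClosed_of_closure_subset fun _ hx => closure_inter_of_mem_compsOf hC
    ⟨hx, closure_minimal (subset_of_mem_compsOf hC) hZ hx⟩

namespace IsStar

variable {x : G} {ι : Type*} {γ : ι → ℝ → G} {r : ℝ}

theorem isOpen_image (h : IsStar x γ r) (i : ι) {s t : ℝ} (hs : 0 ≤ s) (ht : t ≤ r) :
    IsOpen (γ i '' Ioo s t) := by
  have : γ i '' Ioo s t = γ i '' Ioo 0 r ∩ {y | s < dist x y ∧ dist x y < t} := by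
    ext y
    constructor
    · rintro ⟨u, hu, rfl⟩
      have hu' : u ∈ Ioo 0 r := ⟨hs.trans_lt hu.1, hu.2.trans_le ht⟩
      refine ⟨⟨u, hu', rfl⟩, ?_⟩
      rw [mem_ofPred_eq, h.dist_eq i ⟨hu'.1.le, hu'.2⟩]
      exact hu
    · rintro ⟨⟨u, hu, rfl⟩, hd⟩
      rw [mem_ofPred_eq, h.dist_eq i ⟨hu.1.le, hu.2⟩] at hd
      exact ⟨u, hd, rfl⟩
  rw [this]
  refine (h.isOpen i).inter
    ((isOpen_lt continuous_const ?_).and (isOpen_lt ?_ continuous_const)) <;>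
    fun_prop

/-- Near the centre of a star, a closed set with finitely many components contains all or nothing
of each branch. -/
theorem eventually_mem_or_notMem (h : IsStar x γ r) {Z : Set G} (hZ : IsClosed Z)
    (hfin : (compsOf Z).Finite) (hx : x ∈ Z) (i : ι) :
    ∃ δ > 0, δ ≤ r ∧ ((∀ t ∈ Ioo 0 δ, γ i t ∈ Z) ∨ ∀ t ∈ Ioo 0 δ, γ i t ∉ Z) := by
  have hK : IsClosed (⋃ C ∈ {C ∈ compsOf Z | x ∉ C}, C) :=
    (hfin.subset (sep_subset _ _)).isClosed_biUnion fun C hC => isClosed_of_mem_compsOf hZ hC.1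
  obtain ⟨ε, hε, hball⟩ := Metric.isOpen_iff.1 hK.isOpen_compl x (by
    simp only [mem_compl_iff, mem_iUnion, not_exists]
    exact fun C hC hxC => hC.2 hxC)
  set d := min ε r with hd
  have hd0 : 0 < d := lt_min hε h.pos
  have hdr : d ≤ r := min_le_right _ _
  have hcomp : ∀ t ∈ Ioo 0 d, γ i t ∈ Z → γ i t ∈ connectedComponentIn Z x := by
    intro t ht hZt
    have hnot := hball (show γ i t ∈ Metric.ball x ε by
      rw [Metric.mem_ball, dist_comm, h.dist_eq i ⟨ht.1.le, ht.2.trans_le hdr⟩]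
      exact ht.2.trans_le (min_le_left _ _))
    simp only [mem_compl_iff, mem_iUnion, not_exists] at hnot
    have hx' : x ∈ connectedComponentIn Z (γ i t) := by
      by_contra hc
      exact hnot _ ⟨⟨_, hZt, rfl⟩, hc⟩ (mem_connectedComponentIn hZt)
    rw [← connectedComponentIn_eq hx']
    exact mem_connectedComponentIn hZt
  by_contra! hcon
  obtain ⟨s', hs', hs'Z⟩ := (hcon d hd0 hdr).1
  obtain ⟨t, ht, htZ⟩ := (hcon s' hs'.1 (hs'.2.le.trans hdr)).2
  obtain ⟨s, hs, hsZ⟩ := (hcon t ht.1 (ht.2.le.trans (hs'.2.le.trans hdr))).1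
  have hs'r : s' < r := hs'.2.trans_le hdr
  have hcl : IsClosed (γ i '' Icc s s') := (isCompact_Icc.image_of_continuousOn
    ((h.continuousOn i).mono fun u hu => ⟨hs.1.le.trans hu.1, hu.2.trans_lt hs'r⟩)).isClosed
  have hsub : connectedComponentIn Z x ⊆ γ i '' Ioo s s' := by
    refine isPreconnected_connectedComponentIn.subset_left_of_subset_union
      (h.isOpen_image i hs.1.le hs'r.le) hcl.isOpen_compl ?_ ?_ ?_
    · rw [disjoint_compl_right_iff_subset]
      exact image_mono Ioo_subset_Icc_self
    · intro y hy
      have hyZ := connectedComponentIn_subset Z x hy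
      by_cases hm : y ∈ γ i '' Icc s s'
      · left
        obtain ⟨u, hu, rfl⟩ := hm
        exact ⟨u, ⟨hu.1.lt_of_ne (by rintro rfl; exact hsZ hyZ),
          hu.2.lt_of_ne (by rintro rfl; exact hs'Z hyZ)⟩, rfl⟩
      · exact Or.inr hm
    · exact ⟨γ i t, hcomp t ⟨ht.1, ht.2.trans hs'.2⟩ htZ, t, ⟨hs.2, ht.2⟩, rfl⟩
  obtain ⟨u, hu, hux⟩ := hsub (mem_connectedComponentIn hx)
  exact h.ne i ⟨hs.1.trans hu.1, hu.2.trans hs'r⟩ hux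

theorem exists_frontier_inter_subset [Finite ι] (h : IsStar x γ r) {Z : Set G} (hZ : IsClosed Z)
    (hfin : (compsOf Z).Finite) (hx : x ∈ Z) : ∃ U ∈ nhds x, U ∩ frontier Z ⊆ {x} := by
  choose δ hδ hδr hor using h.eventually_mem_or_notMem hZ hfin hx
  obtain ⟨d, hd0, hdr, hd⟩ : ∃ d > 0, d ≤ r ∧ ∀ i, d ≤ δ i := by
    rcases isEmpty_or_nonempty ι with hE | hE
    · exact ⟨r, h.pos, le_rfl, fun i => (hE.false i).elim⟩
    · obtain ⟨i₀, hi₀⟩ := Finite.exists_min δ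
      exact ⟨δ i₀, hδ i₀, hδr i₀, hi₀⟩
  refine ⟨Metric.ball x d, Metric.ball_mem_nhds x hd0, fun y hy => ?_⟩
  by_contra hne
  obtain ⟨hyb, hyf⟩ := hy
  rw [Metric.mem_ball, dist_comm] at hyb
  obtain ⟨i, t, ht, rfl⟩ := (h.mono hd0 hdr).cover y hne hyb
  have ho := (h.mono hd0 hdr).isOpen i
  rcases hor i with h1 | h1
  · refine hyf.2 (mem_interior.2 ⟨_, ?_, ho, mem_image_of_mem _ ht⟩)
    rintro _ ⟨u, hu, rfl⟩
    exact h1 u ⟨hu.1, hu.2.trans_le (hd i)⟩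
  · refine h1 t ⟨ht.1, ht.2.trans_le (hd i)⟩ ?_
    exact hZ.closure_subset hyf.1

end IsStar

theorem EdgeModel.finite_frontier [CompactSpace G] {W : Set G} (M : EdgeModel W) {Z : Set G}
    (hZ : IsClosed Z) (hfin : (compsOf Z).Finite) : (frontier Z).Finite := by
  have hex : ∀ x ∈ Z, ∃ U ∈ nhds x, U ∩ frontier Z ⊆ {x} := by
    intro x hx
    obtain ⟨ι, _, γ, r, h⟩ := M.exists_isStar x
    exact h.exists_frontier_inter_subset hZ hfin hx
  choose! U hU hUs using hex
  obtain ⟨F, hF, hcov⟩ := hZ.isCompact.elim_nhds_subcover U hU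
  refine F.finite_toSet.subset fun y hy => ?_
  obtain ⟨x, hx, hyU⟩ := mem_iUnion₂.1 (hcov (hZ.frontier_subset hy))
  rw [show y = x from hUs x (hF x hx) ⟨hyU, hy⟩]
  exact hx

namespace EdgeModel

variable {W : Set G} {M : EdgeModel W} {Z : Set G}

/-- The oriented edge `h` is disjoint from `Z`. -/
def Avoids (Z : Set G) (h : M.HalfEdge) : Prop := ∀ t ∈ Ioo 0 (M.hlen h), M.path h t ∉ Z

theorem path_mem_of_not_avoids (hfr : frontier Z ⊆ W) {h : M.HalfEdge} (ha : ¬Avoids Z h) {t : ℝ}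
    (ht : t ∈ Ioo 0 (M.hlen h)) : M.path h t ∈ Z := by
  by_contra hc
  simp only [Avoids, not_forall, not_not] at ha
  obtain ⟨s, hs, hsZ⟩ := ha
  obtain ⟨_, ⟨u, hu, rfl⟩, huf⟩ := inter_frontier_nonempty_of_isPreconnected
    (isPreconnected_Ioo.image _ ((continuousOn_path h).mono Ioo_subset_Icc_self))
    ⟨_, mem_image_of_mem _ hs, hsZ⟩ ⟨_, mem_image_of_mem _ ht, hc⟩
  exact path_notMem h hu (hfr huf)

theorem path_zero_mem_closure (h : M.HalfEdge) {S : Set G}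
    (hS : ∀ t ∈ Ioo 0 (M.hlen h), M.path h t ∈ S) : M.path h 0 ∈ closure S := by
  have hc : closure (Ioo 0 (M.hlen h)) = Icc 0 (M.hlen h) := closure_Ioo (hlen_pos h).ne
  refine closure_mono (image_subset_iff.2 hS) (ContinuousOn.image_closure ?_
    ⟨0, ?_, rfl⟩)
  · rw [hc]; exact continuousOn_path h
  · rw [hc]; exact ⟨le_rfl, (hlen_pos h).le⟩

theorem avoids_iff (hfr : frontier Z ⊆ W) (h : M.HalfEdge) :
    (∃ δ > (0:ℝ), ∀ t ∈ Ioo (0:ℝ) δ, M.path h t ∉ interior Z) ↔ Avoids Z h := by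
  constructor
  · rintro ⟨δ, hδ, H⟩
    by_contra ha
    set t := min δ (M.hlen h) / 2 with ht
    have h0 : 0 < min δ (M.hlen h) := lt_min hδ (hlen_pos h)
    refine H t ⟨by linarith, by linarith [min_le_left δ (M.hlen h)]⟩ (mem_interior.2
      ⟨_, ?_, isOpen_path_image h le_rfl le_rfl, t, ⟨by linarith,
        by linarith [min_le_right δ (M.hlen h)]⟩, rfl⟩)
    rintro _ ⟨u, hu, rfl⟩
    exact path_mem_of_not_avoids hfr ha hu
  · intro ha
    exact ⟨M.hlen h, hlen_pos h, fun t ht hi => ha t ht (interior_subset hi)⟩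

theorem degOut_eq (hfr : frontier Z ⊆ W) {w : G} (hw : w ∈ W) :
    degOut Z w = Nat.card {h : {h : M.HalfEdge // M.path h 0 = w} // Avoids Z h.1} := by
  obtain ⟨r, -, hr⟩ := exists_isStar_vertex (M := M) hw
  rw [hr.degOut_eq]
  exact Nat.card_congr (Equiv.subtypeEquivRight fun h => avoids_iff hfr h.1)

theorem degOut_pos (hZ : IsClosed Z) (hfr : frontier Z ⊆ W) (M : EdgeModel W) {w : G}
    (hw : w ∈ frontier Z) : 0 < degOut Z w := by
  rw [degOut_eq (M := M) hfr (hfr hw)]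
  refine Nat.card_pos_iff.2 ⟨?_, inferInstance⟩
  by_contra hE
  obtain ⟨r, hrl, hr⟩ := exists_isStar_vertex (M := M) (hfr hw)
  refine hw.2 (mem_interior.2 ⟨Metric.ball w r, fun y hy => ?_, Metric.isOpen_ball,
    Metric.mem_ball_self hr.pos⟩)
  by_cases hyw : y = w
  · rw [hyw]; exact hZ.frontier_subset hw
  · rw [Metric.mem_ball, dist_comm] at hy
    obtain ⟨h, t, ht, rfl⟩ := hr.cover y hyw hy
    exact path_mem_of_not_avoids hfr (fun ha => hE ⟨⟨h, ha⟩⟩) ⟨ht.1, ht.2.trans_le (hrl _)⟩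

open scoped Classical in
/-- The function that fires the closed subgraph `Z` by a small amount `δ`. -/
noncomputable def fire (W Z : Set G) (δ : ℝ) (y : G) : ℝ :=
  if y ∈ Z then 0 else -min δ (Metric.infDist y (W ∩ Z))

theorem continuous_fire (hZ : IsClosed Z) (hfr : frontier Z ⊆ W) {δ : ℝ} (hδ : 0 ≤ δ) :
    Continuous (fire W Z δ) := by
  classical
  refine Continuous.if (p := fun y => y ∈ Z) (fun a ha => ?_) continuous_const
    (continuous_const.min (Metric.continuous_infDist_pt _)).neg
  have ha' : a ∈ W ∩ Z := ⟨hfr ha, hZ.frontier_subset ha⟩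
  rw [Metric.infDist_zero_of_mem ha', min_eq_right hδ, neg_zero]

theorem fire_mem_Icc {δ : ℝ} (hδ : 0 ≤ δ) (y : G) : fire W Z δ y ∈ Icc (-δ) 0 := by
  unfold fire
  split_ifs
  · simpa using hδ
  · exact ⟨neg_le_neg (min_le_left _ _),
      neg_nonpos.2 (le_min hδ Metric.infDist_nonneg)⟩

open scoped Classical in
/-- The value of `fire` on the inner part of an edge. -/
noncomputable def fireMid (Z : Set G) (δ : ℝ) (h : M.HalfEdge) : ℝ :=
  if Avoids Z h then -δ else 0

theorem fire_path (hZ : IsClosed Z) (hfr : frontier Z ⊆ W) (hne : (frontier Z).Nonempty)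
    {r : ℝ} (hr : ∀ h, r ≤ M.hlen h)
    (hst : ∀ w ∈ W, IsStar w (fun h : {h : M.HalfEdge // M.path h 0 = w} => M.path h) r)
    {δ : ℝ} (hδ : 0 < δ) (hδr : 4 * δ ≤ r) (h : M.HalfEdge) :
    ∀ t ∈ Icc 0 (M.hlen h - δ),
      fire W Z δ (M.path h t) = max (fire W Z δ (M.path h 0) - t) (fireMid Z δ h) := by
  intro t ht
  have hrh := hr h
  have htI : t ∈ Icc 0 (M.hlen h) := ⟨ht.1, by linarith [ht.2]⟩
  have hbase : M.path h 0 ∈ W := path_base_mem h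
  have hnon : (W ∩ Z).Nonempty := hne.mono fun y hy => ⟨hfr hy, hZ.frontier_subset hy⟩
  have hdist0 : dist (M.path h t) (M.path h 0) = t := by
    rw [dist_path h htI ⟨le_rfl, (hlen_pos h).le⟩, sub_zero, abs_of_nonneg ht.1]
  have hfar : ∀ w ∈ W, w ≠ M.path h 0 → δ ≤ dist (M.path h t) w := by
    intro w hw hwne
    have h1 := le_dist_of_mem hr hst hbase hw hwne
    by_cases htd : t ≤ δ
    · have := dist_triangle_left (M.path h 0) w (M.path h t)
      linarith
    · by_contra! hlt
      rw [dist_comm] at hlt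
      have hto : t ∈ Ioo 0 (M.hlen h) := ⟨by linarith, by linarith [ht.2]⟩
      obtain ⟨h', s, hs, he⟩ := ((hst w hw).mono hδ (by linarith)).cover _
        (fun hc => path_notMem h hto (by rw [hc]; exact hw)) hlt
      rcases path_eq hto ⟨hs.1, by linarith [hs.2, hr h'.1]⟩ he.symm with h2 | h2
      · linarith [hs.2]
      · linarith [hs.2, ht.2]
  by_cases ha : Avoids Z h
  · rw [fireMid, if_pos ha]
    have hval : 0 < t ∨ M.path h 0 ∉ Z →
        fire W Z δ (M.path h t) = -min δ (Metric.infDist (M.path h t) (W ∩ Z)) := by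
      intro hor
      refine if_neg ?_
      rcases ht.1.eq_or_lt with rfl | h0
      · exact hor.resolve_left (lt_irrefl _)
      · exact ha t ⟨h0, by linarith [ht.2]⟩
    by_cases hb : M.path h 0 ∈ Z
    · have hf0 : fire W Z δ (M.path h 0) = 0 := if_pos hb
      rw [hf0, zero_sub, max_neg_neg]
      rcases ht.1.eq_or_lt with rfl | h0
      · rw [hf0, min_eq_left hδ.le, neg_zero]
      rw [hval (Or.inl h0), min_comm t δ]
      congr 1
      have hle : Metric.infDist (M.path h t) (W ∩ Z) ≤ t :=
        (Metric.infDist_le_dist_of_mem (s := W ∩ Z) ⟨hbase, hb⟩).trans_eq hdist0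
      have hge : min δ t ≤ Metric.infDist (M.path h t) (W ∩ Z) := by
        refine (Metric.le_infDist hnon).2 fun {w} hw => ?_
        by_cases hwb : w = M.path h 0
        · rw [hwb, hdist0]; exact min_le_right _ _
        · exact (min_le_left _ _).trans (hfar w hw.1 hwb)
      exact le_antisymm (min_le_min_left _ hle) (le_min (min_le_left _ _) hge)
    · have hge : ∀ y, (∀ w ∈ W, w ≠ M.path h 0 → δ ≤ dist y w) →
          δ ≤ Metric.infDist y (W ∩ Z) := fun y hy =>
        (Metric.le_infDist hnon).2 fun {w} hw => hy w hw.1 fun he => hb (he ▸ hw.2)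
      have h1 : fire W Z δ (M.path h 0) = -δ := by
        rw [fire, if_neg hb, min_eq_left]
        exact hge _ fun w hw hwne => by linarith [le_dist_of_mem hr hst hbase hw hwne]
      rw [hval (Or.inr hb), min_eq_left (hge _ hfar), h1, max_eq_right (by linarith [ht.1])]
  · rw [fireMid, if_neg ha]
    have hin : ∀ s ∈ Ico 0 (M.hlen h), M.path h s ∈ Z := by
      intro s hs
      rcases hs.1.eq_or_lt with rfl | h0
      · exact hZ.closure_subset (path_zero_mem_closure h fun u hu =>
          path_mem_of_not_avoids hfr ha hu)
      · exact path_mem_of_not_avoids hfr ha ⟨h0, hs.2⟩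
    rw [fire, if_pos (hin t ⟨ht.1, by linarith [ht.2]⟩), fire,
      if_pos (hin 0 ⟨le_rfl, hlen_pos h⟩), max_eq_right (by linarith [ht.1])]

end EdgeModel

namespace EdgeModel

theorem fire_of_mem {W Z : Set G} {δ : ℝ} {y : G} (hy : y ∈ Z) : fire W Z δ y = 0 := if_pos hy

/-- Firing a closed subgraph by a small amount moves one chip from each boundary point into every
direction leaving the subgraph. -/
theorem exists_fire [CompactSpace G] [Nonempty G] {W : Set G} (M : EdgeModel W) (hW : W.Finite)
    {Z : Set G} {D : G → ℤ} (hfr : frontier Z ⊆ W) (hDW : support D ⊆ W) (hDe : Effective D)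
    (hfire : CanFire D Z) (hne : (frontier Z).Nonempty) {ε : ℝ} (hε : 0 < ε) :
    ∃ D' : G → ℤ, FinSupp D' ∧ Effective D' ∧ LinEquiv D D' ∧ linDist D D' < ε ∧
      (∀ w ∈ frontier Z, D' w < D w) ∧ (∀ x ∉ frontier Z, D x ≤ D' x) ∧
      ∀ w ∈ frontier Z, degOut Z w ≤ {y | y ∉ W ∧ D' y ≠ 0}.ncard := by
  obtain ⟨-, hZ, -, hdeg⟩ := hfire
  obtain ⟨r, hr0, hr, hst⟩ := M.exists_radius
  set δ := min (r / 4) (ε / 2) with hδdef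
  have hδ : 0 < δ := lt_min (by linarith) (by linarith)
  have hδr : 4 * δ ≤ r := by linarith [min_le_left (r / 4) (ε / 2)]
  have hδε : δ < ε := by linarith [min_le_right (r / 4) (ε / 2)]
  have hL : ∀ h, M.hlen h / 2 < M.hlen h - δ := fun h => by linarith [hr h]
  have hL' : ∀ h, M.hlen h - δ ≤ M.hlen h := fun h => by linarith
  have hf := fire_path hZ hfr hne hr hst hδ hδr
  have hrat := kink_isRational hL hf (continuous_fire hZ hfr hδ.le)
  set f := fire W Z δ with hfdef
  have hmid : ∀ h : M.HalfEdge, fireMid Z δ h < 0 ↔ Avoids Z h := fun h => by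
    rw [fireMid]
    split_ifs with ha <;> simp [ha, hδ]
  have hfrontier : ∀ w ∈ frontier Z, ordAt f w = -(degOut Z w : ℤ) := by
    intro w hw
    rw [kink_ordAt_vertex hL hf (hfr hw), degOut_eq (M := M) hfr (hfr hw), hfdef,
      fire_of_mem (hZ.frontier_subset hw)]
    congr 2
    exact Nat.card_congr (Equiv.subtypeEquivRight fun h => hmid h.1)
  have hnon : (W ∩ Z).Nonempty := hne.mono fun y hy => ⟨hfr hy, hZ.frontier_subset hy⟩
  have hother : ∀ w ∈ W, w ∉ frontier Z → ordAt f w = 0 := by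
    intro w hw hwf
    rw [kink_ordAt_vertex hL hf hw, neg_eq_zero, Nat.cast_eq_zero, Nat.card_eq_zero]
    refine Or.inl ⟨?_⟩
    rintro ⟨⟨h, rfl⟩, hlt⟩
    have ha : Avoids Z h := (hmid h).1 (hlt.trans_le (fire_mem_Icc hδ.le _).2)
    by_cases hwZ : M.path h 0 ∈ Z
    · refine hwf ⟨subset_closure hwZ, fun hi => ?_⟩
      rw [← compl_compl (interior Z), ← closure_compl] at hi
      exact hi (path_zero_mem_closure h ha)
    · have : fireMid Z δ h = -δ := if_pos ha
      rw [hfdef, fire, if_neg hwZ, this, neg_lt_neg_iff, min_eq_left] at hlt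
      · exact lt_irrefl _ hlt
      · refine (Metric.le_infDist hnon).2 fun {y} hy => ?_
        linarith [le_dist_of_mem hr hst hw hy.1 fun he => hwZ (he ▸ hy.2)]
  have hoff : ∀ y ∉ W, 0 ≤ ordAt f y := by
    intro y hy
    obtain ⟨h, t, ht, ht2, rfl⟩ := exists_path_eq (M := M) hy
    rw [kink_ordAt_path hL' hf h ⟨ht.1, ht2.trans_lt (hL h)⟩]
    split_ifs <;> simp
  have hge : ∀ x ∉ frontier Z, 0 ≤ ordAt f x := fun x hx => by
    by_cases hxW : x ∈ W
    · exact (hother x hxW hx).ge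
    · exact hoff x hxW
  have hfin : FinSupp fun x => D x + ordAt f x := by
    refine (hW.union (finite_range
      fun h : M.HalfEdge => M.path h (f (M.path h 0) - fireMid Z δ h))).subset fun y hy => ?_
    by_contra hcon
    rw [mem_union, not_or] at hcon
    obtain ⟨h, t, ht, ht2, rfl⟩ := exists_path_eq (M := M) hcon.1
    refine hy ?_
    have hD0 : D (M.path h t) = 0 := notMem_support.1 fun hs => hcon.1 (hDW hs)
    simp only [hD0, zero_add]
    rw [kink_ordAt_path hL' hf h ⟨ht.1, ht2.trans_lt (hL h)⟩, if_neg]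
    exact fun he => hcon.2 ⟨h, by rw [he]⟩
  refine ⟨fun x => D x + ordAt f x, hfin, fun x => ?_, ⟨f, hrat, fun _ => rfl⟩, ?_, fun w hw => ?_,
    fun x hx => by linarith [hge x hx], fun w hw => ?_⟩
  · by_cases hx : x ∈ frontier Z
    · have := hdeg x hx
      simp only [hfrontier x hx]
      linarith
    · exact add_nonneg (hDe x) (hge x hx)
  · refine (linDist_le hrat (fun _ => rfl) fun x y => abs_le.2 ?_).trans_lt hδε
    have hx := fire_mem_Icc (W := W) (Z := Z) hδ.le x
    have hy := fire_mem_Icc (W := W) (Z := Z) hδ.le y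
    exact ⟨by linarith [hx.1, hy.2], by linarith [hx.2, hy.1]⟩
  · have := degOut_pos hZ hfr M hw
    simp only [hfrontier w hw]
    omega
  · rw [degOut_eq (M := M) hfr (hfr hw), ← Nat.card_coe_set_eq]
    have : Finite {y | y ∉ W ∧ D y + ordAt f y ≠ 0} := hfin.subset fun y hy => hy.2
    have hmem : ∀ h : M.HalfEdge, δ ∈ Ioo 0 (M.hlen h) := fun h => ⟨hδ, by linarith [hr h]⟩
    refine Nat.card_le_card_of_injective (fun h => ⟨M.path h.1.1 δ, path_notMem _ (hmem _), ?_⟩) ?_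
    · obtain ⟨⟨h, rfl⟩, ha⟩ := h
      have hD0 : D (M.path h δ) = 0 :=
        notMem_support.1 fun hs => path_notMem _ (hmem h) (hDW hs)
      have hc : fireMid Z δ h = -δ := if_pos ha
      simp only [hD0, zero_add]
      rw [kink_ordAt_path hL' hf h ⟨hδ, by linarith [hr h]⟩, if_pos]
      · simp
      · rw [hc, hfdef, fire_of_mem (hZ.frontier_subset hw)]
        ring
    · intro h h' he
      have hδr' : δ ∈ Ioo 0 r := ⟨hδ, by linarith⟩
      exact Subtype.ext ((hst w (hfr hw)).inj _ _ δ hδr' δ hδr' (congrArg Subtype.val he))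

end EdgeModel

/-! ### Generic divisors are unsaturated and small -/

theorem unsaturated_of_generic [CompactSpace G] [Nonempty G] {V : Set G} (hV : IsGraphModel V)
    {D₀ D : G → ℤ} (h : Generic V D₀ D) : Unsaturated V D := by
  rintro ⟨Z, ⟨v, hvZ, hvV⟩, hZ⟩
  obtain ⟨⟨hD, hDe, hlin⟩, ε, hε, H⟩ := h
  obtain ⟨M⟩ := exists_edgeModel hV
  have hF := hD.union (M.finite_frontier hZ.2.1 hZ.2.2.1)
  obtain ⟨M'⟩ := M.union hF
  obtain ⟨D', hD', hDe', hlin', hdist, hlt, -, -⟩ := M'.exists_fire (hV.1.union hF)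
    (fun x hx => Or.inr (Or.inr hx)) (fun x hx => Or.inr (Or.inl hx)) hDe hZ ⟨v, hvZ⟩ hε
  have hlin₀ := M.linEquiv_trans hlin hlin'
  exact ((H D' ⟨hD', hDe', hlin₀⟩ hdist).le hV hD hDe hD' hDe' hlin₀).1 v hvV |>.not_gt (hlt v hvZ)

theorem EdgeModel.valence_eq_two {W : Set G} (M : EdgeModel W) {x : G} (hx : x ∉ W) {n : ℕ}
    (hn : HasValence x n) : n = 2 := by
  obtain ⟨h, t, ht, -, rfl⟩ := exists_path_eq (M := M) hx
  obtain ⟨r, hr⟩ := exists_isStar_path h ht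
  rw [← hr.card_eq hn, Nat.card_eq_fintype_card, Fintype.card_bool]

theorem lt_valence_of_generic [CompactSpace G] [Nonempty G] {V : Set G} (hV : IsGraphModel V)
    {D₀ D : G → ℤ} (h : Generic V D₀ D) {x : G} {n : ℕ} (hx : HasValence x n) : D x < n := by
  by_contra! hle
  have huns := unsaturated_of_generic hV h
  obtain ⟨⟨hD, hDe, hlin⟩, ε, hε, H⟩ := h
  obtain ⟨M₀⟩ := exists_edgeModel hV
  have hF := hD.union (finite_singleton x)
  obtain ⟨M⟩ := M₀.union hF
  have hxW : x ∈ V ∪ (support D ∪ {x}) := Or.inr (Or.inr rfl)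
  obtain ⟨r, -, hr⟩ := EdgeModel.exists_isStar_vertex (M := M) hxW
  have hcard := hr.card_eq hx
  have hav : ∀ h : M.HalfEdge, EdgeModel.Avoids {x} h := fun h t ht he =>
    EdgeModel.path_notMem h ht (by rw [mem_singleton_iff.1 he]; exact hxW)
  have hfr : frontier {x} = {x} := by
    refine isClosed_singleton.frontier_subset.antisymm (singleton_subset_iff.2
      ⟨subset_closure rfl, fun hi => ?_⟩)
    obtain ⟨⟨h, h0⟩⟩ := (Nat.card_pos_iff.1 (hcard ▸ hx.pos)).1
    rw [← compl_compl (interior {x}), ← closure_compl] at hi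
    have hcl := EdgeModel.path_zero_mem_closure h (S := {x}ᶜ) (hav h)
    rw [h0] at hcl
    exact hi hcl
  have hsub : frontier {x} ⊆ V ∪ (support D ∪ {x}) := by
    rw [hfr]
    exact singleton_subset_iff.2 hxW
  have hdeg : degOut {x} x = n := by
    rw [EdgeModel.degOut_eq (M := M) hsub hxW, ← hcard]
    exact Nat.card_congr (Equiv.subtypeUnivEquiv fun h => hav h.1)
  have hZ : CanFire D {x} := by
    refine ⟨singleton_nonempty x, isClosed_singleton, ?_, fun y hy => ?_⟩
    · refine (finite_singleton (connectedComponentIn {x} x)).subset ?_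
      rintro _ ⟨y, rfl, rfl⟩
      rfl
    · rw [hfr, mem_singleton_iff] at hy
      rw [hy, hdeg]
      exact hle
  have hxV : x ∉ V := fun hv => huns ⟨{x}, ⟨x, by rw [hfr]; rfl, hv⟩, hZ⟩
  have hn : n = 2 := M₀.valence_eq_two hxV hx
  obtain ⟨D', hD', hDe', hlin', hdist, -, hge, hnew⟩ := M.exists_fire (hV.1.union hF) hsub
    (fun x hx => Or.inr (Or.inl hx)) hDe hZ (by rw [hfr]; exact singleton_nonempty x) hε
  have hlin₀ := M.linEquiv_trans hlin hlin'
  have hcount := ((H D' ⟨hD', hDe', hlin₀⟩ hdist).le hV hD hDe hD' hDe' hlin₀).2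
  have h2 := hnew x (by rw [hfr]; rfl)
  rw [hdeg, hn] at h2
  have hfinD : (edgeSupp V D).Finite := hD.subset fun y hy => hy.2
  have hfinD' : (edgeSupp V D').Finite := hD'.subset fun y hy => hy.2
  have hxD : x ∈ edgeSupp V D := ⟨hxV, fun h0 => by rw [h0, hn] at hle; norm_num at hle⟩
  set N := {y | y ∉ V ∪ (support D ∪ {x}) ∧ D' y ≠ 0} with hN
  have hunion : edgeSupp V D \ {x} ∪ N ⊆ edgeSupp V D' := by
    rintro y (hy | hy)
    · refine ⟨hy.1.1, ?_⟩
      have h1 := hge y (by rw [hfr]; exact hy.2)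
      have h3 := (hDe y).lt_of_ne hy.1.2.symm
      exact (h3.trans_le h1).ne'
    · exact ⟨fun hv => hy.1 (Or.inl hv), hy.2⟩
  have hdisj : Disjoint (edgeSupp V D \ {x}) N :=
    disjoint_left.2 fun y hy hyN => hyN.1 (Or.inr (Or.inl hy.1.2))
  have h1 := ncard_le_ncard hunion hfinD'
  rw [ncard_union_eq hdisj (hfinD.subset sdiff_subset) (hD'.subset fun y hy => hy.2)] at h1
  have h3 := ncard_sdiff_singleton_add_one hxD hfinD
  omega

/-! ### Superlevel sets of rational functions -/

theorem finite_compsOf_sUnion {S : Set (Set G)} (hS : S.Finite)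
    (hpre : ∀ s ∈ S, IsPreconnected s) : (compsOf (⋃₀ S)).Finite := by
  classical
  refine (hS.image fun s => if h : s.Nonempty then connectedComponentIn (⋃₀ S) h.some
    else ∅).subset ?_
  rintro _ ⟨x, ⟨s, hs, hx⟩, rfl⟩
  have hne : s.Nonempty := ⟨x, hx⟩
  refine ⟨s, hs, ?_⟩
  simp only [dif_pos hne]
  exact connectedComponentIn_eq ((hpre s hs).subset_connectedComponentIn hne.some_mem
    (subset_sUnion_of_mem hs) hx)

namespace EdgeModel

variable {W : Set G}

/-- The vertices and closed edges on which `f` is at least `T`, as determined by the values of `f`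
at the vertices and at the midpoints of the edges. -/
def superlevelCells (M : EdgeModel W) (f : G → ℝ) (T : ℝ) : Set (Set G) :=
  (fun w => {w}) '' {w ∈ W | T ≤ f w} ∪
    (fun h : M.HalfEdge => M.path h '' Icc 0 (M.hlen h)) '' {h | T ≤ f (M.path h (M.hlen h / 2))}

/-- The closed subgraph of vertices and edges on which `f` is at least `T`. -/
def superlevel (M : EdgeModel W) (f : G → ℝ) (T : ℝ) : Set G := ⋃₀ M.superlevelCells f T

variable {M : EdgeModel W} {f : G → ℝ} {T : ℝ}

theorem mem_superlevel {y : G} : y ∈ M.superlevel f T ↔ (y ∈ W ∧ T ≤ f y) ∨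
    ∃ h : M.HalfEdge, T ≤ f (M.path h (M.hlen h / 2)) ∧ ∃ t ∈ Icc 0 (M.hlen h), M.path h t = y := by
  simp only [superlevel, superlevelCells, mem_sUnion, mem_union, mem_image, mem_ofPred_eq]
  constructor
  · rintro ⟨_, ⟨w, hw, rfl⟩ | ⟨h, hh, rfl⟩, hy⟩
    · rw [mem_singleton_iff.1 hy]
      exact Or.inl hw
    · exact Or.inr ⟨h, hh, hy⟩
  · rintro (hw | ⟨h, hh, hy⟩)
    · exact ⟨_, Or.inl ⟨y, hw, rfl⟩, rfl⟩
    · exact ⟨_, Or.inr ⟨h, hh, rfl⟩, hy⟩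

theorem finite_superlevelCells (hW : W.Finite) : (M.superlevelCells f T).Finite :=
  ((hW.subset (sep_subset _ _)).image _).union (toFinite _)

theorem isClosed_superlevel (hW : W.Finite) : IsClosed (M.superlevel f T) := by
  rw [superlevel, sUnion_eq_biUnion]
  refine (finite_superlevelCells hW).isClosed_biUnion ?_
  rintro _ (⟨w, -, rfl⟩ | ⟨h, -, rfl⟩)
  · exact isClosed_singleton
  · exact isClosed_path_image h le_rfl le_rfl

theorem finite_compsOf_superlevel (hW : W.Finite) : (compsOf (M.superlevel f T)).Finite := by
  refine finite_compsOf_sUnion (finite_superlevelCells hW) ?_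
  rintro _ (⟨w, -, rfl⟩ | ⟨h, -, rfl⟩)
  · exact isPreconnected_singleton
  · exact isPreconnected_Icc.image _ (continuousOn_path h)

theorem path_mem_superlevel (h : M.HalfEdge) {t : ℝ} (ht : t ∈ Ioo 0 (M.hlen h)) :
    M.path h t ∈ M.superlevel f T ↔ T ≤ f (M.path h (M.hlen h / 2)) := by
  rw [mem_superlevel]
  constructor
  · rintro (⟨hw, -⟩ | ⟨h', hh', s, hs, he⟩)
    · exact (path_notMem h ht hw).elim
    · have hs' : s ∈ Ioo 0 (M.hlen h') := by
        refine ⟨hs.1.lt_of_ne ?_, hs.2.lt_of_ne ?_⟩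
        · rintro rfl
          exact path_notMem h ht (he ▸ path_base_mem h')
        · rintro rfl
          exact path_notMem h ht (he ▸ path_end_mem h')
      rcases path_eq ht hs' he.symm with ⟨rfl, -⟩ | ⟨rfl, -⟩
      · exact hh'
      · rwa [path_flip, hlen_flip, sub_half] at hh'
  · exact fun hT => Or.inr ⟨h, hT, t, Ioo_subset_Icc_self ht, rfl⟩

theorem frontier_superlevel_subset (hW : W.Finite) : frontier (M.superlevel f T) ⊆ W := by
  intro y hy
  by_contra hyW
  obtain ⟨h, t, ht, -, rfl⟩ := exists_path_eq (M := M) hyW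
  have hT := (path_mem_superlevel h ht).1 ((isClosed_superlevel hW).frontier_subset hy)
  refine hy.2 (mem_interior.2 ⟨_, ?_, isOpen_path_image h le_rfl le_rfl, mem_image_of_mem _ ht⟩)
  rintro _ ⟨s, hs, rfl⟩
  exact (path_mem_superlevel h hs).2 hT

theorem avoids_superlevel (h : M.HalfEdge) :
    Avoids (M.superlevel f T) h ↔ f (M.path h (M.hlen h / 2)) < T := by
  rw [← not_le]
  constructor
  · intro ha hT
    have ht : M.hlen h / 2 ∈ Ioo 0 (M.hlen h) := by
      constructor <;> linarith [hlen_pos h]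
    exact ha _ ht ((path_mem_superlevel h ht).2 hT)
  · exact fun hT t ht hm => hT ((path_mem_superlevel h ht).1 hm)

/-- If `D` is unsaturated, no rational function of small oscillation that moves chips of `D`
decreases along an edge starting at a vertex of the model. -/
theorem slope_eq_zero_of_unsaturated (M : EdgeModel W) (hW : W.Finite) {V : Set G} (hVW : V ⊆ W)
    {D : G → ℤ} (huns : Unsaturated V D) {σ : M.HalfEdge → ℤ}
    (hslope : ∀ h, HasSlopeAlong f (M.path h) (σ h)) (hσ : ∀ h, σ h ≤ 0)
    (hmid : ∀ h, f (M.path h (M.hlen h / 2)) ≤ f (M.path h 0))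
    (hlt : ∀ h, f (M.path h (M.hlen h / 2)) < f (M.path h 0) ↔ σ h < 0)
    (heff : ∀ w ∈ W, 0 ≤ D w + ordAt f w) {h : M.HalfEdge} (hV : M.path h 0 ∈ V) : σ h = 0 := by
  classical
  by_contra hne
  have hneg := (hlt h).2 ((hσ h).lt_of_ne hne)
  set T := f (M.path h 0) with hT
  have hfr := frontier_superlevel_subset (M := M) (f := f) (T := T) hW
  have hmem : M.path h 0 ∈ M.superlevel f T := mem_superlevel.2 (Or.inl ⟨hVW hV, le_rfl⟩)
  have hcl := isClosed_superlevel (M := M) (f := f) (T := T) hW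
  refine huns ⟨M.superlevel f T, ⟨M.path h 0, ⟨subset_closure hmem, fun hi => ?_⟩, hV⟩,
    ⟨_, hmem⟩, hcl, finite_compsOf_superlevel hW, fun w hw => ?_⟩
  · rw [← compl_compl (interior _), ← closure_compl] at hi
    exact hi (path_zero_mem_closure h ((avoids_superlevel h).2 hneg))
  · have hwT : T ≤ f w := by
      rcases mem_superlevel.1 (hcl.frontier_subset hw) with hw' | ⟨h', hh', t, ht, rfl⟩
      · exact hw'.2
      · rcases ht.1.eq_or_lt with rfl | h0
        · exact hh'.trans (hmid h')
        · rcases ht.2.eq_or_lt with rfl | h1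
          · have := hmid (M.flip h')
            rw [path_flip, path_flip, hlen_flip, sub_half, sub_zero] at this
            exact hh'.trans this
          · exact (path_notMem h' ⟨h0, h1⟩ (hfr hw)).elim
    have := Fintype.ofFinite {h : M.HalfEdge // M.path h 0 = w}
    have heffw := heff w (hfr hw)
    rw [ordAt_vertex (hfr hw) hslope, finsum_eq_sum_of_fintype] at heffw
    rw [degOut_eq (M := M) hfr (hfr hw), Nat.card_eq_fintype_card, Fintype.card_subtype,
      Finset.card_filter]
    push_cast
    have hle : ∑ h' : {h : M.HalfEdge // M.path h 0 = w},
        (if Avoids (M.superlevel f T) h'.1 then (1 : ℤ) else 0) ≤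
        ∑ h' : {h : M.HalfEdge // M.path h 0 = w}, -σ h' := by
      refine Finset.sum_le_sum fun h' _ => ?_
      split_ifs with ha
      · have := (hlt h').1 (((avoids_superlevel _).1 ha).trans_le (by rw [h'.2]; exact hwT))
        omega
      · exact neg_nonneg.2 (hσ _)
    rw [Finset.sum_neg_distrib] at hle
    linarith

end EdgeModel

/-! ### Homeomorphisms pushing points along edges -/

theorem _root_.IsCompact.continuousOn_image_of_comp {X Y Z : Type*} [TopologicalSpace X]
    [TopologicalSpace Y] [TopologicalSpace Z] [T2Space Y] {K : Set X} (hK : IsCompact K)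
    {ψ : X → Y} (hψ : ContinuousOn ψ K) {g : Y → Z} (hg : ContinuousOn (g ∘ ψ) K) :
    ContinuousOn g (ψ '' K) := by
  refine continuousOn_iff_isClosed.2 fun C hC => ?_
  obtain ⟨u, hu, he⟩ := continuousOn_iff_isClosed.1 hg C hC
  refine ⟨ψ '' (u ∩ K), ((hK.inter_left hu).image_of_continuousOn
    (hψ.mono inter_subset_right)).isClosed, ?_⟩
  rw [← he]
  ext y
  constructor
  · rintro ⟨hy, x, hx, rfl⟩
    exact ⟨⟨x, ⟨hy, hx⟩, rfl⟩, x, hx, rfl⟩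
  · rintro ⟨⟨x, ⟨hx, hxK⟩, rfl⟩, hy⟩
    exact ⟨hx, hy⟩

/-- The homeomorphism of `[-ρ, ρ]` fixing the ends and sending `0` to `a`. -/
noncomputable def slide (a ρ u : ℝ) : ℝ := u + a * (1 - |u| / ρ)

section Slide

variable {a ρ : ℝ}

theorem slide_zero : slide a ρ 0 = a := by simp [slide]

theorem slide_of_abs_eq (hρ : 0 < ρ) {u : ℝ} (hu : |u| = ρ) : slide a ρ u = u := by
  rw [slide, hu, div_self hρ.ne']
  ring

theorem continuous_slide : Continuous (slide a ρ) := by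
  unfold slide
  fun_prop

theorem strictMono_slide (ha : a ∈ Ico 0 ρ) : StrictMono (slide a ρ) := by
  intro u v huv
  have hρ : 0 < ρ := ha.1.trans_lt ha.2
  have h1 : a / ρ < 1 := (div_lt_one hρ).2 ha.2
  have h0 : 0 ≤ a / ρ := div_nonneg ha.1 hρ.le
  have h2 : |v| - |u| ≤ v - u := (abs_sub_abs_le_abs_sub v u).trans_eq (abs_of_pos (by linarith))
  have h3 : slide a ρ v - slide a ρ u = (v - u) - a / ρ * (|v| - |u|) := by
    unfold slide
    ring
  nlinarith [mul_le_mul_of_nonneg_left h2 h0, mul_lt_mul_of_pos_right h1 (sub_pos.2 huv)]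

theorem abs_slide_le (ha : a ∈ Ico 0 ρ) {u : ℝ} (hu : |u| ≤ ρ) : |slide a ρ u| ≤ ρ := by
  have hρ : 0 < ρ := ha.1.trans_lt ha.2
  have h1 := (strictMono_slide ha).monotone (abs_le.1 hu).1
  have h2 := (strictMono_slide ha).monotone (abs_le.1 hu).2
  rw [slide_of_abs_eq hρ (by rw [abs_neg, abs_of_pos hρ])] at h1
  rw [slide_of_abs_eq hρ (abs_of_pos hρ)] at h2
  exact abs_le.2 ⟨h1, h2⟩

theorem abs_slide_lt (ha : a ∈ Ico 0 ρ) {u : ℝ} (hu : |u| < ρ) : |slide a ρ u| < ρ := by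
  have hρ : 0 < ρ := ha.1.trans_lt ha.2
  have h1 := strictMono_slide ha (abs_lt.1 hu).1
  have h2 := strictMono_slide ha (abs_lt.1 hu).2
  rw [slide_of_abs_eq hρ (by rw [abs_neg, abs_of_pos hρ])] at h1
  rw [slide_of_abs_eq hρ (abs_of_pos hρ)] at h2
  exact abs_lt.2 ⟨h1, h2⟩

theorem exists_slide_eq (ha : a ∈ Ico 0 ρ) {u : ℝ} (hu : |u| ≤ ρ) :
    ∃ v, |v| ≤ ρ ∧ slide a ρ v = u := by
  have hρ : 0 < ρ := ha.1.trans_lt ha.2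
  have := intermediate_value_Icc (by linarith : -ρ ≤ ρ)
    (continuous_slide (a := a) (ρ := ρ)).continuousOn
  rw [slide_of_abs_eq hρ (by rw [abs_neg, abs_of_pos hρ]),
    slide_of_abs_eq hρ (abs_of_pos hρ)] at this
  obtain ⟨v, hv, rfl⟩ := this (abs_le.1 hu)
  exact ⟨v, abs_le.2 hv, rfl⟩

end Slide

namespace IsStar

/-- The line through the centre of a star formed by two of its branches. -/
noncomputable def line {X ι : Type*} (γ : ι → ℝ → X) (i j : ι) (u : ℝ) : X :=
  if 0 ≤ u then γ i u else γ j (-u)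

theorem line_of_nonneg {X ι : Type*} {γ : ι → ℝ → X} {i j : ι} {u : ℝ} (hu : 0 ≤ u) :
    line γ i j u = γ i u := if_pos hu

variable {p : G} {ι : Type*} {γ : ι → ℝ → G} {r : ℝ}

theorem line_of_nonpos (h : IsStar p γ r) {i j : ι} {u : ℝ} (hu : u ≤ 0) :
    line γ i j u = γ j (-u) := by
  rcases hu.eq_or_lt with rfl | hu
  · rw [line_of_nonneg le_rfl, neg_zero, h.zero, h.zero]
  · exact if_neg hu.not_ge

theorem dist_line (h : IsStar p γ r) {i j : ι} {u : ℝ} (hu : |u| < r) :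
    dist p (line γ i j u) = |u| := by
  rcases le_total 0 u with h0 | h0
  · rw [line_of_nonneg h0, abs_of_nonneg h0] at *
    exact h.dist_eq i ⟨h0, hu⟩
  · rw [abs_of_nonpos h0] at *
    rw [h.line_of_nonpos h0]
    exact h.dist_eq j ⟨by linarith, hu⟩

theorem line_inj (h : IsStar p γ r) {i j : ι} (hij : i ≠ j) {u v : ℝ} (hu : |u| < r) (hv : |v| < r)
    (he : line γ i j u = line γ i j v) : u = v := by
  wlog huv : v ≤ u generalizing u v
  · exact (this hv hu he.symm (le_of_not_ge huv)).symm
  have habs : |u| = |v| := by rw [← h.dist_line hu, ← h.dist_line hv, he]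
  rcases abs_eq_abs.1 habs with h1 | h1
  · exact h1
  have hv0 : v ≤ 0 := by linarith
  rcases hv0.eq_or_lt with h0 | h0
  · rw [h1, h0, neg_zero]
  · have hr : -v ∈ Ioo 0 r := ⟨by linarith, by rwa [abs_of_neg h0] at hv⟩
    rw [h1, line_of_nonneg hr.1.le, h.line_of_nonpos h0.le] at he
    exact (hij (h.inj _ _ _ hr _ hr he)).elim

theorem exists_line_eq (h : IsStar p γ r) {i j : ι} (hι : ∀ k, k = i ∨ k = j) {y : G}
    (hy : dist p y < r) : ∃ u, |u| < r ∧ line γ i j u = y := by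
  by_cases hyp : y = p
  · exact ⟨0, by rw [abs_zero]; exact h.pos, by rw [line_of_nonneg le_rfl, h.zero, hyp]⟩
  · obtain ⟨k, t, ht, rfl⟩ := h.cover y hyp hy
    rcases hι k with rfl | rfl
    · exact ⟨t, by rw [abs_of_pos ht.1]; exact ht.2, line_of_nonneg ht.1.le⟩
    · exact ⟨-t, by rw [abs_neg, abs_of_pos ht.1]; exact ht.2,
        by rw [h.line_of_nonpos (by linarith [ht.1]), neg_neg]⟩

theorem continuousOn_line (h : IsStar p γ r) {i j : ι} {ρ : ℝ} (hρ : ρ < r) :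
    ContinuousOn (line γ i j) (Icc (-ρ) ρ) := by
  have h1 : ContinuousOn (line γ i j) (Icc 0 ρ) :=
    ((h.continuousOn i).mono fun u hu => ⟨hu.1, hu.2.trans_lt hρ⟩).congr
      fun u hu => line_of_nonneg hu.1
  have h2 : ContinuousOn (line γ i j) (Icc (-ρ) 0) :=
    ((h.continuousOn j).comp continuous_neg.continuousOn fun u hu =>
      ⟨by linarith [hu.2], by linarith [hu.1]⟩).congr fun u hu => h.line_of_nonpos hu.2
  refine (h2.union_of_isClosed h1 isClosed_Icc isClosed_Icc).mono fun u hu => ?_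
  rcases le_total u 0 with h0 | h0
  · exact Or.inl ⟨hu.1, h0⟩
  · exact Or.inr ⟨h0, hu.2⟩

/-- A point in a two-branched star can be pushed along a branch by a homeomorphism supported near
the centre. -/
theorem exists_push [CompactSpace G] (h : IsStar p γ r) {i j : ι} (hij : i ≠ j)
    (hι : ∀ k, k = i ∨ k = j) {a ρ : ℝ} (ha : a ∈ Ico 0 ρ) (hρ : ρ < r) :
    ∃ g : G ≃ₜ G, g p = γ i a ∧ (∀ y, ρ ≤ dist p y → g y = y) ∧
      ∀ y, dist p y < ρ → dist p (g y) < ρ := by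
  classical
  choose! c hc hcy using fun y (hy : dist p y < r) => h.exists_line_eq hι hy
  set g : G → G := fun y => if dist p y < ρ then line γ i j (slide a ρ (c y)) else y with hg
  have hρ0 : 0 < ρ := ha.1.trans_lt ha.2
  have hout : ∀ y, ρ ≤ dist p y → g y = y := fun y hy => if_neg hy.not_gt
  have hline : ∀ u, |u| ≤ ρ → g (line γ i j u) = line γ i j (slide a ρ u) := by
    intro u hu
    have hd := h.dist_line (i := i) (j := j) (hu.trans_lt hρ)
    rcases hu.eq_or_lt with h1 | h1
    · rw [hout _ (hd.trans h1).ge, slide_of_abs_eq hρ0 h1]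
    · have hdr : dist p (line γ i j u) < r := hd.trans_lt (h1.trans hρ)
      rw [hg]
      simp only [hd, h1, if_true]
      rw [h.line_inj hij (hc _ hdr) (hu.trans_lt hρ) (hcy _ hdr)]
  have hin : ∀ y, dist p y < ρ → ∃ u, |u| < ρ ∧ line γ i j u = y := by
    intro y hy
    obtain ⟨u, hu, rfl⟩ := h.exists_line_eq hι (hy.trans hρ)
    rw [h.dist_line hu] at hy
    exact ⟨u, hy, rfl⟩
  have hball : ∀ y, dist p y < ρ → dist p (g y) < ρ := by
    intro y hy
    obtain ⟨u, hu, rfl⟩ := hin y hy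
    have := abs_slide_lt ha hu
    rw [hline u hu.le, h.dist_line (this.trans hρ)]
    exact this
  have hinj : Injective g := by
    intro y z he
    rcases lt_or_ge (dist p y) ρ with hy | hy <;> rcases lt_or_ge (dist p z) ρ with hz | hz
    · obtain ⟨u, hu, rfl⟩ := hin y hy
      obtain ⟨v, hv, rfl⟩ := hin z hz
      rw [hline u hu.le, hline v hv.le] at he
      rw [(strictMono_slide ha).injective (h.line_inj hij ((abs_slide_lt ha hu).trans hρ)
        ((abs_slide_lt ha hv).trans hρ) he)]
    · have := hball y hy
      rw [he, hout z hz] at this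
      exact (this.not_ge hz).elim
    · have := hball z hz
      rw [← he, hout y hy] at this
      exact (this.not_ge hy).elim
    · rwa [hout y hy, hout z hz] at he
  have hsurj : Surjective g := by
    intro y
    rcases lt_or_ge (dist p y) ρ with hy | hy
    · obtain ⟨u, hu, rfl⟩ := hin y hy
      obtain ⟨v, hv, rfl⟩ := exists_slide_eq ha hu.le
      exact ⟨_, hline v hv⟩
    · exact ⟨y, hout y hy⟩
  have hcont : Continuous g := by
    have h1 : ContinuousOn g (line γ i j '' Icc (-ρ) ρ) := by
      refine isCompact_Icc.continuousOn_image_of_comp (h.continuousOn_line hρ) ?_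
      have hmaps : MapsTo (slide a ρ) (Icc (-ρ) ρ) (Icc (-ρ) ρ) :=
        fun u hu => abs_le.1 (abs_slide_le ha (abs_le.2 hu))
      exact ((h.continuousOn_line (i := i) (j := j) hρ).comp continuous_slide.continuousOn
        hmaps).congr fun u hu => hline u (abs_le.2 hu)
    have h2 : ContinuousOn g {y | ρ ≤ dist p y} := continuousOn_id.congr hout
    rw [← continuousOn_univ]
    refine (h1.union_of_isClosed h2
      (isCompact_Icc.image_of_continuousOn (h.continuousOn_line hρ)).isClosed
      (isClosed_le continuous_const (by fun_prop))).mono fun y _ => ?_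
    rcases lt_or_ge (dist p y) ρ with hy | hy
    · obtain ⟨u, hu, rfl⟩ := hin y hy
      exact Or.inl ⟨u, abs_le.1 hu.le, rfl⟩
    · exact Or.inr hy
  refine ⟨hcont.homeoOfEquivCompactToT2 (f := Equiv.ofBijective g ⟨hinj, hsurj⟩), ?_, hout, hball⟩
  have := hline 0 (by rw [abs_zero]; exact hρ0.le)
  rw [line_of_nonneg le_rfl, h.zero, slide_zero, line_of_nonneg ha.1] at this
  exact this

theorem isPreconnected_ball (h : IsStar p γ r) : IsPreconnected (Metric.ball p r) := by
  refine isPreconnected_of_forall p fun y hy => ?_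
  rw [Metric.mem_ball, dist_comm] at hy
  by_cases hyp : y = p
  · exact ⟨{p}, singleton_subset_iff.2 (Metric.mem_ball_self h.pos), rfl, hyp,
      isPreconnected_singleton⟩
  · obtain ⟨i, t, ht, rfl⟩ := h.cover y hyp hy
    refine ⟨γ i '' Icc 0 t, ?_, ⟨0, ⟨le_rfl, ht.1.le⟩, h.zero i⟩, ⟨t, ⟨ht.1.le, le_rfl⟩, rfl⟩,
      isPreconnected_Icc.image _ ((h.continuousOn i).mono fun u hu => ⟨hu.1, hu.2.trans_lt ht.2⟩)⟩
    rintro _ ⟨u, hu, rfl⟩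
    have hur : u < r := hu.2.trans_lt ht.2
    rw [Metric.mem_ball, dist_comm, h.dist_eq i ⟨hu.1, hur⟩]
    exact hur

end IsStar

/-- Pushes supported in disjoint balls can be performed simultaneously. -/
theorem exists_homeomorph_of_pushes {V P : Set G} (hP : P.Finite) {ρ : ℝ} {q : G → G}
    (hpush : ∀ p ∈ P, ∃ g : G ≃ₜ G, g p = q p ∧ (∀ y, ρ ≤ dist p y → g y = y) ∧
      ∀ y, dist p y < ρ → dist p (g y) < ρ)
    (hρ : 0 < ρ) (hsep : ∀ p ∈ P, ∀ p' ∈ P, p ≠ p' → 2 * ρ ≤ dist p p')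
    (hpre : ∀ p ∈ P, IsPreconnected (Metric.ball p ρ))
    (hV : ∀ p ∈ P, Metric.ball p ρ ⊆ Vᶜ) :
    ∃ h : G ≃ₜ G, (∀ y, (∀ p ∈ P, ρ ≤ dist p y) → h y = y) ∧
      (∀ x ∉ V, h x ∈ connectedComponentIn Vᶜ x) ∧ ∀ p ∈ P, h p = q p := by
  induction P, hP using Set.Finite.induction_on with
  | empty =>
    exact ⟨Homeomorph.refl G, fun y _ => rfl, fun x hx => mem_connectedComponentIn hx,
      fun p hp => hp.elim⟩
  | @insert p P hpP _ ih =>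
    obtain ⟨h, hfix, hcomp, hq⟩ := ih (fun p' hp' => hpush p' (Or.inr hp'))
      (fun a ha b hb => hsep a (Or.inr ha) b (Or.inr hb)) (fun a ha => hpre a (Or.inr ha))
      (fun a ha => hV a (Or.inr ha))
    obtain ⟨g, hgp, hgfix, hgball⟩ := hpush p (Or.inl rfl)
    have hgcomp : ∀ z ∉ V, g z ∈ connectedComponentIn Vᶜ z := by
      intro z hz
      rcases lt_or_ge (dist p z) ρ with hd | hd
      · refine (hpre p (Or.inl rfl)).subset_connectedComponentIn ?_ (hV p (Or.inl rfl)) ?_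
        · rwa [Metric.mem_ball, dist_comm]
        · rw [Metric.mem_ball, dist_comm]
          exact hgball z hd
      · rw [hgfix z hd]
        exact mem_connectedComponentIn hz
    refine ⟨h.trans g, fun y hy => ?_, fun x hx => ?_, ?_⟩
    · rw [Homeomorph.trans_apply, hfix y fun a ha => hy a (Or.inr ha), hgfix y (hy p (Or.inl rfl))]
    · rw [Homeomorph.trans_apply, connectedComponentIn_eq (hcomp x hx)]
      exact hgcomp _ (connectedComponentIn_subset _ _ (hcomp x hx))
    · rintro a (rfl | ha)
      · rw [Homeomorph.trans_apply, hfix a fun b hb => ?_, hgp]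
        linarith [hsep b (Or.inr hb) a (Or.inl rfl) fun he => hpP (he ▸ hb)]
      · rw [Homeomorph.trans_apply, hq a ha, hgfix]
        obtain ⟨g', hg'a, -, hg'⟩ := hpush a (Or.inr ha)
        have h1 := hg' a (by rwa [dist_self])
        rw [hg'a] at h1
        have h2 := hsep p (Or.inl rfl) a (Or.inr ha) fun he => hpP (he ▸ ha)
        linarith [dist_triangle_right p a (q a)]

/-! ### Unsaturated small divisors are generic -/

namespace EdgeModel

variable {W : Set G} {M : EdgeModel W} {f : G → ℝ} {D D' : G → ℤ}

/-- An isolated chip at a point of valence two is moved along at most one of the two edges. -/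
theorem exists_chip_target [CompactSpace G] {L c : M.HalfEdge → ℝ}
    (hL : ∀ h, M.hlen h / 2 < L h) (hL' : ∀ h, L h ≤ M.hlen h)
    (hf : ∀ h, ∀ t ∈ Icc 0 (L h), f (M.path h t) = max (f (M.path h 0) - t) (c h))
    (hD : ∀ y ∉ W, D y = 0) (hD' : ∀ x, D' x = D x + ordAt f x) {p : G} (hp : p ∈ W)
    (hDp : D p = 1) (hD'p : 0 ≤ D' p) {r ρ : ℝ}
    (hst : IsStar p (fun h : {h : M.HalfEdge // M.path h 0 = p} => M.path h) r)
    (hcard : Nat.card {h : M.HalfEdge // M.path h 0 = p} = 2) (hρ : ρ < r)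
    (hρL : ∀ h, ρ ≤ L h) (hfρ : ∀ h, f (M.path h 0) - c h < ρ) :
    ∃ q, D' q = 1 ∧ (∃ g : G ≃ₜ G, g p = q ∧ (∀ y, ρ ≤ dist p y → g y = y) ∧
        ∀ y, dist p y < ρ → dist p (g y) < ρ) ∧
      (∀ h, M.path h 0 = p → c h < f p → M.path h (f p - c h) = q) ∧ (D' p ≠ 0 → q = p) := by
  have hv := hD' p
  rw [kink_ordAt_vertex hL hf hp, hDp] at hv
  by_cases hex : ∃ h : {h : M.HalfEdge // M.path h 0 = p}, c h < f p
  · obtain ⟨⟨h, h0⟩, hlt⟩ := hex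
    have hcard1 : Nat.card {h : {h : M.HalfEdge // M.path h 0 = p} // c h < f p} ≤ 1 := by omega
    have hsub := Finite.card_le_one_iff_subsingleton.1 hcard1
    have hpos : 0 < Nat.card {h : {h : M.HalfEdge // M.path h 0 = p} // c h < f p} :=
      have : Nonempty {h : {h : M.HalfEdge // M.path h 0 = p} // c h < f p} := ⟨⟨⟨h, h0⟩, hlt⟩⟩
      Nat.card_pos
    have hfρ' := hfρ h
    rw [h0] at hfρ'
    simp only at hlt
    have hT : f p - c h ∈ Ioo 0 (L h) := ⟨by linarith, hfρ'.trans_le (hρL h)⟩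
    refine ⟨M.path h (f p - c h), ?_, ?_, ?_, fun hne => by omega⟩
    · rw [hD', hD _ (path_notMem h ⟨hT.1, hT.2.trans_le (hL' h)⟩), kink_ordAt_path hL' hf h hT,
        h0, if_pos rfl, zero_add]
    · obtain ⟨j, hj, huniq⟩ := (Nat.card_eq_two_iff' (⟨h, h0⟩ : {h // M.path h 0 = p})).1 hcard
      exact hst.exists_push (i := ⟨h, h0⟩) hj.symm
        (fun k => or_iff_not_imp_left.2 fun hk => huniq k hk) ⟨hT.1.le, hfρ'⟩ hρ
    · intro h' h0' hlt'
      have := congrArg (fun k => k.1.1) (hsub.elim ⟨⟨h', h0'⟩, hlt'⟩ ⟨⟨h, h0⟩, hlt⟩)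
      simp only at this
      rw [this]
  · push Not at hex
    have hempty : IsEmpty {h : {h : M.HalfEdge // M.path h 0 = p} // c h < f p} :=
      ⟨fun h => (hex h.1).not_gt h.2⟩
    rw [Nat.card_of_isEmpty] at hv
    refine ⟨p, by simpa using hv, ⟨Homeomorph.refl G, rfl, fun _ _ => rfl, fun _ h => h⟩,
      fun h h0 hlt => absurd hlt (hex ⟨h, h0⟩).not_gt, fun _ => rfl⟩

end EdgeModel

/-- A divisor of the linear system near an unsaturated divisor all of whose chips in the open
edges are isolated has the same combinatorial type. -/
theorem sameType_of_near [CompactSpace G] {V : Set G} {D₀ D D' : G → ℤ}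
    (M : EdgeModel (V ∪ support D)) (hV : V.Finite) (hD : FinSupp D) (hD₀ : LinEquiv D₀ D)
    (hone : ∀ p ∈ edgeSupp V D, D p = 1)
    (hcard : ∀ p ∈ edgeSupp V D, Nat.card {h : M.HalfEdge // M.path h 0 = p} = 2)
    (huns : Unsaturated V D) {r : ℝ} (hr0 : 0 < r) (hr : ∀ h, r ≤ M.hlen h)
    (hst : ∀ w ∈ V ∪ support D, IsStar w (fun h : {h // M.path h 0 = w} => M.path h) r)
    (hD' : Effective D') (hlin : LinEquiv D D') (hdist : linDist D D' < r / 4) :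
    SameType V D₀ D D' := by
  obtain ⟨f, hf, hDD', hosc⟩ := exists_of_linDist_lt hlin hdist
  have hD0 : ∀ y ∉ V ∪ support D, D y = 0 := fun y hy => by
    by_contra hc
    exact hy (Or.inr hc)
  obtain ⟨σ, hσ⟩ := M.small_osc hf (by linarith : 0 < r / 4) (fun h => by linarith [hr h]) hosc
    fun y hy => by
      have := hDD' y
      rw [hD0 y hy, zero_add] at this
      exact this ▸ hD' y
  have hσV : ∀ h, M.path h 0 ∈ V → σ h = 0 := fun h hh =>
    M.slope_eq_zero_of_unsaturated (hV.union hD) subset_union_left huns (fun h => (hσ h).1)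
      (fun h => (hσ h).2.1) (fun h => (hσ h).2.2.1) (fun h => (hσ h).2.2.2.1)
      (fun w _ => hDD' w ▸ hD' w) hh
  have hbase : ∀ h, M.path h 0 ∉ V → M.path h 0 ∈ edgeSupp V D := fun h hh =>
    ⟨hh, (EdgeModel.path_base_mem h).resolve_left hh⟩
  have hσ1 : ∀ h, -1 ≤ σ h := by
    classical
    intro h
    by_cases hh : M.path h 0 ∈ V
    · rw [hσV h hh]; norm_num
    · have h1 := hDD' (M.path h 0)
      rw [EdgeModel.ordAt_vertex (EdgeModel.path_base_mem h) fun h => (hσ h).1,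
        hone _ (hbase h hh)] at h1
      have := Fintype.ofFinite {h' : M.HalfEdge // M.path h' 0 = M.path h 0}
      rw [finsum_eq_sum_of_fintype] at h1
      have h2 := Finset.single_le_sum (s := Finset.univ)
        (f := fun k : {h' : M.HalfEdge // M.path h' 0 = M.path h 0} => - σ k)
        (fun k _ => by simpa using (hσ k).2.1) (Finset.mem_univ ⟨h, rfl⟩)
      rw [Finset.sum_neg_distrib] at h2
      have h3 := hD' (M.path h 0)
      simp only at h2
      linarith
  have hL : ∀ h, M.hlen h / 2 < M.hlen h - r / 4 := fun h => by linarith [hr h]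
  have hL' : ∀ h, M.hlen h - r / 4 ≤ M.hlen h := fun h => by linarith
  have hkink := fun h => (hσ h).2.2.2.2 (hσ1 h)
  have heqV : ∀ v ∈ V, D v = D' v := fun v hv => by
    rw [hDD', EdgeModel.ordAt_vertex (M := M) (Or.inl hv) fun h => (hσ h).1,
      finsum_eq_zero_of_forall_eq_zero, add_zero]
    exact fun h => hσV h (h.2.symm ▸ hv)
  have htarget : ∀ p ∈ edgeSupp V D, _ := fun p hp =>
    EdgeModel.exists_chip_target hL hL' hkink hD0 hDD' (Or.inr hp.2) (hone p hp) (hD' p)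
      (hst p (Or.inr hp.2)) (hcard p hp) (by linarith : r / 2 < r) (fun h => by linarith [hr h])
      fun h => by linarith [(abs_lt.1 (hosc (M.path h 0) (M.path h (M.hlen h / 2)))).2]
  choose! q hq1 hpush hqpath hqself using htarget
  have hnew : ∀ y ∉ V, D' y ≠ 0 → ∃ p ∈ edgeSupp V D, q p = y := by
    intro y hyV hy
    by_cases hyW : y ∈ support D
    · exact ⟨y, ⟨hyV, hyW⟩, hqself y ⟨hyV, hyW⟩ hy⟩
    · have hyW' : y ∉ V ∪ support D := fun h => h.elim hyV hyW
      obtain ⟨h, t, ht, ht2, rfl⟩ := EdgeModel.exists_path_eq (M := M) hyW'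
      rw [hDD', hD0 _ hyW', zero_add,
        EdgeModel.kink_ordAt_path hL' hkink h ⟨ht.1, ht2.trans_lt (hL h)⟩] at hy
      have hte := of_not_not fun hc => hy (if_neg hc)
      have hlt : f (M.path h (M.hlen h / 2)) < f (M.path h 0) := by linarith [ht.1]
      have hbV : M.path h 0 ∉ V := fun hb => ((hσ h).2.2.2.1.1 hlt).ne (hσV h hb)
      refine ⟨M.path h 0, hbase h hbV, ?_⟩
      rw [← hqpath _ (hbase h hbV) h rfl hlt, ← hte]
  have hsep : ∀ p ∈ edgeSupp V D, ∀ w ∈ V ∪ support D, w ≠ p → r ≤ dist p w := fun p hp w hw hne =>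
    EdgeModel.le_dist_of_mem hr hst (Or.inr hp.2) hw hne
  have hne : ∀ p ∈ edgeSupp V D, ∀ v ∈ V, v ≠ p := fun p hp v hv he => hp.1 (he ▸ hv)
  obtain ⟨φ, hφfix, hφcomp, hφq⟩ := exists_homeomorph_of_pushes (V := V)
    (hD.subset fun y hy => hy.2 : (edgeSupp V D).Finite) hpush (half_pos hr0)
    (fun p hp p' hp' hpp => by linarith [hsep p hp p' (Or.inr hp'.2) hpp.symm])
    (fun p hp => ((hst p (Or.inr hp.2)).mono (half_pos hr0) (by linarith)).isPreconnected_ball)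
    (fun p hp v hv hvV => by
      have := hsep p hp v (Or.inl hvV) (hne p hp v hvV)
      rw [Metric.mem_ball, dist_comm] at hv
      linarith)
  have hφV : ∀ v ∈ V, φ v = v := fun v hv => hφfix v fun p hp => by
    linarith [hsep p hp v (Or.inl hv) (hne p hp v hv)]
  refine ⟨heqV, ⟨φ, hφV, hφcomp, fun x => ?_⟩, ?_⟩
  · by_cases hx : x ∈ V
    · rw [hφV x hx, heqV x hx]
    · by_cases hxD : D x = 0
      · rw [hxD]
        by_contra hc
        obtain ⟨p, hp, hpq⟩ := hnew (φ x) (connectedComponentIn_subset _ _ (hφcomp x hx)) hc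
        rw [← hφq p hp] at hpq
        obtain rfl := φ.injective hpq
        exact hp.2 hxD
      · rw [hφq x ⟨hx, hxD⟩, hq1 x ⟨hx, hxD⟩, hone x ⟨hx, hxD⟩]
  · obtain ⟨f₁, hf₁, hDf₁⟩ := hD₀
    have hnf := (isRational_const (0:ℝ)).sub hf
    refine ⟨f₁, fun x => f₁ x - (0 - f x), hf₁, hf₁.sub hnf, hDf₁, fun x => ?_, fun v hv ζ => ?_⟩
    · rw [M.ordAt_sub hf₁ hnf, M.ordAt_neg hf, hDD', hDf₁]
      ring
    · obtain ⟨h, rfl⟩ := (hst v (Or.inl hv)).dir_bijective.2 ζ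
      obtain ⟨s, hs⟩ := M.exists_slope_vertex hf₁
      have h0 : HasSlopeAlong (fun x => 0 - f x) (M.path h) (0 - σ h) :=
        HasSlopeAlong.sub (f := fun _ => 0) ⟨1, one_pos, fun t _ => by simp⟩ (hσ h).1
      have h1 := (hs h).sub h0
      rw [hσV h (h.2.symm ▸ hv), sub_zero, sub_zero] at h1
      rw [(hst v (Or.inl hv)).tangentSlope_dir (hs h), (hst v (Or.inl hv)).tangentSlope_dir h1]

theorem generic_of_unsaturated [CompactSpace G] [Nonempty G] {V : Set G} (hV : IsGraphModel V)
    {val : G → ℕ} (hval : ∀ x, HasValence x (val x)) {D₀ D : G → ℤ} (hD : D ∈ LinSys D₀)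
    (hlt : ∀ x, D x < val x) (huns : Unsaturated V D) : Generic V D₀ D := by
  refine ⟨hD, ?_⟩
  obtain ⟨hfin, heff, hlin⟩ := hD
  obtain ⟨M₀⟩ := exists_edgeModel hV
  obtain ⟨M⟩ := M₀.union hfin
  obtain ⟨r, hr0, hr, hst⟩ := M.exists_radius
  have hval2 : ∀ p ∈ edgeSupp V D, val p = 2 := fun p hp => M₀.valence_eq_two hp.1 (hval p)
  refine ⟨r / 4, by linarith, fun D' hD' hdist ε hε => ⟨D', ?_, ?_⟩⟩
  · refine sameType_of_near M hV.1 hfin hlin (fun p hp => ?_) (fun p hp => ?_) huns hr0 hr hst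
      hD'.2.1 (M.linEquiv_of_mem hlin hD'.2.2) hdist
    · have h1 := hlt p
      rw [hval2 p hp] at h1
      have h2 := (heff p).lt_of_ne hp.2.symm
      push_cast at h1
      omega
    · rw [(hst p (Or.inr hp.2)).card_eq (hval p), hval2 p hp]
  · exact (linDist_le (isRational_const 0) (fun x => by rw [M.ordAt_const, add_zero])
      (fun x y => by simp)).trans_lt hε

/-- a divisor `D ∈ |D₀|` is generic if and only if `D(x) < val(x)` for
every point `x` and `D` is `V`-unsaturated. -/
theorem generic_iff (hG : IsMetricGraph G) (hconn : ConnectedSpace G)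
    (V : Set G) (hV : IsGraphModel V) (hVl : LoopFree V)
    (val : G → ℕ) (hval : ∀ x, HasValence x (val x))
    (D₀ : G → ℤ) (hD₀ : FinSupp D₀) (hD₀e : Effective D₀)
    (D : G → ℤ) (hD : D ∈ LinSys D₀) :
    Generic V D₀ D ↔ (∀ x, D x < (val x : ℤ)) ∧ Unsaturated V D := by
  have := hG.1
  have : Nonempty G := hconn.toNonempty
  exact ⟨fun h => ⟨fun x => lt_valence_of_generic hV h (hval x), unsaturated_of_generic hV h⟩,
    fun h => generic_of_unsaturated hV hval hD h.1 h.2⟩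

end TropGraph
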